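/- Let G be a finite group with |G| = |L₃(47)| = 2⁶·3·23²·37·47³·61 and degree pattern D(G) = D(L₃(47)) = (3,2,3,1,2,1), i.e., deg_G(2)=3, deg_G(3)=2, deg_G(23)=3, deg_G(37)=1, deg_G(47)=2, deg_G(61)=1. Then G is isomorphic to L₃(47). -/

import Mathlib

open scoped MatrixGroups

/-- Two distinct primes `p` and `q` dividing `|G|` are adjacent in the prime graph `Γ(G)`
of a finite group `G` iff `G` has an element of order `p * q`. -/
def primeGraphAdj (G : Type*) [Group G] (p q : ℕ) : Prop :=
  p ≠ q ∧ p.Prime ∧ q.Prime ∧ p ∣ Nat.card G ∧ q ∣ Nat.card G ∧ ∃ g : G, orderOf g = p * q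

open scoped Classical in
/-- The degree of a vertex `p` in the prime graph of `G`: the number of primes dividing `|G|`
that are adjacent to `p`. -/
noncomputable def primeGraphDeg (G : Type*) [Group G] (p : ℕ) : ℕ :=
  ((Nat.card G).primeFactors.filter (fun r => primeGraphAdj G p r)).card

open scoped MatrixGroups
namespace OD
open Subgroup

instance fact47 : Fact (Nat.Prime 47) := ⟨by norm_num⟩
instance fact37 : Fact (Nat.Prime 37) := ⟨by norm_num⟩
instance fact23 : Fact (Nat.Prime 23) := ⟨by norm_num⟩

/-- the order of the group -/
abbrev ordG : ℕ := 2 ^ 6 * 3 * 23 ^ 2 * 37 * 47 ^ 3 * 61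

lemma ordG_factors : ordG.primeFactors = {2, 3, 23, 37, 47, 61} := by
  have : ordG = 2 ^ 6 * (3 * (23 ^ 2 * (37 * (47 ^ 3 * 61)))) := by norm_num [ordG]
  rw [this, Nat.primeFactors_mul (by norm_num) (by norm_num),
    Nat.primeFactors_mul (by norm_num) (by norm_num),
    Nat.primeFactors_mul (by norm_num) (by norm_num),
    Nat.primeFactors_mul (by norm_num) (by norm_num),
    Nat.primeFactors_mul (by norm_num) (by norm_num),
    Nat.primeFactors_pow _ (by norm_num), Nat.primeFactors_pow _ (by norm_num),
    Nat.primeFactors_pow _ (by norm_num),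
    Nat.Prime.primeFactors (by norm_num), Nat.Prime.primeFactors (by norm_num),
    Nat.Prime.primeFactors (by norm_num), Nat.Prime.primeFactors (by norm_num),
    Nat.Prime.primeFactors (by norm_num), Nat.Prime.primeFactors (by norm_num)]
  rfl

set_option linter.unusedSectionVars false
set_option linter.style.haveILetI false

lemma factorization_eq {n p a m : ℕ} (hp : p.Prime) (h : n = p ^ a * m) (hm : ¬ p ∣ m) :
    n.factorization p = a := by
  have hm0 : m ≠ 0 := fun h0 => hm (by simp [h0])
  rw [h, Nat.factorization_mul (pow_ne_zero _ hp.ne_zero) hm0, Nat.factorization_pow]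
  simp [hp.factorization_self, Nat.factorization_eq_zero_of_not_dvd hm]

variable {G : Type*} [Group G] [Finite G]

lemma adj_symm {p q : ℕ} (h : primeGraphAdj G p q) : primeGraphAdj G q p := by
  obtain ⟨h1, h2, h3, h4, h5, g, hg⟩ := h
  exact ⟨h1.symm, h3, h2, h5, h4, g, by rw [hg, mul_comm]⟩

lemma adj_of_dvd_centralizer {p r : ℕ} (hp : p.Prime) (hr : r.Prime) (hpr : r ≠ p) {x : G}
    (hx : orderOf x = p) (h : r ∣ Nat.card (centralizer ({x} : Set G))) :
    primeGraphAdj G p r := by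
  haveI : Fact r.Prime := ⟨hr⟩
  obtain ⟨y, hy⟩ := exists_prime_orderOf_dvd_card' r h
  have hy' : orderOf (y : G) = r := by rw [← hy]; exact Subgroup.orderOf_coe y
  have hc : Commute x (y : G) := by
    have := y.2
    rw [mem_centralizer_singleton_iff] at this
    exact this.symm
  refine ⟨hpr.symm, hp, hr, hx ▸ orderOf_dvd_natCard x, h.trans (card_subgroup_dvd_card _),
    x * y, ?_⟩
  rw [hc.orderOf_mul_eq_mul_orderOf_of_coprime, hx, hy']
  rw [hx, hy']
  exact (Nat.coprime_primes hp hr).2 hpr.symm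

lemma dvd_centralizer_of_adj {p r : ℕ} (h : primeGraphAdj G p r) :
    ∃ x : G, orderOf x = p ∧ r ∣ Nat.card (centralizer ({x} : Set G)) := by
  obtain ⟨h1, h2, h3, h4, h5, g, hg⟩ := h
  have hgpos : 0 < p * r := Nat.mul_pos h2.pos h3.pos
  refine ⟨g ^ r, ?_, ?_⟩
  · rw [orderOf_pow_of_dvd h3.ne_zero (by rw [hg]; exact dvd_mul_left _ _), hg,
      Nat.mul_div_cancel _ h3.pos]
  · have hgm : g ^ p ∈ centralizer ({g ^ r} : Set G) := by
      rw [mem_centralizer_singleton_iff]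
      rw [← pow_add, ← pow_add, add_comm]
    have : orderOf (g ^ p) = r := by
      rw [orderOf_pow_of_dvd h2.ne_zero (by rw [hg]; exact dvd_mul_right _ _), hg,
        Nat.mul_div_cancel_left _ h2.pos]
    have h6 := _root_.orderOf_dvd_natCard (⟨g ^ p, hgm⟩ : centralizer ({g ^ r} : Set G))
    rw [Subgroup.orderOf_mk, this] at h6
    exact h6

lemma prime_dvd_ordG {r : ℕ} (hr : r.Prime) (h : r ∣ ordG) :
    r = 2 ∨ r = 3 ∨ r = 23 ∨ r = 37 ∨ r = 47 ∨ r = 61 := by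
  have : r ∈ ordG.primeFactors := by
    rw [Nat.mem_primeFactors]; exact ⟨hr, h, by norm_num [ordG]⟩
  rw [ordG_factors] at this
  simpa using this

lemma prime_pow_eq {m s B : ℕ} (hB : m ∣ B) (hB0 : B ≠ 0)
    (h : ∀ r : ℕ, r.Prime → r ∣ m → r = s) : ∃ a, m = s ^ a := by
  have hm0 : m ≠ 0 := fun h0 => hB0 (by subst h0; simpa using hB)
  exact ⟨_, Nat.eq_prime_pow_of_unique_prime_dvd hm0 (fun {r} hr hrm => h r hr hrm)⟩

open scoped Classical in
lemma deg_def (hcard : Nat.card G = ordG) (p : ℕ) : primeGraphDeg G p =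
    (if primeGraphAdj G p 2 then 1 else 0) + (if primeGraphAdj G p 3 then 1 else 0) +
    (if primeGraphAdj G p 23 then 1 else 0) + (if primeGraphAdj G p 37 then 1 else 0) +
    (if primeGraphAdj G p 47 then 1 else 0) + (if primeGraphAdj G p 61 then 1 else 0) := by
  unfold primeGraphDeg
  rw [hcard, ordG_factors, Finset.card_filter]
  rw [Finset.sum_insert (by decide), Finset.sum_insert (by decide), Finset.sum_insert (by decide),
    Finset.sum_insert (by decide), Finset.sum_insert (by decide), Finset.sum_singleton]
  ring

/-- Sylow arithmetic for `N(P)` -/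
lemma norm_card (p : ℕ) [hp : Fact p.Prime] (P : Sylow p G) (hP : Nat.card P = p) {x : G}
    (hx : x ∈ P) (hx1 : x ≠ 1) :
    centralizer (P : Set G) = centralizer ({x} : Set G) ∧
    ∃ e, e ∣ (p - 1) ∧ Nat.card (normalizer (P : Set G)) =
      Nat.card (centralizer ({x} : Set G)) * e := by
  have hz : zpowers x = (P : Subgroup G) := by
    have hle : zpowers x ≤ P := by rwa [zpowers_le]
    apply eq_of_le_of_card_ge hle
    rw [Nat.card_zpowers]
    have h1 : orderOf x ∣ p := by
      have := Subgroup.orderOf_dvd_natCard (P : Subgroup G) hx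
      rwa [hP] at this
    rcases (Nat.dvd_prime hp.out).1 h1 with h | h
    · exact absurd (orderOf_eq_one_iff.1 h) hx1
    · rw [h]; exact hP.le
  have hcen : centralizer (P : Set G) = centralizer ({x} : Set G) := by
    have : centralizer ((zpowers x : Subgroup G) : Set G) = centralizer ({x} : Set G) := by
      rw [zpowers_eq_closure, centralizer_closure]
    rw [← this, hz]; rfl
  refine ⟨hcen, ?_⟩
  have hcyc : IsCyclic P := isCyclic_of_prime_card hP
  let f := (P : Subgroup G).normalizerMonoidHom
  have h1 : Nat.card f.range ∣ p - 1 := by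
    have := card_subgroup_dvd_card f.range
    rw [IsCyclic.card_mulAut, hP, Nat.totient_prime hp.out] at this
    exact this
  refine ⟨_, h1, ?_⟩
  have h2 : Nat.card f.ker = Nat.card (centralizer ({x} : Set G)) := by
    rw [normalizerMonoidHom_ker, ← hcen]
    have hle : centralizer (P : Set G) ≤ normalizer (P : Set G) := centralizer_le_normalizer _
    exact Nat.card_congr (subgroupOfEquivOfLe hle).toEquiv
  rw [← h2, mul_comm, ← index_ker]
  exact (index_mul_card f.ker).symm

lemma exists_sylow_prime (hcard : Nat.card G = ordG) (P : Sylow 37 G) : Nat.card P = 37 := by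
  rw [P.card_eq_multiplicity, hcard]
  have : ordG.factorization 37 = 1 := by
    exact factorization_eq (m := 2 ^ 6 * 3 * 23 ^ 2 * 47 ^ 3 * 61) (by norm_num) (by norm_num [ordG])
      (by norm_num)
  rw [this, pow_one]

/-- The arithmetic behind the uniqueness of the neighbour of `37`. -/
lemma arith37 {s a e n : ℕ} (hs : s = 2 ∨ s = 3 ∨ s = 23 ∨ s = 47 ∨ s = 61)
    (he : e ∣ 36) (hn : n ≡ 1 [MOD 37])
    (h : n * (s ^ a * e) = 2 ^ 6 * 3 * 23 ^ 2 * 47 ^ 3 * 61) : s = 61 ∧ a = 1 ∧ e = 3 := by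
  have hmod : s ^ a * e ≡ 2 ^ 6 * 3 * 23 ^ 2 * 47 ^ 3 * 61 [MOD 37] := by
    rw [← h]
    simpa using (hn.symm.mul_right (s ^ a * e))
  have hdvd : s ^ a * e ∣ 2 ^ 6 * 3 * 23 ^ 2 * 47 ^ 3 * 61 := ⟨n, by rw [← h]; ring⟩
  have hdvd2 : s ^ a ∣ 2 ^ 6 * 3 * 23 ^ 2 * 47 ^ 3 * 61 := (dvd_mul_right _ _).trans hdvd
  have hs' : s.Prime := by rcases hs with h | h | h | h | h <;> subst h <;> norm_num
  have ha : a ≤ 6 := by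
    by_contra hcon
    have h7 : s ^ 7 ∣ 2 ^ 6 * 3 * 23 ^ 2 * 47 ^ 3 * 61 := (pow_dvd_pow _ (by omega)).trans hdvd2
    rcases hs with h | h | h | h | h <;> subst h <;> revert h7 <;> norm_num
  have he' : e ∈ Nat.divisors 36 := by rw [Nat.mem_divisors]; exact ⟨he, by norm_num⟩
  have hd : Nat.divisors 36 = {1, 2, 3, 4, 6, 9, 12, 18, 36} := by decide
  rw [hd] at he'
  have key : ∀ s ∈ ({2, 3, 23, 47, 61} : Finset ℕ), ∀ a ∈ Finset.range 7,
    ∀ e ∈ ({1, 2, 3, 4, 6, 9, 12, 18, 36} : Finset ℕ),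
      (s ^ a * e) % 37 = (2 ^ 6 * 3 * 23 ^ 2 * 47 ^ 3 * 61) % 37 →
      (2 ^ 6 * 3 * 23 ^ 2 * 47 ^ 3 * 61) % (s ^ a * e) = 0 → s = 61 ∧ a = 1 ∧ e = 3 := by
    decide +kernel
  exact key s (by simpa using hs) a (by simp; omega) e he' hmod (Nat.mod_eq_zero_of_dvd hdvd)

/-- The consequences of the order and of the degree pattern that are used below. -/
structure Hyp (G : Type*) [Group G] [Finite G] : Prop where
  card : Nat.card G = ordG
  cent47 : ∀ x : G, orderOf x = 47 → Nat.card (centralizer ({x} : Set G)) ∣ 2 ^ 6 * 23 ^ 2 * 47 ^ 3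
  noniso : ∃ x : G, orderOf x = 47 ∧ ∃ r : ℕ, r.Prime ∧ r ≠ 47 ∧
    r ∣ Nat.card (centralizer ({x} : Set G))
  cent37 : ∀ x : G, orderOf x = 37 → Nat.card (centralizer ({x} : Set G)) ∣ 37 * 61
  norm37 : ∀ P : Sylow 37 G, Nat.card (normalizer (P : Set G)) = 3 * 37 * 61

lemma dvd_of_not_prime_dvd {m a b : ℕ} (h : m ∣ a * b)
    (hb : ∀ r : ℕ, r.Prime → r ∣ b → ¬ r ∣ m) : m ∣ a := by
  refine Nat.Coprime.dvd_of_dvd_mul_right ?_ h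
  rw [Nat.coprime_iff_gcd_eq_one]
  by_contra hne
  obtain ⟨r, hr, hrd⟩ := Nat.exists_prime_and_dvd hne
  exact hb r hr (hrd.trans (Nat.gcd_dvd_right _ _)) (hrd.trans (Nat.gcd_dvd_left _ _))

theorem hyp_of_pattern (hcard : Nat.card G = ordG)
    (hdeg2 : primeGraphDeg G 2 = 3)
    (hdeg23 : primeGraphDeg G 23 = 3)
    (hdeg37 : primeGraphDeg G 37 = 1)
    (hdeg47 : primeGraphDeg G 47 = 2)
    (hdeg61 : primeGraphDeg G 61 = 1) : Hyp G := by
  classical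
  have h22 : ∀ p, ¬ primeGraphAdj G p p := fun p h => h.1 rfl
  -- the neighbour of 37
  have h37 : ∃ s, (s = 2 ∨ s = 3 ∨ s = 23 ∨ s = 47 ∨ s = 61) ∧ 
      ∀ r, primeGraphAdj G 37 r → r = s := by
    rw [deg_def hcard] at hdeg37
    have hr : ∀ r, primeGraphAdj G 37 r → (r = 2 ∨ r = 3 ∨ r = 23 ∨ r = 37 ∨ r = 47 ∨ r = 61) :=
      fun r h => prime_dvd_ordG h.2.2.1 (hcard ▸ h.2.2.2.2.1)
    have h37 := h22 37
    by_cases a2 : primeGraphAdj G 37 2 <;> by_cases a3 : primeGraphAdj G 37 3 <;>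
    by_cases a23 : primeGraphAdj G 37 23 <;> by_cases a47 : primeGraphAdj G 37 47 <;>
    by_cases a61 : primeGraphAdj G 37 61 <;> simp [a2, a3, a23, a47, a61, h37] at hdeg37
    · exact ⟨2, by simp, fun r h => by
        rcases hr r h with rfl | rfl | rfl | rfl | rfl | rfl <;> first | rfl | contradiction⟩
    · exact ⟨3, by simp, fun r h => by
        rcases hr r h with rfl | rfl | rfl | rfl | rfl | rfl <;> first | rfl | contradiction⟩
    · exact ⟨23, by simp, fun r h => by
        rcases hr r h with rfl | rfl | rfl | rfl | rfl | rfl <;> first | rfl | contradiction⟩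
    · exact ⟨47, by simp, fun r h => by
        rcases hr r h with rfl | rfl | rfl | rfl | rfl | rfl <;> first | rfl | contradiction⟩
    · exact ⟨61, by simp, fun r h => by
        rcases hr r h with rfl | rfl | rfl | rfl | rfl | rfl <;> first | rfl | contradiction⟩
  obtain ⟨s, hs, hsu⟩ := h37
  have main : ∀ x : G, orderOf x = 37 → ∀ P : Sylow 37 G, x ∈ P →
      s = 61 ∧ Nat.card (centralizer ({x} : Set G)) = 37 * 61 ∧
      Nat.card (normalizer (P : Set G)) = 3 * 37 * 61 := by
    intro x hx P hxP
    have hP := exists_sylow_prime hcard P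
    have hx1 : x ≠ 1 := by rintro rfl; simp at hx
    obtain ⟨-, e, he, hN⟩ := norm_card 37 P hP hxP hx1
    have hC : 37 ∣ Nat.card (centralizer ({x} : Set G)) := by
      have hxm : x ∈ centralizer ({x} : Set G) := by rw [mem_centralizer_singleton_iff]
      have := Subgroup.orderOf_dvd_natCard _ hxm
      rwa [hx] at this
    obtain ⟨m, hm⟩ := hC
    have hmd : m ∣ 2 ^ 6 * 3 * 23 ^ 2 * 47 ^ 3 * 61 := by
      have := card_subgroup_dvd_card (centralizer ({x} : Set G))
      rw [hm, hcard] at this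
      have h2 : ordG = 37 * (2 ^ 6 * 3 * 23 ^ 2 * 47 ^ 3 * 61) := by norm_num [ordG]
      rw [h2] at this
      exact Nat.dvd_of_mul_dvd_mul_left (by norm_num) this
    obtain ⟨a, ha⟩ : ∃ a, m = s ^ a := by
      refine prime_pow_eq hmd (by norm_num) ?_
      intro r hr hrm
      apply hsu
      refine adj_of_dvd_centralizer (by norm_num) hr ?_ hx (by rw [hm]; exact hrm.mul_left _)
      rintro rfl
      have := hrm.trans hmd
      revert this; norm_num
    have hidx := index_mul_card (normalizer (P : Set G))
    have hsy := card_sylow_modEq_one 37 G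
    rw [P.card_eq_index_normalizer] at hsy
    rw [hN, hm, ha, hcard] at hidx
    obtain ⟨r1, r2, r3⟩ := arith37 hs (by simpa using he) hsy (a := a)
      (by
        have h2 : ordG = 37 * (2 ^ 6 * 3 * 23 ^ 2 * 47 ^ 3 * 61) := by norm_num [ordG]
        rw [h2] at hidx
        apply Nat.eq_of_mul_eq_mul_left (show 0 < 37 by norm_num)
        rw [← hidx]; ring)
    subst r1 r2 r3
    refine ⟨rfl, by rw [hm, ha]; norm_num, by rw [hN, hm, ha]; norm_num⟩
  have hcomm37 : ∀ x : G, orderOf x = 37 → ∃ P : Sylow 37 G, x ∈ P := by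
    intro x hx
    have hp : IsPGroup 37 (zpowers x) := IsPGroup.of_card (n := 1) (by rw [Nat.card_zpowers, hx]; rfl)
    obtain ⟨P, hP⟩ := hp.exists_le_sylow
    exact ⟨P, hP (mem_zpowers x)⟩
  have hex : ∀ P : Sylow 37 G, ∃ x ∈ P, orderOf x = 37 := by
    intro P
    have hP := exists_sylow_prime hcard P
    obtain ⟨y, hy⟩ := exists_prime_orderOf_dvd_card' (G := P) 37 (by rw [hP])
    exact ⟨y, y.2, (Subgroup.orderOf_coe y).trans hy⟩
  have hs61 : s = 61 := by
    obtain ⟨x, hxP, hx⟩ := hex default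
    exact (main x hx _ hxP).1
  subst hs61
  have n37 : ∀ r, r ≠ 61 → ¬ primeGraphAdj G r 37 := fun r hr h => hr (hsu r (adj_symm h))
  have a3761 : primeGraphAdj G 61 37 := by
    by_contra hcon
    rw [deg_def hcard] at hdeg37
    have h1 : ¬ primeGraphAdj G 37 2 := fun h => by simpa using hsu _ h
    have h2 : ¬ primeGraphAdj G 37 3 := fun h => by simpa using hsu _ h
    have h3 : ¬ primeGraphAdj G 37 23 := fun h => by simpa using hsu _ h
    have h4 : ¬ primeGraphAdj G 37 47 := fun h => by simpa using hsu _ h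
    have h5 : ¬ primeGraphAdj G 37 61 := fun h => hcon (adj_symm h)
    simp [h1, h2, h3, h4, h5, h22 37] at hdeg37
  have n61 : ∀ r, r ≠ 37 → ¬ primeGraphAdj G r 61 := by
    intro r hr h
    have h' := adj_symm h
    rw [deg_def hcard] at hdeg61
    have h61 := h22 61
    rcases prime_dvd_ordG h'.2.2.1 (hcard ▸ h'.2.2.2.2.1) with rfl | rfl | rfl | rfl | rfl | rfl
    all_goals first | contradiction | (simp only [h', a3761, h61, if_true, if_false] at hdeg61; split_ifs at hdeg61 <;> omega) | (simp only [h', a3761, h61, if_true, if_false] at hdeg61; omega)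
  rw [deg_def hcard] at hdeg2 hdeg23 hdeg47
  have b1 := h22 2
  have b2 := n37 2 (by norm_num)
  have b3 := n61 2 (by norm_num)
  have b4 := n37 3 (by norm_num)
  have b5 := n61 3 (by norm_num)
  have b6 := n37 47 (by norm_num)
  have b7 := n61 47 (by norm_num)
  have b8 := h22 3
  have b9 := h22 47
  have a247 : primeGraphAdj G 2 47 := by
    by_contra h
    simp only [h, b1, b2, b3, if_false] at hdeg2
    split_ifs at hdeg2 <;> omega
  have n347 : ¬ primeGraphAdj G 47 3 := by
    intro h
    have c1 := h22 23
    have c2 := n37 23 (by norm_num)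
    have c3 := n61 23 (by norm_num)
    have c4 : primeGraphAdj G 23 47 := by
      by_contra h
      simp only [h, c1, c2, c3, if_false] at hdeg23
      split_ifs at hdeg23 <;> omega
    have c5 := adj_symm c4
    have c6 := adj_symm a247
    simp only [h, c5, c6, b6, b7, b9, if_true, if_false] at hdeg47
    omega
  refine ⟨hcard, ?_, ?_, ?_, ?_⟩
  · intro x hx
    have h1 := card_subgroup_dvd_card (centralizer ({x} : Set G))
    rw [hcard] at h1
    have h2 : ordG = (2 ^ 6 * 23 ^ 2 * 47 ^ 3) * (3 * (37 * 61)) := by norm_num [ordG]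
    rw [h2] at h1
    apply dvd_of_not_prime_dvd h1
    intro r hr hrd hrc
    have h3 : r = 3 ∨ r = 37 ∨ r = 61 := by
      rcases (Nat.Prime.dvd_mul hr).1 hrd with h | h
      · left; exact (Nat.prime_dvd_prime_iff_eq hr (by norm_num)).1 h
      · rcases (Nat.Prime.dvd_mul hr).1 h with h | h
        · right; left; exact (Nat.prime_dvd_prime_iff_eq hr (by norm_num)).1 h
        · right; right; exact (Nat.prime_dvd_prime_iff_eq hr (by norm_num)).1 h
    have h4 : primeGraphAdj G 47 r := adj_of_dvd_centralizer (by norm_num) hr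
      (by rcases h3 with rfl | rfl | rfl <;> norm_num) hx hrc
    rcases h3 with rfl | rfl | rfl <;> contradiction
  · obtain ⟨x, hx, h⟩ := dvd_centralizer_of_adj (adj_symm a247)
    exact ⟨x, hx, 2, by norm_num, by norm_num, h⟩
  · intro x hx
    obtain ⟨P, hP⟩ := hcomm37 x hx
    rw [(main x hx P hP).2.1]
  · intro P
    obtain ⟨x, hxP, hx⟩ := hex P
    exact (main x hx _ hxP).2.2
end OD
open scoped MatrixGroups
namespace OD
open Subgroup
open scoped Pointwise
set_option linter.style.haveILetI false

lemma r_part {S K : Type*} [Group S] [Group K] [Finite S] [Finite K] [MulDistribMulAction S K]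
    (hS : IsPGroup 47 S) (hK : Nat.card K ∣ 2 ^ 6 * 23 ^ 2) (r : ℕ) [Fact r.Prime]
    (hr : ∀ a b, b ≤ a → r ^ a ∣ 2 ^ 6 * 23 ^ 2 → r ^ a ≡ r ^ b [MOD 47] → a = b) (P₀ : Sylow r K) :
    Nat.card P₀ ∣ Nat.card (FixedPoints.subgroup S K) := by
  have h47 : ¬ 47 ∣ Nat.card (Sylow r K) := by
    intro h
    have := (h.trans P₀.card_dvd_index).trans ((index_dvd_card _).trans hK)
    revert this; norm_num
  obtain ⟨P, hP⟩ := hS.nonempty_fixed_point_of_prime_not_dvd_card (Sylow r K) h47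
  have hmem : ∀ (s : S) (x : K), x ∈ P → s • x ∈ P := by
    intro s x hx
    have h1 := hP s
    have h2 : s • x ∈ s • P := by
      rw [← SetLike.mem_coe]
      exact Set.smul_mem_smul_set hx
    rwa [h1] at h2
  letI : MulAction S P :=
    { smul := fun s x => ⟨s • (x : K), hmem s x x.2⟩
      one_smul := fun x => Subtype.ext (one_smul S (x : K))
      mul_smul := fun a b x => Subtype.ext (mul_smul a b (x : K)) }
  have h1 := hS.card_modEq_card_fixedPoints P
  have h2 : Nat.card (MulAction.fixedPoints S P) =
      Nat.card ((FixedPoints.subgroup S K).subgroupOf P) := by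
    apply Nat.card_congr
    refine Equiv.subtypeEquivRight ?_
    intro x
    rw [mem_subgroupOf]
    constructor
    · intro h s; exact congrArg Subtype.val (h s)
    · intro h s; exact Subtype.ext (h s)
  rw [h2] at h1
  obtain ⟨a, ha⟩ := IsPGroup.iff_card.1 P.2
  have h3 := card_subgroup_dvd_card ((FixedPoints.subgroup S K).subgroupOf P)
  have ha' : Nat.card P = r ^ a := ha
  rw [ha'] at h3 h1
  obtain ⟨b, hb, hb'⟩ := (Nat.dvd_prime_pow (Fact.out)).1 h3
  rw [hb'] at h1
  have := hr a b hb (ha ▸ (card_subgroup_dvd_card _).trans hK) h1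
  subst this
  have h4 : (P : Subgroup K) ≤ FixedPoints.subgroup S K := by
    rw [← subgroupOf_eq_top]
    apply eq_top_of_card_eq
    rw [hb', ha']
  have h5 : Nat.card P₀ = Nat.card P := by
    rw [P.card_eq_multiplicity, P₀.card_eq_multiplicity]
  rw [h5]
  exact card_dvd_of_le h4

lemma prime_2_23 {p : ℕ} (hp : p.Prime) (h : p ∣ 2 ^ 6 * 23 ^ 2) : p = 2 ∨ p = 23 := by
  rcases (Nat.Prime.dvd_mul hp).1 h with h | h
  · left; exact (Nat.prime_dvd_prime_iff_eq hp (by norm_num)).1 (hp.dvd_of_dvd_pow h)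
  · right; exact (Nat.prime_dvd_prime_iff_eq hp (by norm_num)).1 (hp.dvd_of_dvd_pow h)

lemma L0 {S K : Type*} [Group S] [Group K] [Finite S] [Finite K] [MulDistribMulAction S K]
    (hS : IsPGroup 47 S) (hK : Nat.card K ∣ 2 ^ 6 * 23 ^ 2) (s : S) (k : K) : s • k = k := by
  have hd : Nat.card K ∣ Nat.card (FixedPoints.subgroup S K) := by
    rw [Nat.dvd_iff_prime_pow_dvd_dvd]
    intro p k hp hpk
    rcases Nat.eq_zero_or_pos k with rfl | hk
    · simp
    haveI : Fact p.Prime := ⟨hp⟩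
    have P₀ : Sylow p K := default
    have h1 := P₀.pow_dvd_card_of_pow_dvd_card hpk
    refine h1.trans (r_part hS hK p ?_ P₀)
    rcases prime_2_23 hp ((dvd_pow_self p hk.ne').trans (hpk.trans hK)) with rfl | rfl
    · intro a b hab h
      have : a ≤ 6 := by
        by_contra hcon
        have h7 : 2 ^ 7 ∣ 2 ^ 6 * 23 ^ 2 := (pow_dvd_pow 2 (by omega)).trans h
        revert h7; norm_num
      intro h
      have key : ∀ a < 7, ∀ b < 7, 2 ^ a % 47 = 2 ^ b % 47 → a = b := by decide
      exact key a (by omega) b (by omega) h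
    · intro a b hab h
      have : a ≤ 2 := by
        by_contra hcon
        have h7 : 23 ^ 3 ∣ 2 ^ 6 * 23 ^ 2 := (pow_dvd_pow 23 (by omega)).trans h
        revert h7; norm_num
      intro h
      have key : ∀ a < 3, ∀ b < 3, 23 ^ a % 47 = 23 ^ b % 47 → a = b := by decide
      exact key a (by omega) b (by omega) h
  have htop : FixedPoints.subgroup S K = ⊤ :=
    eq_top_of_card_eq _ (Nat.dvd_antisymm (card_subgroup_dvd_card _) hd)
  have : k ∈ FixedPoints.subgroup S K := by rw [htop]; trivial
  exact this s

lemma L0' {X : Type*} [Group X] [Finite X] (K S : Subgroup X) [K.Normal]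
    (hS : IsPGroup 47 S) (hK : Nat.card K ∣ 2 ^ 6 * 23 ^ 2) {s k : X} (hs : s ∈ S) (hk : k ∈ K) :
    s * k = k * s := by
  letI : MulDistribMulAction S K :=
    MulDistribMulAction.compHom K ((MulAut.conjNormal : X →* MulAut K).comp S.subtype)
  have h := L0 hS hK (⟨s, hs⟩ : S) (⟨k, hk⟩ : K)
  have h' : s * k * s⁻¹ = k := congrArg Subtype.val h
  rw [mul_inv_eq_iff_eq_mul] at h'
  exact h'

lemma le_sylow_of_normal {p : ℕ} {Y : Type*} [Group Y] {D : Subgroup Y} [D.Normal]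
    (hD : IsPGroup p D) (S : Sylow p Y) : D ≤ S := by
  have h1 : IsPGroup p (D ⊔ S : Subgroup Y) := hD.to_sup_of_normal_left S.2
  have h2 := S.is_maximal' h1 le_sup_right
  rw [← h2]; exact le_sup_left

lemma L5 {Y : Type*} [Group Y] [Finite Y] (D C : Subgroup Y) [D.Normal] [C.Normal] (hDC : D ≤ C)
    (hD : IsPGroup 47 D) {c : ℕ} (hC : Nat.card C = Nat.card D * c) (hc : c ∣ 2 ^ 6 * 23 ^ 2)
    {k : ℕ} (hi : C.index = 47 ^ k) (S : Sylow 47 Y) : (S : Subgroup Y).Normal := by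
  have hDS : D ≤ S := le_sylow_of_normal hD S
  let π := QuotientGroup.mk' D
  have hK : Nat.card (C.map π) = c := by
    have h1 := card_eq_card_quotient_mul_card_subgroup (D.subgroupOf C)
    have h2 : Nat.card (C.map π) = Nat.card (C ⧸ D.subgroupOf C) := by
      have e := (QuotientGroup.quotientKerEquivRange (π.comp C.subtype))
      rw [MonoidHom.range_comp, C.range_subtype] at e
      rw [← Nat.card_congr e.toEquiv]
      have : (π.comp C.subtype).ker = D.subgroupOf C := by
        rw [← MonoidHom.comap_ker, QuotientGroup.ker_mk']; rfl
      rw [this]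
    rw [Nat.card_congr (subgroupOfEquivOfLe hDC).toEquiv, ← h2, hC, mul_comm] at h1
    exact (Nat.eq_of_mul_eq_mul_right Nat.card_pos h1).symm
  haveI : (C.map π).Normal := Normal.map ‹_› π (QuotientGroup.mk'_surjective D)
  have hS : IsPGroup 47 ((S : Subgroup Y).map π) := S.2.map π
  have hcomm : ∀ s ∈ S, ∀ x ∈ C, π s * π x = π x * π s := by
    intro s hs x hx
    exact L0' (C.map π) ((S : Subgroup Y).map π) hS (hK ▸ hc) (mem_map_of_mem _ hs)
      (mem_map_of_mem _ hx)
  have htop : (S : Subgroup Y) ⊔ C = ⊤ := by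
    rw [← index_eq_one]
    have h1 : ((S : Subgroup Y) ⊔ C).index ∣ 47 ^ k := hi ▸ index_dvd_of_le le_sup_right
    have h2 : ((S : Subgroup Y) ⊔ C).index ∣ (S : Subgroup Y).index := index_dvd_of_le le_sup_left
    obtain ⟨j, -, hj⟩ := (Nat.dvd_prime_pow (by norm_num)).1 h1
    rcases Nat.eq_zero_or_pos j with rfl | hj0
    · simpa using hj
    · exfalso
      apply S.not_dvd_index
      refine dvd_trans ?_ h2
      rw [hj]; exact dvd_pow_self _ hj0.ne'
  rw [← normalizer_eq_top_iff, eq_top_iff, ← htop, sup_le_iff]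
  refine ⟨le_normalizer, ?_⟩
  intro x hx
  have key : ∀ x ∈ C, ∀ s ∈ S, x * s * x⁻¹ ∈ S := by
    intro x hx s hs
    have h1 := hcomm s hs x hx
    rw [← map_mul, ← map_mul] at h1
    have h2 : (s * x)⁻¹ * (x * s) ∈ D := QuotientGroup.eq.1 h1
    have h3 : x * s * x⁻¹ = s * (x * ((s * x)⁻¹ * (x * s)) * x⁻¹) := by group
    rw [h3]
    exact mul_mem hs (hDS (Normal.conj_mem ‹_› _ h2 x))
  rw [mem_normalizer_iff]
  intro s
  refine ⟨key x hx s, fun h => ?_⟩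
  have := key x⁻¹ (inv_mem hx) _ h
  have h4 : s ∈ S := by simpa [mul_assoc] using this
  exact h4

lemma L1 {X : Type*} [Group X] [Finite X] {k c : ℕ} (hX : Nat.card X = 47 ^ k * c)
    (hc : c ∣ 2 ^ 6 * 23 ^ 2) (Q : Sylow 47 X)
    (hQ : normalizer (Q : Set X) ≤ centralizer (Q : Set X)) : (Q : Subgroup X).Normal := by
  have hcompl := MonoidHom.ker_transferSylow_isComplement' Q hQ
  set N := (MonoidHom.transferSylow Q hQ).ker
  have hc47 : ¬ 47 ∣ c := fun h => by have := h.trans hc; revert this; norm_num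
  have hQc : Nat.card Q = 47 ^ k := by
    rw [Q.card_eq_multiplicity, factorization_eq (by norm_num) hX hc47]
  have h1 := hcompl.card_mul_card
  have h2 : Nat.card (Q : Subgroup X) = 47 ^ k := hQc
  have hN : Nat.card N = c := by
    rw [h2, hX, mul_comm] at h1
    exact Nat.eq_of_mul_eq_mul_left (by positivity) h1
  refine L5 ⊥ N bot_le (IsPGroup.of_bot) (c := c) (by simp [hN]) hc (k := k) ?_ Q
  have h3 := index_mul_card N
  rw [hN, hX] at h3
  exact Nat.eq_of_mul_eq_mul_right (Nat.pos_of_dvd_of_pos hc (by norm_num)) h3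

lemma dvd_card_of_orbits {S Z : Type*} [Group S] [Finite Z] [MulAction S Z] (m : ℕ)
    (h : ∀ z : Z, m ∣ Nat.card (MulAction.orbit S z)) : m ∣ Nat.card Z := by
  classical
  haveI : Fintype (Quotient (MulAction.orbitRel S Z)) := Fintype.ofFinite _
  rw [Nat.card_congr (MulAction.selfEquivSigmaOrbits S Z), Nat.card_sigma]
  exact Finset.dvd_sum fun q _ => h _

lemma card_orbit_mul {S Z : Type*} [Group S] [MulAction S Z] (z : Z) :
    Nat.card (MulAction.orbit S z) * Nat.card (MulAction.stabilizer S z) = Nat.card S := by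
  rw [← index_mul_card (MulAction.stabilizer S z), MulAction.index_stabilizer]
  rfl

lemma card_orbit_sylow {p : ℕ} [Fact p.Prime] {G : Type*} [Group G] [Finite G] (Q Q' : Sylow p G) :
    Nat.card (MulAction.orbit Q Q') * Nat.card (Q ⊓ Q' : Subgroup G) = Nat.card Q := by
  have h1 := card_orbit_mul (S := Q) Q'
  rw [← h1]
  congr 1
  have h2 : (Q ⊓ Q' : Subgroup G) = (Q : Subgroup G) ⊓ normalizer (Q' : Set G) :=
    (Q.2.inf_normalizer_sylow Q').symm
  rw [h2]
  have h3 : MulAction.stabilizer Q Q' =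
      ((Q : Subgroup G) ⊓ normalizer (Q' : Set G)).subgroupOf Q := by
    ext x
    rw [MulAction.mem_stabilizer_iff, mem_subgroupOf, mem_inf]
    have : x • Q' = (x : G) • Q' := rfl
    rw [this, Sylow.smul_eq_iff_mem_normalizer]
    exact ⟨fun h => ⟨x.2, h⟩, fun h => h.2⟩
  rw [h3]
  exact (Nat.card_congr (subgroupOfEquivOfLe inf_le_left).toEquiv).symm

lemma syl_eq_of_le {p : ℕ} [Fact p.Prime] {G : Type*} [Group G] [Finite G] {Q Q' : Sylow p G}
    (h : (Q : Subgroup G) ≤ Q') : Q = Q' := by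
  apply Sylow.ext
  exact (Q.is_maximal' Q'.2 h).symm

lemma mem_smul_iff {p : ℕ} {G : Type*} [Group G] (g x : G) (Q : Sylow p G) :
    x ∈ g • Q ↔ g⁻¹ * x * g ∈ Q := by
  have h : x ∈ g • Q ↔ x ∈ MulAut.conj g • (Q : Subgroup G) := Iff.rfl
  rw [h, Subgroup.mem_pointwise_smul_iff_inv_smul_mem]
  rw [← map_inv]
  simp [MulAut.smul_def]
  rfl

lemma syl_mod {p : ℕ} [Fact p.Prime] {G : Type*} [Group G] [Finite G] (Q : Sylow p G) :
    Nat.card {Q' : Sylow p G // Q' ≠ Q ∧ p * Nat.card (Q ⊓ Q' : Subgroup G) = Nat.card Q} + 1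
      ≡ Nat.card (Sylow p G) [MOD p ^ 2] := by
  classical
  have hp : p.Prime := Fact.out
  -- orbit sizes
  have horb : ∀ Q' : Sylow p G, Q' ≠ Q → p * Nat.card (Q ⊓ Q' : Subgroup G) ≠ Nat.card Q →
      p ^ 2 ∣ Nat.card (MulAction.orbit Q Q') := by
    intro Q' h1 h2
    have h3 := card_orbit_sylow Q Q'
    obtain ⟨k, hk⟩ := IsPGroup.iff_card.1 Q.2
    have hk' : Nat.card Q = p ^ k := hk
    have h4 : Nat.card (MulAction.orbit Q Q') ∣ p ^ k := ⟨_, by rw [h3, hk']⟩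
    obtain ⟨j, -, hj⟩ := (Nat.dvd_prime_pow hp).1 h4
    rw [hj] at h3 ⊢
    rcases Nat.lt_or_ge j 2 with hj2 | hj2
    · exfalso
      interval_cases j
      · apply h1
        symm
        apply syl_eq_of_le
        rw [pow_zero, one_mul] at h3
        have h5 : (Q ⊓ Q' : Subgroup G) = Q := eq_of_le_of_card_ge inf_le_left (le_of_eq h3.symm)
        rw [← h5]; exact inf_le_right
      · exact h2 (by rw [pow_one] at h3; exact h3)
    · exact pow_dvd_pow p hj2
  let W := {Q' : Sylow p G // Q' ≠ Q ∧ p * Nat.card (Q ⊓ Q' : Subgroup G) = Nat.card Q}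
  let Z := {Q' : Sylow p G // Q' ≠ Q ∧ p * Nat.card (Q ⊓ Q' : Subgroup G) ≠ Nat.card Q}
  have hinv : ∀ (q : Q) (Q' : Sylow p G),
      Nat.card (MulAction.orbit Q (q • Q')) = Nat.card (MulAction.orbit Q Q') := by
    intro q Q'; rw [MulAction.orbit_smul]
  have hqQ : ∀ q : Q, q • Q = Q := by
    intro q
    have : q • Q = (q : G) • Q := rfl
    rw [this, Sylow.smul_eq_iff_mem_normalizer]
    exact le_normalizer q.2
  have hZs : ∀ (q : Q) (Q' : Sylow p G), (Q' ≠ Q ∧ p * Nat.card (Q ⊓ Q' : Subgroup G) ≠ Nat.card Q)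
      → (q • Q' ≠ Q ∧ p * Nat.card (Q ⊓ (q • Q' : Sylow p G) : Subgroup G) ≠ Nat.card Q) := by
    intro q Q' ⟨h1, h2⟩
    refine ⟨fun h => h1 ?_, fun h => h2 ?_⟩
    · have := congrArg (fun R => q⁻¹ • R) h
      simp only [inv_smul_smul] at this
      rw [this, hqQ]
    · rw [← h]
      congr 1
      have e1 := card_orbit_sylow Q Q'
      have e2 := card_orbit_sylow Q (q • Q')
      rw [hinv] at e2
      rw [← e2] at e1
      refine Nat.eq_of_mul_eq_mul_left ?_ e1
      haveI : Nonempty (MulAction.orbit Q Q') := (MulAction.nonempty_orbit Q').to_subtype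
      exact Nat.card_pos
  letI : MulAction Q Z :=
    { smul := fun q z => ⟨q • z.1, hZs q z.1 z.2⟩
      one_smul := fun z => Subtype.ext (one_smul _ z.1)
      mul_smul := fun a b z => Subtype.ext (mul_smul a b z.1) }
  have hZ : p ^ 2 ∣ Nat.card Z := by
    apply dvd_card_of_orbits (S := Q)
    intro z
    have h1 := horb z.1 z.2.1 z.2.2
    have h2 := card_orbit_mul (S := Q) z.1
    have h3 := card_orbit_mul (S := Q) z
    have h4 : MulAction.stabilizer Q z = MulAction.stabilizer Q z.1 := by
      ext q
      rw [MulAction.mem_stabilizer_iff, MulAction.mem_stabilizer_iff]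
      exact ⟨fun h => congrArg Subtype.val h, fun h => Subtype.ext h⟩
    rw [h4] at h3
    rw [Nat.eq_of_mul_eq_mul_right Nat.card_pos (h3.trans h2.symm)]
    exact h1
  have hsum : Nat.card (Sylow p G) = 1 + (Nat.card W + Nat.card Z) := by
    haveI : Fintype (Sylow p G) := Fintype.ofFinite _
    simp only [W, Z, Nat.card_eq_fintype_card, Fintype.card_subtype]
    rw [← Finset.filter_filter, ← Finset.filter_filter, Finset.card_filter_add_card_filter_not,
      ← Finset.card_univ, ← Finset.card_filter_add_card_filter_not (s := Finset.univ)
        (p := fun Q' => Q' = Q)]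
    congr 1
    rw [Finset.card_eq_one]; exact ⟨Q, by ext; simp⟩
  rw [hsum]
  show Nat.card W + 1 ≡ _ [MOD p ^ 2]
  rw [← add_assoc, add_comm 1]
  have : Nat.card Z ≡ 0 [MOD p ^ 2] := (Nat.modEq_zero_iff_dvd).2 hZ
  simpa using (this.add_left (Nat.card W + 1)).symm

lemma sylow_unique_of_normal {p : ℕ} [Fact p.Prime] {G : Type*} [Group G] [Finite G]
    {Q : Sylow p G} (h : (Q : Subgroup G).Normal) (Q' : Sylow p G) : Q' = Q := by
  haveI := h
  exact (syl_eq_of_le (le_sylow_of_normal Q.2 Q')).symm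

lemma card_sylow_eq {p : ℕ} [Fact p.Prime] {L : Type*} [Group L] [Finite L] (P : Sylow p L)
    {a m : ℕ} (h : Nat.card L = p ^ a * m) (hm : ¬ p ∣ m) : Nat.card P = p ^ a ∧
    (P : Subgroup L).index = m := by
  have h1 : Nat.card P = p ^ a := by
    rw [P.card_eq_multiplicity, factorization_eq Fact.out h hm]
  refine ⟨h1, ?_⟩
  have h2 := index_mul_card (P : Subgroup L)
  have h3 : Nat.card (P : Subgroup L) = p ^ a := h1
  rw [h3, h, mul_comm] at h2
  exact Nat.eq_of_mul_eq_mul_left (pow_pos (Nat.Prime.pos Fact.out) a) h2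

/-- number of Sylow 23-subgroups -/
lemma n23 {n : ℕ} (hn : n ∣ 2 ^ 6 * 47) (h1 : n ≡ 1 [MOD 23]) : n = 1 ∨ n = 47 := by
  have h : n ∈ Nat.divisors (2 ^ 6 * 47) := by rw [Nat.mem_divisors]; exact ⟨hn, by norm_num⟩
  have key : ∀ n ∈ Nat.divisors (2 ^ 6 * 47), n % 23 = 1 → n = 1 ∨ n = 47 := by decide +kernel
  exact key n h h1

lemma n47 {n : ℕ} (hn : n ∣ 2 ^ 6 * 23 ^ 2) (h1 : n ≡ 1 [MOD 47]) : n = 1 ∨ n = 2116 := by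
  have h : n ∈ Nat.divisors (2 ^ 6 * 23 ^ 2) := by rw [Nat.mem_divisors]; exact ⟨hn, by norm_num⟩
  have key : ∀ n ∈ Nat.divisors (2 ^ 6 * 23 ^ 2), n % 47 = 1 → n = 1 ∨ n = 2116 := by
    decide +kernel
  exact key n h h1

lemma sylow_normal_of_card_one {p : ℕ} [Fact p.Prime] {L : Type*} [Group L] [Finite L]
    (P : Sylow p L) (h : Nat.card (Sylow p L) = 1) : (P : Subgroup L).Normal := by
  rw [P.card_eq_index_normalizer, index_eq_one] at h
  exact normalizer_eq_top_iff.1 h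

lemma L3 {L : Type*} [Group L] [Finite L] {c : ℕ} (hL : Nat.card L = 47 * c)
    (hc : c ∣ 2 ^ 6 * 23 ^ 2) (S : Sylow 47 L) : (S : Subgroup L).Normal := by
  have hc47 : ¬ 47 ∣ c := fun h => by have := h.trans hc; revert this; norm_num
  have hS := card_sylow_eq S (a := 1) (by rw [hL, pow_one]) hc47
  have hLd : Nat.card L ∣ 2 ^ 6 * 23 ^ 2 * 47 := by rw [hL, mul_comm]; exact Nat.mul_dvd_mul_right hc _
  have hn : Nat.card (Sylow 47 L) ∣ 2 ^ 6 * 23 ^ 2 := (hS.2 ▸ S.card_dvd_index).trans hc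
  rcases n47 hn (card_sylow_modEq_one 47 L) with h1 | h1
  · exact sylow_normal_of_card_one S h1
  exfalso
  -- no Sylow normalizer has order divisible by 23
  have hN : ∀ S : Sylow 47 L, ¬ 23 ∣ Nat.card (normalizer (S : Set L)) := by
    intro S h
    have h2 := index_mul_card (normalizer (S : Set L))
    rw [← S.card_eq_index_normalizer, h1] at h2
    obtain ⟨m, hm⟩ := h
    rw [hm] at h2
    rw [← h2] at hLd
    have h3 : 23 ^ 3 ∣ 2116 * (23 * m) := ⟨4 * m, by ring⟩
    have := h3.trans hLd
    revert this; norm_num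
  have h529 : 23 ^ 2 ∣ Nat.card L := by
    have h2 : 2116 ∣ Nat.card L := by
      rw [← h1]; exact (S.card_dvd_index).trans (index_dvd_card _)
    exact (by norm_num : 23 ^ 2 ∣ 2116).trans h2
  obtain ⟨m, hm⟩ := h529
  have hmd : m ∣ 2 ^ 6 * 47 := by
    rw [hm] at hLd
    apply Nat.dvd_of_mul_dvd_mul_left (show 0 < 23 ^ 2 by norm_num)
    refine hLd.trans (by norm_num)
  have hm23 : ¬ 23 ∣ m := fun h => by have := h.trans hmd; revert this; norm_num
  have hP : ∀ P : Sylow 23 L, Nat.card P = 23 ^ 2 := fun P => (card_sylow_eq P hm hm23).1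
  have hPi : ∀ P : Sylow 23 L, (P : Subgroup L).index = m := fun P => (card_sylow_eq P hm hm23).2
  have P : Sylow 23 L := default
  have hn23 : Nat.card (Sylow 23 L) ∣ 2 ^ 6 * 47 := (hPi P ▸ P.card_dvd_index).trans hmd
  rcases n23 hn23 (card_sylow_modEq_one 23 L) with h2 | h2
  · haveI := sylow_normal_of_card_one P h2
    have hPd : Nat.card (P : Subgroup L) ∣ 2 ^ 6 * 23 ^ 2 := by
      have : Nat.card (P : Subgroup L) = 23 ^ 2 := hP P
      rw [this]; exact dvd_mul_left _ _
    have hle : (P : Subgroup L) ≤ normalizer (S : Set L) := by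
      refine le_trans ?_ (centralizer_le_normalizer _)
      intro k hk
      rw [mem_centralizer_iff]
      intro s hs
      exact L0' (P : Subgroup L) (S : Subgroup L) S.2 hPd hs hk
    apply hN S
    refine dvd_trans ?_ (card_dvd_of_le hle)
    have : Nat.card (P : Subgroup L) = 23 ^ 2 := hP P
    rw [this]; norm_num
  · have hmod := syl_mod P
    rw [h2] at hmod
    obtain ⟨P', hne, hU⟩ : ∃ P' : Sylow 23 L, P' ≠ P ∧
        23 * Nat.card (P ⊓ P' : Subgroup L) = Nat.card P := by
      by_contra hcon
      push Not at hcon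
      haveI : IsEmpty {Q' : Sylow 23 L //
          Q' ≠ P ∧ 23 * Nat.card (P ⊓ Q' : Subgroup L) = Nat.card P} :=
        ⟨fun x => hcon x.1 x.2.1 x.2.2⟩
      rw [Nat.card_of_isEmpty] at hmod
      revert hmod; decide
    rw [hP P] at hU
    have hU' : Nat.card (P ⊓ P' : Subgroup L) = 23 := by omega
    set U : Subgroup L := P ⊓ P' with hUdef
    have hcen : ∀ R : Sylow 23 L, U ≤ R → (R : Subgroup L) ≤ centralizer (U : Set L) := by
      intro R hUR x hx
      rw [mem_centralizer_iff]
      intro u hu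
      have h3 : Nat.card R = 23 ^ 2 := hP R
      have h4 := IsPGroup.isMulCommutative_of_card_eq_prime_sq h3
      exact congrArg Subtype.val (h4.is_comm.comm (⟨u, hUR hu⟩ : R) ⟨x, hx⟩)
    have hPC := hcen P inf_le_left
    have hPC' := hcen P' inf_le_right
    have hne' : P.subtype hPC ≠ P'.subtype hPC' := fun h => hne (Sylow.subtype_injective h).symm
    have hd : Nat.card (Sylow 23 (centralizer (U : Set L))) ∣ 2 ^ 6 * 47 := by
      refine ((P.subtype hPC).card_dvd_index).trans (dvd_trans ?_ (hPi P ▸ hmd : (P : Subgroup L).index ∣ 2 ^ 6 * 47))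
      exact relIndex_dvd_index_of_le hPC
    rcases n23 hd (card_sylow_modEq_one 23 _) with h3 | h3
    · apply hne'
      have := (Nat.card_eq_one_iff_unique.1 h3).1
      exact Subsingleton.elim _ _
    · have h4 : 47 ∣ Nat.card (centralizer (U : Set L)) := by
        rw [← h3]
        exact ((P.subtype hPC).card_dvd_index).trans (index_dvd_card _)
      obtain ⟨s, hs⟩ := exists_prime_orderOf_dvd_card' 47 h4
      have hs' : orderOf (s : L) = 47 := (Subgroup.orderOf_coe s).trans hs
      have hpg : IsPGroup 47 (zpowers (s : L)) :=
        IsPGroup.of_card (n := 1) (by rw [Nat.card_zpowers, hs', pow_one])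
      obtain ⟨S', hS'⟩ := hpg.exists_le_sylow
      have hc' : Nat.card S' = 47 := by
        simpa using (card_sylow_eq S' (a := 1) (by rw [hL, pow_one]) hc47).1
      have heq : zpowers (s : L) = S' := by
        apply eq_of_le_of_card_ge hS'
        rw [Nat.card_zpowers, hs']
        exact hc'.le
      apply hN S'
      rw [← hU']
      apply card_dvd_of_le
      refine le_trans ?_ (centralizer_le_normalizer _)
      intro u hu
      have h5 : (S' : Set L) = zpowers (s : L) := by rw [heq]; rfl
      rw [h5, zpowers_eq_closure, centralizer_closure, mem_centralizer_singleton_iff]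
      exact (mem_centralizer_iff.1 s.2) u hu
end OD
open scoped MatrixGroups
namespace OD
open Subgroup
open scoped Pointwise
set_option linter.style.haveILetI false
set_option linter.unusedSectionVars false
set_option linter.unusedVariables false

lemma fix_mod {G : Type*} [Group G] [Finite G] {r : ℕ} [Fact r.Prime] (R K : Subgroup G)
    (hR : IsPGroup r R) (h : R ≤ normalizer (K : Set G)) :
    Nat.card K ≡ Nat.card (K ⊓ centralizer (R : Set G) : Subgroup G) [MOD r] := by
  letI : MulAction R K :=
    { smul := fun s x => ⟨s * (x : G) * (s : G)⁻¹, (mem_normalizer_iff.1 (h s.2) _).1 x.2⟩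
      one_smul := fun x => Subtype.ext (by
        change ((1 : R) : G) * (x : G) * ((1 : R) : G)⁻¹ = x
        simp)
      mul_smul := fun a b x => Subtype.ext (by
        change ((a * b : R) : G) * (x : G) * ((a * b : R) : G)⁻¹ =
          (a : G) * ((b : G) * x * (b : G)⁻¹) * (a : G)⁻¹
        simp [mul_assoc]) }
  have h1 := hR.card_modEq_card_fixedPoints K
  suffices hs : Nat.card (MulAction.fixedPoints R K) =
      Nat.card (K ⊓ centralizer (R : Set G) : Subgroup G) by rwa [hs] at h1
  refine (Nat.card_congr ?_).trans (Nat.card_congr (subgroupOfEquivOfLe (inf_le_left :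
    K ⊓ centralizer (R : Set G) ≤ K)).toEquiv)
  refine Equiv.subtypeEquivRight ?_
  intro x
  rw [mem_subgroupOf, mem_inf, mem_centralizer_iff]
  constructor
  · intro hx
    refine ⟨x.2, fun s hs => ?_⟩
    have h2 : s * (x : G) * s⁻¹ = x := congrArg Subtype.val (hx ⟨s, hs⟩)
    exact mul_inv_eq_iff_eq_mul.1 h2
  · intro hx s
    apply Subtype.ext
    exact mul_inv_eq_iff_eq_mul.2 (hx.2 s s.2)

section quot
variable {X : Type*} [Group X] [Finite X] (D : Subgroup X) [D.Normal]

lemma normal_of_quot (Q : Subgroup X) (hD : D ≤ Q)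
    (h : (Q.map (QuotientGroup.mk' D)).Normal) : Q.Normal := by
  have : Q = (Q.map (QuotientGroup.mk' D)).comap (QuotientGroup.mk' D) := by
    rw [comap_map_eq, QuotientGroup.ker_mk', sup_eq_left.2 hD]
  rw [this]
  exact h.comap _

lemma card_quot {a b : ℕ} (hD : Nat.card D = a) (hX : Nat.card X = a * b) : Nat.card (X ⧸ D) = b := by
  have h1 := card_eq_card_quotient_mul_card_subgroup D
  rw [hX, hD, mul_comm] at h1
  have : 0 < a := hD ▸ Nat.card_pos
  exact (Nat.eq_of_mul_eq_mul_right this h1).symm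

lemma L1q {j k c : ℕ} (hD : Nat.card D = 47 ^ j) (hX : Nat.card X = 47 ^ j * (47 ^ k * c))
    (hc : c ∣ 2 ^ 6 * 23 ^ 2) (Q : Sylow 47 X) 
    (hQ : ∀ g ∈ normalizer (Q : Set X), ∀ q ∈ Q, (q * g)⁻¹ * (g * q) ∈ D) :
    (Q : Subgroup X).Normal := by
  have hDQ : D ≤ Q := le_sylow_of_normal (IsPGroup.of_card hD) Q
  apply normal_of_quot D _ hDQ
  refine L1 (card_quot D hD hX) hc (Q.mapSurjective (QuotientGroup.mk'_surjective D)) ?_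
  intro g hg
  obtain ⟨g, rfl⟩ := QuotientGroup.mk'_surjective D g
  have hg' : g ∈ normalizer (Q : Set X) := by
    have hg := mem_normalizer_iff.1 (show QuotientGroup.mk' D g ∈ normalizer
      (((Q : Subgroup X).map (QuotientGroup.mk' D) : Subgroup _) : Set (X ⧸ D)) from hg)
    refine mem_normalizer_iff (H := (Q : Subgroup X)).2 ?_
    intro x
    have hmem : ∀ x : X, (QuotientGroup.mk' D) x ∈
        (Q : Subgroup X).map (QuotientGroup.mk' D) ↔ x ∈ Q := by
      intro x
      have : (Q : Subgroup X) = ((Q : Subgroup X).map (QuotientGroup.mk' D)).comap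
          (QuotientGroup.mk' D) := by
        rw [comap_map_eq, QuotientGroup.ker_mk', sup_eq_left.2 hDQ]
      rw [← mem_comap, ← this]; rfl
    have := hg (QuotientGroup.mk' D x)
    rw [← map_mul, ← map_inv, ← map_mul] at this
    exact (hmem x).symm.trans (this.trans (hmem _))
  rw [mem_centralizer_iff]
  rintro _ ⟨q, hq, rfl⟩
  rw [← map_mul, ← map_mul]
  exact QuotientGroup.eq.2 (hQ g hg' q hq)

lemma L3q {j c : ℕ} (hD : Nat.card D = 47 ^ j) (hX : Nat.card X = 47 ^ j * (47 * c))
    (hc : c ∣ 2 ^ 6 * 23 ^ 2) (Q : Sylow 47 X) : (Q : Subgroup X).Normal := by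
  have hDQ : D ≤ Q := le_sylow_of_normal (IsPGroup.of_card hD) Q
  apply normal_of_quot D _ hDQ
  exact L3 (card_quot D hD hX) hc (Q.mapSurjective (QuotientGroup.mk'_surjective D))
end quot

variable {G : Type*} [Group G] [Finite G]

lemma le_normalizer_of_subtype {X : Subgroup G} {E : Subgroup G} (hE : E ≤ X)
    (h : (E.subgroupOf X).Normal) : X ≤ normalizer (E : Set G) :=
  (normal_subgroupOf_iff_le_normalizer hE).1 h

lemma mem_normalizer_subgroupOf {X E : Subgroup G} (hE : E ≤ X) (g : X) :
    g ∈ normalizer (E.subgroupOf X : Set X) ↔ (g : G) ∈ normalizer (E : Set G) := by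
  rw [mem_normalizer_iff, mem_normalizer_iff]
  constructor
  · intro h x
    constructor
    · intro hx
      exact (h ⟨x, hE hx⟩).1 hx
    · intro hx
      have hxX : x ∈ X := by
        have := X.mul_mem (X.mul_mem (X.inv_mem g.2) (hE hx)) g.2
        simpa [mul_assoc] using this
      exact (h ⟨x, hxX⟩).2 hx
  · intro h x
    exact h x

/-- `L1` for a subgroup `X` of `G`. -/
lemma L1sub {X E : Subgroup G} {k c : ℕ} (hEX : E ≤ X) (hX : Nat.card X = 47 ^ k * c)
    (hc : c ∣ 2 ^ 6 * 23 ^ 2) (hE : Nat.card E = 47 ^ k)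
    (h : ∀ g ∈ X, g ∈ normalizer (E : Set G) → ∀ x ∈ E, x * g = g * x) :
    X ≤ normalizer (E : Set G) := by
  have hc47 : ¬ 47 ∣ c := fun h => by have := h.trans hc; revert this; norm_num
  have hfac := factorization_eq (by norm_num) hX hc47
  let S : Sylow 47 X := Sylow.ofCard (E.subgroupOf X)
    (by rw [Nat.card_congr (subgroupOfEquivOfLe hEX).toEquiv, hE, hfac])
  have h1 : (S : Subgroup X).Normal := by
    refine L1 hX hc S ?_
    intro g hg
    have hg' := (mem_normalizer_subgroupOf hEX g).1 hg
    rw [mem_centralizer_iff]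
    intro x hx
    exact Subtype.ext (h g g.2 hg' x hx)
  exact le_normalizer_of_subtype hEX h1

lemma sub37 (H : Hyp G) (M : Subgroup G) (h : 37 ∣ Nat.card M) : ∃ n d, n * d = Nat.card M ∧
    37 ∣ d ∧ d ∣ 3 * 37 * 61 ∧ n ≡ 1 [MOD 37] := by
  have P : Sylow 37 M := default
  have hG : Nat.card G = 37 ^ 1 * (2 ^ 6 * 3 * 23 ^ 2 * 47 ^ 3 * 61) := by rw [H.card]; norm_num [ordG]
  have hfG := factorization_eq (by norm_num) hG (by norm_num)
  have hP : Nat.card P = 37 := by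
    have h1 : 37 ∣ Nat.card P := by
      simpa using P.pow_dvd_card_of_pow_dvd_card (n := 1) (by simpa using h)
    obtain ⟨k, hk⟩ := IsPGroup.iff_card.1 P.2
    have h2 : 37 ^ k ∣ Nat.card G := by
      rw [← hk]; exact (card_subgroup_dvd_card _).trans (card_subgroup_dvd_card _)
    have h3 : k ≤ 1 := by
      rw [← hfG]
      exact (Nat.Prime.pow_dvd_iff_le_factorization (by norm_num) (Nat.card_pos.ne')).1 h2
    have h4 : Nat.card P = 37 ^ k := hk
    rw [h4] at h1 ⊢
    interval_cases k
    · norm_num at h1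
    · norm_num
  let R : Subgroup G := (P : Subgroup M).map M.subtype
  have hR : Nat.card R = 37 := by
    rw [← hP]
    exact Nat.card_congr ((P : Subgroup M).equivMapOfInjective _ M.subtype_injective).symm.toEquiv
  let R' : Sylow 37 G := Sylow.ofCard R (by rw [hR, hfG]; norm_num)
  have hN := H.norm37 R'
  have hRM : R ≤ M := by
    rintro _ ⟨x, -, rfl⟩; exact x.2
  have hsub : R.subgroupOf M = P := by
    ext x
    rw [mem_subgroupOf]
    constructor
    · rintro ⟨y, hy, hyx⟩
      have : y = x := Subtype.ext hyx
      rw [← this]; exact hy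
    · intro hx; exact ⟨x, hx, rfl⟩
  refine ⟨(normalizer (P : Set M)).index, Nat.card (normalizer (P : Set M)), index_mul_card _, ?_,
    ?_, ?_⟩
  · refine dvd_trans ?_ (card_dvd_of_le (le_normalizer (H := (P : Subgroup M))))
    exact dvd_of_eq hP.symm
  · rw [← hN]
    have h1 : (normalizer (P : Set M)).map M.subtype ≤ normalizer (R' : Set G) := by
      rintro _ ⟨x, hx, rfl⟩
      have h2 : x ∈ normalizer ((R.subgroupOf M : Subgroup M) : Set M) := by rw [hsub]; exact hx
      exact (mem_normalizer_subgroupOf hRM x).1 h2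
    rw [Nat.card_congr ((normalizer (P : Set M)).equivMapOfInjective _ M.subtype_injective).toEquiv]
    exact card_dvd_of_le h1
  · rw [← P.card_eq_index_normalizer]
    exact card_sylow_modEq_one 37 M

section hyp

lemma cardG (H : Hyp G) : Nat.card G = 47 ^ 3 * (2 ^ 6 * 3 * 23 ^ 2 * 37 * 61) := by
  rw [H.card]; norm_num [ordG]

lemma cardQ (H : Hyp G) (Q : Sylow 47 G) : Nat.card (Q : Subgroup G) = 47 ^ 3 :=
  (card_sylow_eq Q (cardG H) (by norm_num)).1

lemma not3 (H : Hyp G) (Q : Sylow 47 G) : ¬ 3 ∣ Nat.card (normalizer (Q : Set G)) := by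
  intro h
  haveI : Fact (Nat.Prime 3) := ⟨by norm_num⟩
  obtain ⟨y, hy⟩ := exists_prime_orderOf_dvd_card' 3 h
  have hy' : orderOf (y : G) = 3 := (Subgroup.orderOf_coe y).trans hy
  have hR : IsPGroup 3 (zpowers (y : G)) :=
    IsPGroup.of_card (n := 1) (by rw [Nat.card_zpowers, hy', pow_one])
  have h1 := fix_mod (zpowers (y : G)) Q hR (by rw [zpowers_le]; exact y.2)
  rw [cardQ H] at h1
  set F : Subgroup G := Q ⊓ centralizer (zpowers (y : G) : Set G)
  have h2 : Nat.card F ∣ 47 ^ 3 := by rw [← cardQ H Q]; exact card_dvd_of_le inf_le_left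
  obtain ⟨k, -, hk⟩ := (Nat.dvd_prime_pow (by norm_num)).1 h2
  have h3 : 47 ∣ Nat.card F := by
    rcases Nat.eq_zero_or_pos k with rfl | hk0
    · rw [hk] at h1; exact absurd h1 (by decide)
    · rw [hk]; exact dvd_pow_self _ hk0.ne'
  obtain ⟨x, hx⟩ := exists_prime_orderOf_dvd_card' 47 h3
  have hx' : orderOf (x : G) = 47 := (Subgroup.orderOf_coe x).trans hx
  have h4 := H.cent47 x hx'
  have h5 : (y : G) ∈ centralizer ({(x : G)} : Set G) := by
    rw [mem_centralizer_singleton_iff]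
    exact (mem_centralizer_iff.1 x.2.2) y (mem_zpowers _)
  have h6 := (Subgroup.orderOf_dvd_natCard _ h5).trans h4
  rw [hy'] at h6
  revert h6; norm_num

lemma not_commute_37 (H : Hyp G) {c x : G} (hc : orderOf c = 37) (hx : orderOf x = 47) : c * x ≠ x * c := by
  intro h
  have h5 : x ∈ centralizer ({c} : Set G) := by
    rw [mem_centralizer_singleton_iff]; exact h.symm
  have h6 := (Subgroup.orderOf_dvd_natCard _ h5).trans (H.cent37 c hc)
  rw [hx] at h6
  revert h6; norm_num

lemma h_options (H : Hyp G) (Q : Sylow 47 G) : Nat.card (normalizer (Q : Set G)) = 47 ^ 3 * 2257 ∨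
    Nat.card (normalizer (Q : Set G)) = 47 ^ 3 * 2116 ∨
    Nat.card (normalizer (Q : Set G)) = 47 ^ 3 := by
  have h0 : 47 ^ 3 ∣ Nat.card (normalizer (Q : Set G)) := by
    rw [← cardQ H Q]; exact card_dvd_of_le le_normalizer
  obtain ⟨h, hh⟩ := h0
  have hidx := index_mul_card (normalizer (Q : Set G))
  rw [hh, cardG H] at hidx
  have hn : (normalizer (Q : Set G)).index * h = 2 ^ 6 * 3 * 23 ^ 2 * 37 * 61 := by
    apply Nat.eq_of_mul_eq_mul_left (show 0 < 47 ^ 3 by norm_num)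
    rw [← hidx]; ring
  have hmod := card_sylow_modEq_one 47 G
  rw [Q.card_eq_index_normalizer] at hmod
  have hh1 : h ≡ 1 [MOD 47] := by
    have h1 := hmod.mul_right h
    rw [hn, one_mul] at h1
    exact h1.symm.trans (by decide)
  have h3 : ¬ 3 ∣ h := fun h' => not3 H Q (by rw [hh]; exact h'.mul_left _)
  have hd : h ∣ (2 ^ 6 * 23 ^ 2) * 2257 := by
    have h1 : h ∣ ((2 ^ 6 * 23 ^ 2) * 2257) * 3 := ⟨(normalizer (Q : Set G)).index, by
      rw [mul_comm h, hn]; norm_num⟩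
    refine Nat.Coprime.dvd_of_dvd_mul_right ?_ h1
    exact ((Nat.Prime.coprime_iff_not_dvd (by norm_num)).2 h3).symm
  obtain ⟨a, b, ha, hb, hab⟩ := Nat.dvd_mul.1 hd
  have key : ∀ a ∈ Nat.divisors (2 ^ 6 * 23 ^ 2), ∀ b ∈ Nat.divisors 2257, (a * b) % 47 = 1 →
      a * b = 2257 ∨ a * b = 2116 ∨ a * b = 1 ∨ a * b = 2116 * 2257 := by decide +kernel
  have hk := key a (by rw [Nat.mem_divisors]; exact ⟨ha, by norm_num⟩) b
    (by rw [Nat.mem_divisors]; exact ⟨hb, by norm_num⟩) (by rw [hab]; exact hh1)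
  rw [hab] at hk
  rcases hk with rfl | rfl | rfl | rfl
  · exact Or.inl hh
  · exact Or.inr (Or.inl hh)
  · exact Or.inr (Or.inr (by rw [hh, mul_one]))
  exfalso
  obtain ⟨n, d, hnd, hd1, hd2, hn1⟩ := sub37 H (normalizer (Q : Set G)) (by rw [hh]; norm_num)
  have hd3 : ¬ 3 ∣ d := fun h' => not3 H Q (by rw [← hnd]; exact h'.mul_left _)
  have hd4 : d ∈ Nat.divisors (3 * 37 * 61) := by rw [Nat.mem_divisors]; exact ⟨hd2, by norm_num⟩
  have key2 : ∀ d ∈ Nat.divisors (3 * 37 * 61), 37 ∣ d → ¬ 3 ∣ d → d = 37 ∨ d = 2257 := by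
    decide +kernel
  rw [hh] at hnd
  have hn1' : n % 37 = 1 := hn1
  rcases key2 d hd4 hd1 hd3 with rfl | rfl
  · omega
  · omega

lemma order47_of_mem (H : Hyp G) (Q : Sylow 47 G) {x : G} (hx : orderOf x = 47) : ∃ Q : Sylow 47 G, x ∈ Q := by
  have hpg : IsPGroup 47 (zpowers x) :=
    IsPGroup.of_card (n := 1) (by rw [Nat.card_zpowers, hx, pow_one])
  obtain ⟨S', hS'⟩ := hpg.exists_le_sylow
  exact ⟨S', hS' (mem_zpowers x)⟩

lemma isolated_contra (H : Hyp G)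
    (h : ∀ Q : Sylow 47 G, ∀ x ∈ Q, orderOf x = 47 → IsPGroup 47 (centralizer ({x} : Set G))) :
    False := by
  obtain ⟨x, hx, r, hr, hr47, hrd⟩ := H.noniso
  obtain ⟨Q, hQ⟩ := order47_of_mem H default hx
  obtain ⟨k, hk⟩ := IsPGroup.iff_card.1 (h Q x hQ hx)
  rw [hk] at hrd
  exact hr47 ((Nat.prime_dvd_prime_iff_eq hr (by norm_num)).1 (hr.dvd_of_dvd_pow hrd))

lemma cent_card (H : Hyp G) {x : G} (hx : orderOf x = 47) {X : Subgroup G} (hX : X ≤ centralizer ({x} : Set G))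
    {k : ℕ} (h1 : 47 ^ k ∣ Nat.card X) (h2 : ¬ 47 ^ (k + 1) ∣ Nat.card X) : ∃ c, c ∣ 2 ^ 6 * 23 ^ 2 ∧
    Nat.card X = 47 ^ k * c := by
  obtain ⟨c, hc⟩ := h1
  refine ⟨c, ?_, hc⟩
  have h3 : c ∣ (2 ^ 6 * 23 ^ 2) * 47 ^ 3 :=
    (Dvd.intro_left _ hc.symm).trans ((card_dvd_of_le hX).trans (H.cent47 x hx))
  refine Nat.Coprime.dvd_of_dvd_mul_right ?_ h3
  apply Nat.Coprime.pow_right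
  rw [Nat.coprime_comm, Nat.Prime.coprime_iff_not_dvd (by norm_num)]
  rintro ⟨d, rfl⟩
  exact h2 ⟨d, by rw [hc]; ring⟩

lemma not_47_4 (H : Hyp G) (X : Subgroup G) : ¬ 47 ^ (3 + 1) ∣ Nat.card X := by
  intro h
  have := h.trans (card_subgroup_dvd_card X)
  rw [cardG H] at this
  revert this; norm_num

end hyp
end OD
open scoped MatrixGroups
namespace OD
open Subgroup
open scoped Pointwise
set_option linter.style.haveILetI false
set_option linter.unusedSectionVars false
set_option linter.unusedVariables false

variable {G : Type*} [Group G] [Finite G]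

/-- the center of a subgroup, as a subgroup of the whole group -/
def Zc (Q : Subgroup G) : Subgroup G := Q ⊓ centralizer (Q : Set G)

lemma mem_Zc {Q : Subgroup G} {z : G} : z ∈ Zc Q ↔ z ∈ Q ∧ ∀ x ∈ Q, x * z = z * x := by
  rw [Zc, mem_inf, mem_centralizer_iff]; rfl

lemma Zc_le (Q : Subgroup G) : Zc Q ≤ Q := inf_le_left

lemma card_Zc (Q : Subgroup G) : Nat.card (Zc Q) = Nat.card (center Q) := by
  have : Zc Q = (center Q).map Q.subtype := by
    ext z
    rw [mem_Zc, mem_map]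
    constructor
    · rintro ⟨h1, h2⟩
      exact ⟨⟨z, h1⟩, mem_center_iff.2 fun g => Subtype.ext (h2 g g.2), rfl⟩
    · rintro ⟨y, hy, rfl⟩
      exact ⟨y.2, fun x hx => congrArg Subtype.val (mem_center_iff.1 hy ⟨x, hx⟩)⟩
  rw [this]
  exact Nat.card_congr ((center Q).equivMapOfInjective _ Q.subtype_injective).symm.toEquiv

lemma norm_le_norm_Zc (Q : Subgroup G) : normalizer (Q : Set G) ≤ normalizer (Zc Q : Set G) := by
  have key : ∀ g ∈ normalizer (Q : Set G), ∀ z ∈ Zc Q, g * z * g⁻¹ ∈ Zc Q := by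
    intro g hg z hz
    rw [mem_Zc] at hz ⊢
    refine ⟨(mem_normalizer_iff.1 hg z).1 hz.1, fun x hx => ?_⟩
    have hx' : g⁻¹ * x * g ∈ Q := by
      rw [mem_normalizer_iff.1 hg]; simpa [mul_assoc] using hx
    have h1 := hz.2 _ hx'
    calc x * (g * z * g⁻¹) = g * ((g⁻¹ * x * g) * z) * g⁻¹ := by group
      _ = g * (z * (g⁻¹ * x * g)) * g⁻¹ := by rw [h1]
      _ = _ := by group
  intro g hg
  rw [mem_normalizer_iff]
  intro z
  refine ⟨key g hg z, fun h => ?_⟩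
  have := key g⁻¹ (inv_mem hg) _ h
  simpa [mul_assoc] using this

lemma pow_card_cases {D : Subgroup G} {k : ℕ} (h : Nat.card D ∣ 47 ^ k) :
    ∃ j ≤ k, Nat.card D = 47 ^ j := (Nat.dvd_prime_pow (by norm_num)).1 h

lemma exists_order47 {D : Subgroup G} (h : 47 ∣ Nat.card D) : ∃ x ∈ D, orderOf x = 47 := by
  obtain ⟨x, hx⟩ := exists_prime_orderOf_dvd_card' 47 h
  exact ⟨x, x.2, (Subgroup.orderOf_coe x).trans hx⟩

lemma comm_of_card_sq {D : Subgroup G} (h : Nat.card D = 47 ^ 2) {x y : G} (hx : x ∈ D) (hy : y ∈ D) :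
    x * y = y * x := by
  have h4 := IsPGroup.isMulCommutative_of_card_eq_prime_sq h
  exact congrArg Subtype.val (h4.is_comm.comm (⟨x, hx⟩ : D) ⟨y, hy⟩)

lemma le_norm_of_sq {Q D : Subgroup G} (hQ : Nat.card Q = 47 ^ 3) (hD : Nat.card D = 47 ^ 2)
    (h : D ≤ Q) : Q ≤ normalizer (D : Set G) := by
  apply le_normalizer_of_subtype h
  apply Subgroup.normal_of_index_eq_minFac_card
  have h1 := index_mul_card (D.subgroupOf Q)
  rw [Nat.card_congr (subgroupOfEquivOfLe h).toEquiv, hD, hQ] at h1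
  rw [hQ, Nat.Prime.pow_minFac (by norm_num) (by norm_num)]
  omega

section hyp

lemma card_norm_eq (H : Hyp G) (Q Q' : Sylow 47 G) :
    Nat.card (normalizer (Q : Set G)) = Nat.card (normalizer (Q' : Set G)) := by
  have h1 := index_mul_card (normalizer (Q : Set G))
  have h2 := index_mul_card (normalizer (Q' : Set G))
  rw [← Sylow.card_eq_index_normalizer] at h1 h2
  exact Nat.eq_of_mul_eq_mul_left Nat.card_pos (h1.trans h2.symm)

/-- if `|N(Q)|` is coprime to `46`, then `Q` is the only thing in `N(Q)` centralizing something -/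
lemma inf_norm_eq (H : Hyp G) (Q : Sylow 47 G) {h : ℕ} (hN : Nat.card (normalizer (Q : Set G)) = 47 ^ 3 * h)
    (hh : h = 1 ∨ h = 2257) {X : Subgroup G} {x : G} (hx : orderOf x = 47)
    (hX : X ≤ centralizer ({x} : Set G)) {g : G} (hg : g ∈ X) (hg' : g ∈ normalizer (Q : Set G))
    (hQX : (Q : Subgroup G) ≤ X) : g ∈ Q := by
  have h1 : (Q : Subgroup G) = X ⊓ normalizer (Q : Set G) := by
    apply eq_of_le_of_card_ge (le_inf hQX le_normalizer)
    rw [cardQ H]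
    have h2 : Nat.card (X ⊓ normalizer (Q : Set G) : Subgroup G) ∣ 47 ^ 3 * h :=
      hN ▸ card_dvd_of_le inf_le_right
    have h3 : Nat.card (X ⊓ normalizer (Q : Set G) : Subgroup G) ∣ 47 ^ 3 * (2 ^ 6 * 23 ^ 2) := by
      rw [mul_comm]
      exact (card_dvd_of_le (inf_le_left.trans hX)).trans (H.cent47 x hx)
    have h4 := Nat.dvd_gcd h2 h3
    rw [Nat.gcd_mul_left] at h4
    have h5 : Nat.gcd h (2 ^ 6 * 23 ^ 2) = 1 := by rcases hh with rfl | rfl <;> norm_num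
    rw [h5, mul_one] at h4
    exact Nat.le_of_dvd (by norm_num) h4
  have h6 : g ∈ (Q : Subgroup G) := by rw [h1]; exact ⟨hg, hg'⟩
  exact h6

lemma step2 (H : Hyp G) {h : ℕ} (hh : h = 1 ∨ h = 2257)
    (hN : ∀ Q : Sylow 47 G, Nat.card (normalizer (Q : Set G)) = 47 ^ 3 * h)
    (hab : ∀ Q : Sylow 47 G, ∀ x ∈ Q, ∀ y ∈ Q, x * y = y * x) : False := by
  apply isolated_contra H
  intro Q x hxQ hx
  have hQX : (Q : Subgroup G) ≤ centralizer ({x} : Set G) := by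
    intro y hy; rw [mem_centralizer_singleton_iff]; exact hab Q y hy x hxQ
  have h3 : 47 ^ 3 ∣ Nat.card (centralizer ({x} : Set G)) := by
    rw [← cardQ H Q]; exact card_dvd_of_le hQX
  obtain ⟨c, hc, hcX⟩ := cent_card H hx le_rfl h3 (not_47_4 H _)
  have hle := L1sub hQX hcX hc (cardQ H Q) (by
    intro g hg hg' y hy
    exact hab Q y hy g (inf_norm_eq H Q (hN Q) hh hx le_rfl hg hg' hQX))
  refine Q.2.to_le (K := (Q : Subgroup G)) ?_
  intro g hg
  exact inf_norm_eq H Q (hN Q) hh hx le_rfl hg (hle hg) hQX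

lemma center_nontriv (H : Hyp G) (Q : Sylow 47 G) : 47 ∣ Nat.card (Zc (Q : Subgroup G)) := by
  have hQ := cardQ H Q
  haveI : Nontrivial (Q : Subgroup G) := by
    rw [← Finite.one_lt_card_iff_nontrivial, hQ]; norm_num
  have h1 := Q.2.center_nontrivial
  have h2 : Nat.card (Zc (Q : Subgroup G)) ∣ 47 ^ 3 := hQ ▸ card_dvd_of_le (Zc_le _)
  obtain ⟨j, -, hj⟩ := pow_card_cases h2
  rcases Nat.eq_zero_or_pos j with rfl | hj0
  · rw [card_Zc] at hj
    have := Finite.one_lt_card_iff_nontrivial.2 h1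
    have hj' : Nat.card (center (Q : Subgroup G)) = 1 := by simpa using hj
    omega
  · rw [hj]; exact dvd_pow_self _ hj0.ne'

lemma abelian_of_2257 (H : Hyp G) (Q : Sylow 47 G) (hN : Nat.card (normalizer (Q : Set G)) = 47 ^ 3 * 2257) :
    ∀ x ∈ Q, ∀ y ∈ Q, x * y = y * x := by
  obtain ⟨c, hcN, hc⟩ : ∃ c ∈ normalizer (Q : Set G), orderOf c = 37 := by
    obtain ⟨c, hc⟩ := exists_prime_orderOf_dvd_card' (G := normalizer (Q : Set G)) 37
      (by rw [hN]; norm_num)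
    exact ⟨c, c.2, (Subgroup.orderOf_coe c).trans hc⟩
  have hR : IsPGroup 37 (zpowers c) :=
    IsPGroup.of_card (n := 1) (by rw [Nat.card_zpowers, hc, pow_one])
  have h1 := fix_mod (zpowers c) (Zc (Q : Subgroup G)) hR
    (by rw [zpowers_le]; exact norm_le_norm_Zc _ hcN)
  set F : Subgroup G := Zc (Q : Subgroup G) ⊓ centralizer (zpowers c : Set G)
  have hF : Nat.card F ∣ 47 ^ 3 := by
    rw [← cardQ H Q]; exact card_dvd_of_le (inf_le_left.trans (Zc_le _))
  obtain ⟨j, -, hj⟩ := pow_card_cases hF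
  have hj0 : j = 0 := by
    by_contra h0
    obtain ⟨x, hxF, hx⟩ := exists_order47 (D := F) (by rw [hj]; exact dvd_pow_self _ h0)
    exact not_commute_37 H hc hx (mem_centralizer_iff.1 hxF.2 c (mem_zpowers c))
  have h2 : Nat.card (Zc (Q : Subgroup G)) ∣ 47 ^ 3 := cardQ H Q ▸ card_dvd_of_le (Zc_le _)
  obtain ⟨i, hi, hi'⟩ := pow_card_cases h2
  have h3 := center_nontriv H Q
  rw [hj, hj0, hi'] at h1
  rw [hi'] at h3
  have hi3 : i = 3 := by
    interval_cases i
    · norm_num at h3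
    · exact absurd h1 (by decide)
    · exact absurd h1 (by decide)
    · rfl
  have h4 : Zc (Q : Subgroup G) = Q := eq_of_le_of_card_ge (Zc_le _) (by rw [cardQ H, hi', hi3])
  intro x hx y hy
  have : y ∈ Zc (Q : Subgroup G) := by rw [h4]; exact hy
  exact (mem_Zc.1 this).2 x hx

lemma card_syl_2116 (H : Hyp G) (Q : Sylow 47 G) (hN : Nat.card (normalizer (Q : Set G)) = 47 ^ 3 * 2116) :
    Nat.card (Sylow 47 G) = 48 * 2257 := by
  have h1 := index_mul_card (normalizer (Q : Set G))
  rw [hN, cardG H, ← Sylow.card_eq_index_normalizer] at h1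
  omega

lemma step3 (H : Hyp G) (Q : Sylow 47 G) (hN : Nat.card (normalizer (Q : Set G)) = 47 ^ 3 * 2116)
    (hab : ∀ Q : Sylow 47 G, ∀ x ∈ Q, ∀ y ∈ Q, x * y = y * x) : False := by
  have hmod := syl_mod Q
  rw [card_syl_2116 H Q hN] at hmod
  obtain ⟨Q', hne, hU⟩ : ∃ Q' : Sylow 47 G, Q' ≠ Q ∧
      47 * Nat.card (Q ⊓ Q' : Subgroup G) = Nat.card (Q : Subgroup G) := by
    by_contra hcon
    push Not at hcon
    haveI : IsEmpty {Q' : Sylow 47 G //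
        Q' ≠ Q ∧ 47 * Nat.card (Q ⊓ Q' : Subgroup G) = Nat.card Q} :=
      ⟨fun x => hcon x.1 x.2.1 x.2.2⟩
    rw [Nat.card_of_isEmpty] at hmod
    exact absurd hmod (by decide)
  rw [cardQ H] at hU
  set D : Subgroup G := Q ⊓ Q'
  have hD : Nat.card D = 47 ^ 2 := by omega
  obtain ⟨x, hxD, hx⟩ := exists_order47 (D := D) (by rw [hD]; norm_num)
  set X := centralizer (D : Set G)
  have hQX : ∀ Q' : Sylow 47 G, D ≤ Q' → (Q' : Subgroup G) ≤ X := by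
    intro Q' hD' y hy
    rw [mem_centralizer_iff]
    intro d hd
    exact hab Q' d (hD' hd) y hy
  have hX1 : X ≤ centralizer ({x} : Set G) := by
    intro y hy
    rw [mem_centralizer_singleton_iff]
    exact (mem_centralizer_iff.1 hy x hxD).symm
  have h3 : 47 ^ 3 ∣ Nat.card X := by
    rw [← cardQ H Q]; exact card_dvd_of_le (hQX Q inf_le_left)
  obtain ⟨c, hc, hcX⟩ := cent_card H hx hX1 h3 (not_47_4 H _)
  have hDX : D ≤ X := inf_le_left.trans (hQX Q inf_le_left)
  haveI : (D.subgroupOf X).Normal := by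
    rw [normal_subgroupOf_iff_le_normalizer hDX]
    exact centralizer_le_normalizer _
  have h4 := L3q (D.subgroupOf X) (j := 2) (c := c)
    (by rw [Nat.card_congr (subgroupOfEquivOfLe hDX).toEquiv, hD]) (by rw [hcX]; ring) hc
    (Q.subtype (hQX Q inf_le_left))
  have h5 := sylow_unique_of_normal h4 (Q'.subtype (hQX Q' inf_le_right))
  exact hne (Sylow.subtype_injective h5)

end hyp

/-- the main case: nonabelian Sylow subgroups -/
structure NA (G : Type*) [Group G] [Finite G] : Prop extends Hyp G where
  nonab : ∀ Q : Sylow 47 G, ¬ ∀ x ∈ Q, ∀ y ∈ Q, x * y = y * x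

lemma abelian_conj (Q Q' : Sylow 47 G) (h : ∀ x ∈ Q, ∀ y ∈ Q, x * y = y * x) :
    ∀ x ∈ Q', ∀ y ∈ Q', x * y = y * x := by
  obtain ⟨g, rfl⟩ := MulAction.exists_smul_eq G Q Q'
  intro x hx y hy
  rw [mem_smul_iff] at hx hy
  have := h _ hx _ hy
  have h2 : g * ((g⁻¹ * x * g) * (g⁻¹ * y * g)) * g⁻¹ = g * ((g⁻¹ * y * g) * (g⁻¹ * x * g)) * g⁻¹ := by
    rw [this]
  simpa [mul_assoc] using h2

lemma na_of_hyp (H : Hyp G) : NA G ∧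
    ((∀ Q : Sylow 47 G, Nat.card (normalizer (Q : Set G)) = 47 ^ 3 * 2116) ∨
     (∀ Q : Sylow 47 G, Nat.card (normalizer (Q : Set G)) = 47 ^ 3)) := by
  have key : ∀ Q : Sylow 47 G, (∀ x ∈ Q, ∀ y ∈ Q, x * y = y * x) → False := by
    intro Q hQ
    have hab : ∀ Q : Sylow 47 G, ∀ x ∈ Q, ∀ y ∈ Q, x * y = y * x := fun Q' => abelian_conj Q Q' hQ
    rcases h_options H Q with h | h | h
    · exact step2 H (Or.inr rfl) (fun Q' => (card_norm_eq H Q' Q).trans h) hab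
    · exact step3 H Q h hab
    · exact step2 H (Or.inl rfl) (fun Q' => (card_norm_eq H Q' Q).trans (by rw [h, mul_one])) hab
  refine ⟨⟨H, fun Q hQ => key Q hQ⟩, ?_⟩
  rcases h_options H default with h | h | h
  · exact (key _ (abelian_of_2257 H default h)).elim
  · exact Or.inl fun Q' => (card_norm_eq H Q' default).trans h
  · exact Or.inr fun Q' => (card_norm_eq H Q' default).trans h
end OD
open scoped MatrixGroups
namespace OD
open Subgroup
open scoped Pointwise
set_option linter.style.haveILetI false
set_option linter.unusedSectionVars false
set_option linter.unusedVariables false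

variable {G : Type*} [Group G] [Finite G]

/-- the Sylow 47-subgroups containing `D` -/
def SylOver (D : Subgroup G) : Set (Sylow 47 G) := {Q | D ≤ Q}

section na

lemma cZ (N : NA G) (Q : Sylow 47 G) : Nat.card (Zc (Q : Subgroup G)) = 47 := by
  have hQ := cardQ N.toHyp Q
  have h2 : Nat.card (Zc (Q : Subgroup G)) ∣ 47 ^ 3 := hQ ▸ card_dvd_of_le (Zc_le _)
  obtain ⟨j, hj3, hj⟩ := pow_card_cases h2
  have h1 := center_nontriv N.toHyp Q
  have hne : Zc (Q : Subgroup G) ≠ Q := by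
    intro h
    apply N.nonab Q
    intro x hx y hy
    have : y ∈ Zc (Q : Subgroup G) := by rw [h]; exact hy
    exact (mem_Zc.1 this).2 x hx
  have hlt : Zc (Q : Subgroup G) < Q := lt_of_le_of_ne (Zc_le _) hne
  interval_cases j
  · rw [hj] at h1; norm_num at h1
  · simpa using hj
  · exfalso
    obtain ⟨x, hxQ, hxZ⟩ := SetLike.exists_of_lt hlt
    set F : Subgroup G := Q ⊓ centralizer ({x} : Set G)
    have hZF : Zc (Q : Subgroup G) ≤ F := by
      intro z hz
      refine mem_inf.2 ⟨Zc_le _ hz, ?_⟩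
      rw [mem_centralizer_singleton_iff]
      exact ((mem_Zc.1 hz).2 x hxQ).symm
    have hxF : x ∈ F := mem_inf.2 ⟨hxQ, mem_centralizer_singleton_iff.2 rfl⟩
    have hF : Nat.card F ∣ 47 ^ 3 := hQ ▸ card_dvd_of_le inf_le_left
    obtain ⟨i, hi, hi'⟩ := pow_card_cases hF
    have h5 : Nat.card (Zc (Q : Subgroup G)) < Nat.card F := by
      apply lt_of_le_of_ne (Nat.le_of_dvd Nat.card_pos (card_dvd_of_le hZF))
      intro h
      apply hxZ
      rw [eq_of_le_of_card_ge hZF h.ge]; exact hxF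
    rw [hj, hi'] at h5
    have h6 : i = 3 := by
      have := (Nat.pow_lt_pow_iff_right (by norm_num : 1 < 47)).1 h5
      omega
    have h7 : F = Q := eq_of_le_of_card_ge inf_le_left (by rw [hQ, hi', h6])
    apply hxZ
    rw [mem_Zc]
    refine ⟨hxQ, fun y hy => ?_⟩
    have hyF : y ∈ F := by rw [h7]; exact hy
    exact mem_centralizer_singleton_iff.1 hyF.2
  · exfalso
    exact hne (eq_of_le_of_card_ge (Zc_le _) (by rw [hQ, hj]))

lemma Zc_le_D (N : NA G) (Q : Sylow 47 G) {D : Subgroup G} (hD : Nat.card D = 47 ^ 2) (hDQ : D ≤ Q) :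
    Zc (Q : Subgroup G) ≤ D := by
  have hQ := cardQ N.toHyp Q
  set F : Subgroup G := Q ⊓ centralizer (D : Set G)
  have hDF : D ≤ F := by
    intro d hd
    refine mem_inf.2 ⟨hDQ hd, ?_⟩
    rw [mem_centralizer_iff]
    intro e he
    exact comm_of_card_sq hD he hd
  have hZF : Zc (Q : Subgroup G) ≤ F := by
    intro z hz
    refine mem_inf.2 ⟨Zc_le _ hz, ?_⟩
    rw [mem_centralizer_iff]
    intro e he
    exact (mem_Zc.1 hz).2 e (hDQ he)
  have hF : Nat.card F ∣ 47 ^ 3 := hQ ▸ card_dvd_of_le inf_le_left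
  obtain ⟨i, hi, hi'⟩ := pow_card_cases hF
  have h1 : i ≤ 2 := by
    by_contra hcon
    have h6 : i = 3 := by omega
    have h7 : F = Q := eq_of_le_of_card_ge inf_le_left (by rw [hQ, hi', h6])
    have h8 : D ≤ Zc (Q : Subgroup G) := by
      intro d hd
      rw [mem_Zc]
      refine ⟨hDQ hd, fun x hx => ?_⟩
      have hxF : x ∈ F := by rw [h7]; exact hx
      exact (mem_centralizer_iff.1 hxF.2 d hd).symm
    have h9 := Nat.le_of_dvd Nat.card_pos (card_dvd_of_le h8)
    rw [hD, cZ N] at h9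
    norm_num at h9
  have h2 : D = F := by
    apply eq_of_le_of_card_ge hDF
    rw [hD, hi']
    exact Nat.pow_le_pow_right (by norm_num) h1
  rw [h2]; exact hZF

lemma comm_mem_Zc (N : NA G) (Q : Sylow 47 G) {x y : G} (hx : x ∈ Q) (hy : y ∈ Q) :
    x * y * x⁻¹ * y⁻¹ ∈ Zc (Q : Subgroup G) := by
  have hQ := cardQ N.toHyp Q
  have h1 := card_quot (center (Q : Subgroup G)) (a := 47) (b := 47 ^ 2)
    (by rw [← card_Zc, cZ N]) (by rw [hQ]; norm_num)
  have h2 := IsPGroup.isMulCommutative_of_card_eq_prime_sq h1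
  have h3 := h2.is_comm.comm ((⟨x, hx⟩ : (Q : Subgroup G)) : (Q : Subgroup G) ⧸ center (Q : Subgroup G))
    ((⟨y, hy⟩ : (Q : Subgroup G)) : (Q : Subgroup G) ⧸ center (Q : Subgroup G))
  have h4 := QuotientGroup.eq.1 h3.symm
  have h5 := fun g hg => congrArg Subtype.val (mem_center_iff.1 h4 ⟨g, hg⟩)
  simp only [Subgroup.coe_mul, Subgroup.coe_inv] at h5
  have h6 : (y * x)⁻¹ * (x * y) ∈ Zc (Q : Subgroup G) :=
    mem_Zc.2 ⟨mul_mem (inv_mem (mul_mem hy hx)) (mul_mem hx hy), h5⟩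
  have h7 := (mem_Zc.1 h6).2 (y * x) (mul_mem hy hx)
  have h8 : x * y * x⁻¹ * y⁻¹ = (y * x)⁻¹ * (x * y) := by
    have : x * y = ((y * x)⁻¹ * (x * y)) * (y * x) := by rw [← h7]; group
    calc x * y * x⁻¹ * y⁻¹ = (x * y) * (y * x)⁻¹ := by group
      _ = _ := by
        conv_lhs => rw [this]
        group
  rw [h8]; exact h6

lemma cent_D (N : NA G) {D : Subgroup G} (hD : Nat.card D = 47 ^ 2) {K : Subgroup G}
    (hK : K ≤ centralizer (D : Set G)) (hDK : D ≤ K) :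
    ∃ c, c ∣ 2 ^ 6 * 23 ^ 2 ∧ Nat.card K = 47 ^ 2 * c := by
  obtain ⟨x, hxD, hx⟩ := exists_order47 (D := D) (by rw [hD]; norm_num)
  refine cent_card N.toHyp hx (hK.trans ?_) (hD ▸ card_dvd_of_le hDK) ?_
  · intro y hy
    rw [mem_centralizer_singleton_iff]
    exact (mem_centralizer_iff.1 hy x hxD).symm
  · intro h3
    have S : Sylow 47 K := default
    haveI : (D.subgroupOf K).Normal := by
      rw [normal_subgroupOf_iff_le_normalizer hDK]
      exact hK.trans (centralizer_le_normalizer _)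
    have hDp : IsPGroup 47 D := IsPGroup.of_card hD
    have h4 : D.subgroupOf K ≤ S := le_sylow_of_normal (hDp.of_equiv (subgroupOfEquivOfLe hDK).symm) S
    have h5 := S.pow_dvd_card_of_pow_dvd_card h3
    have hSp : IsPGroup 47 ((S : Subgroup K).map K.subtype) := S.2.map _
    obtain ⟨Q, hQ⟩ := hSp.exists_le_sylow
    have h6 : Nat.card ((S : Subgroup K).map K.subtype) = Nat.card S :=
      Nat.card_congr ((S : Subgroup K).equivMapOfInjective _ K.subtype_injective).symm.toEquiv
    have h7 : (S : Subgroup K).map K.subtype = Q := by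
      apply eq_of_le_of_card_ge hQ
      rw [cardQ N.toHyp, h6]
      exact Nat.le_of_dvd Nat.card_pos h5
    have h8 : D ≤ Zc (Q : Subgroup G) := by
      intro d hd
      rw [mem_Zc, ← h7]
      refine ⟨⟨⟨d, hDK hd⟩, h4 hd, rfl⟩, ?_⟩
      rintro _ ⟨y, -, rfl⟩
      exact (mem_centralizer_iff.1 (hK y.2) d hd).symm
    have h9 := Nat.le_of_dvd Nat.card_pos (card_dvd_of_le h8)
    rw [hD, cZ N] at h9
    norm_num at h9

/-- elements centralizing `Z` and acting trivially on `D / Z` -/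
def unip (D Z : Subgroup G) : Subgroup G where
  carrier := {g | (∀ z ∈ Z, g * z = z * g) ∧ ∀ d ∈ D, g * d * g⁻¹ * d⁻¹ ∈ Z}
  one_mem' := by
    refine ⟨fun z _ => by simp, fun d _ => by simp⟩
  mul_mem' := by
    rintro a b ⟨ha1, ha2⟩ ⟨hb1, hb2⟩
    refine ⟨fun z hz => by rw [mul_assoc, hb1 z hz, ← mul_assoc, ha1 z hz, mul_assoc], fun d hd => ?_⟩
    have h1 := ha1 _ (hb2 d hd)
    have h2 : a * b * d * (a * b)⁻¹ * d⁻¹ = (b * d * b⁻¹ * d⁻¹) * (a * d * a⁻¹ * d⁻¹) := by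
      calc a * b * d * (a * b)⁻¹ * d⁻¹ = a * (b * d * b⁻¹ * d⁻¹) * (d * a⁻¹ * d⁻¹) := by group
        _ = _ := by rw [h1]; group
    rw [h2]
    exact mul_mem (hb2 d hd) (ha2 d hd)
  inv_mem' := by
    rintro a ⟨ha1, ha2⟩
    have ha1' : ∀ z ∈ Z, a⁻¹ * z = z * a⁻¹ := by
      intro z hz
      have := ha1 z hz
      rw [inv_mul_eq_iff_eq_mul, ← mul_assoc, this]; group
    refine ⟨ha1', fun d hd => ?_⟩
    have h1 := ha1' _ (ha2 d hd)
    have h2 : a⁻¹ * d * a⁻¹⁻¹ * d⁻¹ = (a * d * a⁻¹ * d⁻¹)⁻¹ := by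
      rw [eq_inv_iff_mul_eq_one]
      have h3 : a⁻¹ * d * a⁻¹⁻¹ * d⁻¹ = a⁻¹ * (a * d * a⁻¹ * d⁻¹)⁻¹ * a := by group
      have h4 := ha1' _ (inv_mem (ha2 d hd))
      rw [h3, h4]; group
    rw [h2]
    exact inv_mem (ha2 d hd)

lemma L2 (N : NA G) {D : Subgroup G} (hD : Nat.card D = 47 ^ 2) {Q Q' : Sylow 47 G} (hQ : D ≤ Q) (hQ' : D ≤ Q')
    (hZ : Zc (Q : Subgroup G) = Zc (Q' : Subgroup G)) : Q = Q' := by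
  set Z := Zc (Q : Subgroup G)
  have hZD : Z ≤ D := Zc_le_D N Q hD hQ
  have hZcard : Nat.card Z = 47 := cZ N Q
  set Y := unip D Z
  have hle : ∀ R : Sylow 47 G, D ≤ R → Zc (R : Subgroup G) = Z → (R : Subgroup G) ≤ Y := by
    intro R hDR hRZ x hx
    refine ⟨fun z hz => ?_, fun d hd => ?_⟩
    · rw [← hRZ] at hz; exact (mem_Zc.1 hz).2 x hx
    · rw [← hRZ]; exact comm_mem_Zc N R hx (hDR hd)
  have h1 := hle Q hQ rfl
  have h2 := hle Q' hQ' hZ.symm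
  have hDY : D ≤ Y := hQ.trans h1
  obtain ⟨d₀, hd₀, hd₀Z⟩ : ∃ d ∈ D, d ∉ Z := by
    by_contra hcon
    push Not at hcon
    have h9 := Nat.le_of_dvd Nat.card_pos (card_dvd_of_le (show D ≤ Z from hcon))
    rw [hD, hZcard] at h9
    norm_num at h9
  have hYnorm : Y ≤ normalizer (D : Set G) := by
    have key : ∀ g ∈ Y, ∀ d ∈ D, g * d * g⁻¹ ∈ D := by
      intro g hg d hd
      have := D.mul_mem (hZD (hg.2 d hd)) hd
      simpa using this
    intro g hg
    rw [mem_normalizer_iff]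
    intro d
    refine ⟨key g hg d, fun h => ?_⟩
    have := key g⁻¹ (inv_mem hg) _ h
    simpa [mul_assoc] using this
  haveI : (D.subgroupOf Y).Normal := by
    rw [normal_subgroupOf_iff_le_normalizer hDY]; exact hYnorm
  let f : Y →* Z :=
    { toFun := fun g => ⟨g * d₀ * (g : G)⁻¹ * d₀⁻¹, g.2.2 d₀ hd₀⟩
      map_one' := Subtype.ext (by simp)
      map_mul' := fun a b => Subtype.ext (by
        have e1 := a.2.1 _ (b.2.2 d₀ hd₀)
        have e2 := comm_of_card_sq hD (hZD (a.2.2 d₀ hd₀)) (hZD (b.2.2 d₀ hd₀))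
        simp only [Subgroup.coe_mul]
        rw [e2]
        calc (a : G) * b * d₀ * ((a : G) * b)⁻¹ * d₀⁻¹
            = a * (b * d₀ * (b : G)⁻¹ * d₀⁻¹) * (d₀ * (a : G)⁻¹ * d₀⁻¹) := by group
          _ = _ := by rw [e1]; group) }
  let C : Subgroup Y := f.ker
  have hmemC : ∀ g : Y, g ∈ C ↔ ∀ d ∈ D, (g : G) * d = d * g := by
    intro g
    constructor
    · intro hg
      have h3 : (g : G) * d₀ * (g : G)⁻¹ * d₀⁻¹ = 1 := congrArg Subtype.val hg
      have h4 : (g : G) * d₀ = d₀ * g := by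
        rw [mul_inv_eq_one, mul_inv_eq_iff_eq_mul] at h3; exact h3
      set F : Subgroup G := D ⊓ centralizer ({(g : G)} : Set G)
      have hZF : Z ≤ F := by
        intro z hz
        refine mem_inf.2 ⟨hZD hz, ?_⟩
        rw [mem_centralizer_singleton_iff]
        exact (g.2.1 z hz).symm
      have hdF : d₀ ∈ F := mem_inf.2 ⟨hd₀, mem_centralizer_singleton_iff.2 h4.symm⟩
      have hF : Nat.card F ∣ 47 ^ 2 := hD ▸ card_dvd_of_le inf_le_left
      obtain ⟨i, hi, hi'⟩ := pow_card_cases hF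
      have h5 : Nat.card Z < Nat.card F := by
        apply lt_of_le_of_ne (Nat.le_of_dvd Nat.card_pos (card_dvd_of_le hZF))
        intro h
        apply hd₀Z
        rw [eq_of_le_of_card_ge hZF h.ge]; exact hdF
      have h6 : i = 2 := by
        rw [hZcard, hi'] at h5
        interval_cases i
        · norm_num at h5
        · norm_num at h5
        · rfl
      have h7 : F = D := eq_of_le_of_card_ge inf_le_left (by rw [hD, hi', h6])
      intro d hd
      have : d ∈ F := by rw [h7]; exact hd
      exact (mem_centralizer_singleton_iff.1 this.2).symm
    · intro hg
      apply Subtype.ext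
      show (g : G) * d₀ * (g : G)⁻¹ * d₀⁻¹ = 1
      rw [hg d₀ hd₀]; group
  have hDC : D.subgroupOf Y ≤ C := by
    intro g hg
    rw [hmemC]
    intro d hd
    exact comm_of_card_sq hD hg hd
  obtain ⟨c, hc, hcC⟩ := cent_D N hD (K := C.map Y.subtype) (by
      rintro _ ⟨g, hg, rfl⟩
      rw [mem_centralizer_iff]
      intro d hd
      exact ((hmemC g).1 hg d hd).symm) (by
      intro d hd
      exact ⟨⟨d, hDY hd⟩, hDC hd, rfl⟩)
  have hcC' : Nat.card C = Nat.card (D.subgroupOf Y) * c := by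
    rw [Nat.card_congr (subgroupOfEquivOfLe hDY).toEquiv, hD, ← hcC]
    exact Nat.card_congr (C.equivMapOfInjective _ Y.subtype_injective).toEquiv
  obtain ⟨k, hk⟩ : ∃ k, C.index = 47 ^ k := by
    have : C.index ∣ 47 ^ 1 := by
      rw [index_ker, pow_one, ← hZcard]
      exact card_subgroup_dvd_card _
    obtain ⟨k, -, hk⟩ := (Nat.dvd_prime_pow (by norm_num)).1 this
    exact ⟨k, hk⟩
  have hDp : IsPGroup 47 D := IsPGroup.of_card hD
  have h8 := L5 (D.subgroupOf Y) C hDC (hDp.of_equiv (subgroupOfEquivOfLe hDY).symm) hcC' hc hk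
    (Q.subtype h1)
  exact (Sylow.subtype_injective (sylow_unique_of_normal h8 (Q'.subtype h2))).symm

end na
end OD
open scoped MatrixGroups
namespace OD
open Subgroup
open scoped Pointwise
set_option linter.style.haveILetI false
set_option linter.unusedSectionVars false
set_option linter.unusedVariables false

variable {G : Type*} [Group G] [Finite G]

lemma eq_of_mem_47 {A B : Subgroup G} (hA : Nat.card A = 47) (hB : Nat.card B = 47) {z : G}
    (hzA : z ∈ A) (hzB : z ∈ B) (hz : z ≠ 1) : A = B := by
  have h1 : Nat.card (A ⊓ B : Subgroup G) ∣ 47 := hA ▸ card_dvd_of_le inf_le_left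
  have h2 : Nat.card (A ⊓ B : Subgroup G) ≠ 1 := by
    intro h
    rw [card_eq_one] at h
    have : z ∈ A ⊓ B := ⟨hzA, hzB⟩
    rw [h] at this
    exact hz (mem_bot.1 this)
  have h3 := ((Nat.dvd_prime (by norm_num)).1 h1).resolve_left h2
  have h4 : A ⊓ B = A := eq_of_le_of_card_ge inf_le_left (by rw [hA, h3])
  have h5 : A ⊓ B = B := eq_of_le_of_card_ge inf_le_right (by rw [hB, h3])
  exact h4.symm.trans h5

lemma card_ne_one_sub (A : Subgroup G) : Nat.card {z : A // z ≠ 1} = Nat.card A - 1 := by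
  classical
  haveI : Fintype A := Fintype.ofFinite _
  rw [Nat.card_eq_fintype_card, Nat.card_eq_fintype_card, ← Set.card_ne_eq (1 : A)]
  exact Fintype.card_congr (Equiv.refl _)

lemma le_smul_of_norm {D : Subgroup G} {Q : Sylow 47 G} (h : D ≤ Q) {g : G}
    (hg : g ∈ normalizer (D : Set G)) : D ≤ ((g • Q : Sylow 47 G) : Subgroup G) := by
  intro d hd
  have h1 : g⁻¹ * d * g ∈ D := by
    have := (mem_normalizer_iff.1 (inv_mem hg) d).1 hd
    simpa using this
  exact (mem_smul_iff g d Q).2 (h h1)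

section na

lemma over_uniq (N : NA G) {D : Subgroup G} (hD : Nat.card D = 47 ^ 2) {Q Q' : Sylow 47 G} (hQ : D ≤ Q)
    (hQ' : D ≤ Q') {z : G} (hz : z ∈ Zc (Q : Subgroup G)) (hz' : z ∈ Zc (Q' : Subgroup G))
    (h1 : z ≠ 1) : Q = Q' :=
  L2 N hD hQ hQ' (eq_of_mem_47 (cZ N Q) (cZ N Q') hz hz' h1)

lemma over_ncard (N : NA G) {D : Subgroup G} (hD : Nat.card D = 47 ^ 2) :
    Nat.card (SylOver D) ≤ 48 ∧ (Nat.card (SylOver D) = 48 → ∀ d ∈ D, d ≠ 1 →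
      ∃ Q : Sylow 47 G, D ≤ Q ∧ d ∈ Zc (Q : Subgroup G)) := by
  classical
  let f : (Σ Q : SylOver D, {z : Zc ((Q : Sylow 47 G) : Subgroup G) // z ≠ 1}) → {d : D // d ≠ 1} :=
    fun p => ⟨⟨p.2.1, Zc_le_D N p.1 hD p.1.2 p.2.1.2⟩, fun h => p.2.2 (Subtype.ext (by
      have := congrArg (Subtype.val : D → G) h; exact this))⟩
  have hf : Function.Injective f := by
    rintro ⟨Q, z, hz⟩ ⟨Q', z', hz'⟩ h
    have h1 : (z : G) = z' := congrArg (fun d => ((d.1 : D) : G)) h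
    have h2 : Q = Q' := by
      apply Subtype.ext
      refine over_uniq N hD Q.2 Q'.2 z.2 (h1 ▸ z'.2) ?_
      intro h; exact hz (Subtype.ext h)
    subst h2
    congr
    exact Subtype.ext h1
  haveI : Fintype (SylOver D) := Fintype.ofFinite _
  have hc1 : Nat.card (Σ Q : SylOver D, {z : Zc ((Q : Sylow 47 G) : Subgroup G) // z ≠ 1}) =
      Nat.card (SylOver D) * 46 := by
    rw [Nat.card_sigma, Finset.sum_congr rfl (g := fun _ => 46)]
    · simp
    · intro Q _
      rw [card_ne_one_sub, cZ N]
  have hc2 : Nat.card {d : D // d ≠ 1} = 48 * 46 := by rw [card_ne_one_sub, hD]; norm_num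
  constructor
  · have := Nat.card_le_card_of_injective f hf
    rw [hc1, hc2] at this
    omega
  · intro h48 d hd hd1
    have hb := (Nat.bijective_iff_injective_and_card f).2 ⟨hf, by rw [hc1, hc2, h48]⟩
    obtain ⟨⟨Q, z, hz⟩, h⟩ := hb.2 ⟨⟨d, hd⟩, fun h => hd1 (congrArg Subtype.val h)⟩
    have h1 : (z : G) = d := congrArg (fun d => ((d.1 : D) : G)) h
    exact ⟨Q, Q.2, h1 ▸ z.2⟩

lemma over_inf (N : NA G) {D : Subgroup G} (hD : Nat.card D = 47 ^ 2) {Q Q' : Sylow 47 G} (hQ : D ≤ Q)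
    (hQ' : D ≤ Q') (hne : Q ≠ Q') : (Q ⊓ Q' : Subgroup G) = D := by
  have h1 : Nat.card (Q ⊓ Q' : Subgroup G) ∣ 47 ^ 3 := cardQ N.toHyp Q ▸ card_dvd_of_le inf_le_left
  obtain ⟨i, hi, hi'⟩ := pow_card_cases h1
  symm
  apply eq_of_le_of_card_ge (le_inf hQ hQ')
  rw [hi', hD]
  apply Nat.pow_le_pow_right (by norm_num)
  by_contra hcon
  have h3 : i = 3 := by omega
  apply hne
  apply syl_eq_of_le
  have : (Q ⊓ Q' : Subgroup G) = Q := eq_of_le_of_card_ge inf_le_left (by rw [cardQ N.toHyp, hi', h3])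
  rw [← this]; exact inf_le_right

lemma over_eq (N : NA G) {D : Subgroup G} (hD : Nat.card D = 47 ^ 2) {Q Q' : Sylow 47 G} (hQ : D ≤ Q)
    (hQ' : D ≤ Q') (hne : Q ≠ Q') :
    Nat.card (SylOver D) = 48 ∧ Nat.card (MulAction.orbit Q Q') = 47 ∧
      SylOver D = insert Q (MulAction.orbit Q Q') := by
  have h1 := card_orbit_sylow Q Q'
  rw [over_inf N hD hQ hQ' hne, hD, cardQ N.toHyp] at h1
  have h2 : Nat.card (MulAction.orbit Q Q') = 47 := by omega
  have hsub : insert Q (MulAction.orbit Q Q') ⊆ SylOver D := by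
    rintro R (rfl | ⟨q, rfl⟩)
    · exact hQ
    · exact le_smul_of_norm hQ' (le_norm_of_sq (cardQ N.toHyp Q) hD hQ q.2)
  have hni : Q ∉ MulAction.orbit Q Q' := by
    rintro ⟨q, hq⟩
    apply hne
    have h3 : (q : G) • Q' = Q := hq
    have h4 : Q' = (q : G)⁻¹ • Q := eq_inv_smul_iff.2 h3
    rw [h4]; exact (Sylow.smul_eq_iff_mem_normalizer.2 (inv_mem (le_normalizer q.2))).symm
  have h3 : (insert Q (MulAction.orbit Q Q') : Set (Sylow 47 G)).ncard = 48 := by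
    rw [Set.ncard_insert_of_notMem hni (Set.toFinite _), ← Nat.card_coe_set_eq, h2]
  have h4 := (over_ncard N hD).1
  rw [Nat.card_coe_set_eq] at h4 ⊢
  have h5 := Set.eq_of_subset_of_ncard_le hsub (by rw [h3]; exact h4) (Set.toFinite _)
  exact ⟨by rw [← h5, h3], h2, h5.symm⟩

lemma over_trans (N : NA G) {D : Subgroup G} (hD : Nat.card D = 47 ^ 2) {Q Q' : Sylow 47 G} (hQ : D ≤ Q)
    (hQ' : D ≤ Q') : ∃ g ∈ normalizer (D : Set G), g • Q = Q' := by
  by_cases hne : Q = Q'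
  · exact ⟨1, one_mem _, by rw [one_smul, hne]⟩
  obtain ⟨h48, -, -⟩ := over_eq N hD hQ hQ' hne
  obtain ⟨R, hR, hRQ, hRQ'⟩ : ∃ R ∈ SylOver D, R ≠ Q ∧ R ≠ Q' := by
    by_contra hcon
    push Not at hcon
    have hs : SylOver D ⊆ {Q, Q'} := by
      intro R hR
      by_cases h : R = Q
      · left; exact h
      · right; exact hcon R hR h
    have := Set.ncard_le_ncard hs (Set.toFinite _)
    have h2 := Set.ncard_pair hne
    rw [Nat.card_coe_set_eq] at h48
    omega
  obtain ⟨-, -, h5⟩ := over_eq N hD hR hQ hRQ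
  have h6 : Q' ∈ SylOver D := hQ'
  rw [h5] at h6
  rcases h6 with h6 | ⟨r, hr⟩
  · exact absurd h6.symm hRQ'
  · exact ⟨r, le_norm_of_sq (cardQ N.toHyp R) hD hR r.2, hr⟩

lemma card_norm_D (N : NA G) {D : Subgroup G} (hD : Nat.card D = 47 ^ 2) (Q : Sylow 47 G) (hQ : D ≤ Q) :
    Nat.card (normalizer (D : Set G)) = Nat.card (SylOver D) *
      Nat.card (normalizer (D : Set G) ⊓ normalizer (Q : Set G) : Subgroup G) := by
  have h1 := card_orbit_mul (S := normalizer (D : Set G)) Q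
  have h2 : MulAction.orbit (normalizer (D : Set G)) Q = SylOver D := by
    ext R
    constructor
    · rintro ⟨g, rfl⟩
      exact le_smul_of_norm hQ g.2
    · intro hR
      obtain ⟨g, hg, h⟩ := over_trans N hD hQ hR
      exact ⟨⟨g, hg⟩, h⟩
  rw [← h1, h2]
  congr 1
  have : MulAction.stabilizer (normalizer (D : Set G)) Q = (normalizer (Q : Set G)).subgroupOf (normalizer (D : Set G)) := by
    ext g
    rw [MulAction.mem_stabilizer_iff, mem_subgroupOf]
    exact Sylow.smul_eq_iff_mem_normalizer
  rw [this, inf_comm, ← inf_subgroupOf_right]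
  exact Nat.card_congr (subgroupOfEquivOfLe inf_le_right).toEquiv

end na
end OD
open scoped MatrixGroups
namespace OD
open Subgroup
open scoped Pointwise
set_option linter.style.haveILetI false
set_option linter.unusedSectionVars false
set_option linter.unusedVariables false

instance fact3 : Fact (Nat.Prime 3) := ⟨by norm_num⟩
instance fact2 : Fact (Nat.Prime 2) := ⟨by norm_num⟩

lemma no_2256 {M : Type*} [Group M] [Finite M] (hM : Nat.card M = 47 * 48)
    (h : ∀ P : Sylow 47 M, normalizer (P : Set M) = P) : False := by
  have P : Sylow 47 M := default
  obtain ⟨hPc, -⟩ := card_sylow_eq (a := 1) (m := 48) P (by rw [hM]; norm_num) (by norm_num)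
  have hPcom : normalizer (P : Set M) ≤ centralizer (P : Set M) := by
    rw [h P]
    have := isCyclic_of_prime_card (α := (P : Subgroup M)) (p := 47) (by rw [hPc]; norm_num)
    intro x hx
    rw [mem_centralizer_iff]
    intro y hy
    have h2 := this.commGroup.mul_comm (⟨y, hy⟩ : (P : Subgroup M)) ⟨x, hx⟩
    exact congrArg Subtype.val h2
  have hcompl := MonoidHom.ker_transferSylow_isComplement' P hPcom
  set F := (MonoidHom.transferSylow P hPcom).ker
  have hF : F.index = 47 := by
    rw [hcompl.symm.index_eq_card, hPc]; norm_num
  have hFc : Nat.card F = 48 := by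
    have := F.index_mul_card
    rw [hF, hM] at this
    omega
  have R : Sylow 3 F := default
  obtain ⟨hRc, -⟩ := card_sylow_eq (a := 1) (m := 16) R (by rw [hFc]; norm_num) (by norm_num)
  have hsup := R.normalizer_sup_eq_top
  set K := (R : Subgroup F).map F.subtype
  have hK : Nat.card K = 3 := by
    rw [← Nat.card_congr ((R : Subgroup F).equivMapOfInjective _ F.subtype_injective).toEquiv, hRc]
    norm_num
  have h47 : 47 ∣ Nat.card (normalizer (K : Set M)) := by
    have h1 := relIndex_sup_right (normalizer (K : Set M)) F
    have h2 : normalizer (K : Set M) ⊔ F = ⊤ := hsup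
    rw [h2, relIndex_top_right, hF] at h1
    rw [h1]
    exact relIndex_dvd_card _ _
  obtain ⟨c, hcN, hc⟩ := exists_order47 h47
  have hZ : Nat.card (zpowers c) = 47 := by rw [Nat.card_zpowers, hc]
  let S : Sylow 47 M := Sylow.ofCard (zpowers c) (by
    rw [hZ, factorization_eq (p := 47) (a := 1) (m := 48) (by norm_num) (by rw [hM]; norm_num) (by norm_num), pow_one])
  have hS := h S
  have hmod := fix_mod (r := 47) (zpowers c) K (IsPGroup.of_card (n := 1) (by rw [hZ]; norm_num))
    (by rwa [zpowers_le])
  rw [hK] at hmod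
  have hle : Nat.card (K ⊓ centralizer (zpowers c : Set M) : Subgroup M) ≤ 3 := by
    rw [← hK]; exact Nat.le_of_dvd Nat.card_pos (card_dvd_of_le inf_le_left)
  have h3 : Nat.card (K ⊓ centralizer (zpowers c : Set M) : Subgroup M) = 3 := by
    unfold Nat.ModEq at hmod; omega
  have h4 : (K ⊓ centralizer (zpowers c : Set M) : Subgroup M) ≤ zpowers c := by
    have : (S : Subgroup M) = zpowers c := rfl
    calc _ ≤ normalizer (zpowers c : Set M) := inf_le_right.trans (centralizer_le_normalizer _)
      _ ≤ _ := hS.le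
  have h5 := card_dvd_of_le h4
  rw [h3, hZ] at h5
  revert h5; norm_num

lemma no_2256q {X : Type*} [Group X] [Finite X] (E : Subgroup X) [E.Normal] (hE : Nat.card E = 47 ^ 2)
    (hX : Nat.card X = 47 ^ 3 * 48)
    (h : ∀ S : Subgroup X, Nat.card S = 47 ^ 3 → normalizer (S : Set X) = S) : False := by
  have hM : Nat.card (X ⧸ E) = 47 * 48 := card_quot E hE (by rw [hX]; norm_num)
  apply no_2256 hM
  intro P
  obtain ⟨hPc, hPi⟩ := card_sylow_eq (a := 1) (m := 48) P (by rw [hM]; norm_num) (by norm_num)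
  have hs := QuotientGroup.mk'_surjective E
  have h1 : Nat.card ((P : Subgroup (X ⧸ E)).comap (QuotientGroup.mk' E)) = 47 ^ 3 := by
    have := index_mul_card ((P : Subgroup (X ⧸ E)).comap (QuotientGroup.mk' E))
    rw [index_comap_of_surjective _ hs, hPi, hX] at this
    omega
  have h2 := h _ h1
  have h3 := comap_normalizer_eq_of_surjective (P : Subgroup (X ⧸ E)) hs
  exact comap_injective hs (h3.trans h2)

variable {G : Type*} [Group G] [Finite G]

section na

/-- a subgroup of order 47^3 as a Sylow subgroup -/
lemma exists_sylow_eq (N : NA G) {S : Subgroup G} (hS : Nat.card S = 47 ^ 3) : ∃ Q : Sylow 47 G, (Q : Subgroup G) = S := by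
  obtain ⟨Q, hQ⟩ := (IsPGroup.of_card hS).exists_le_sylow
  exact ⟨Q, (eq_of_le_of_card_ge hQ (by rw [hS, cardQ N.toHyp])).symm⟩

lemma card_EC (N : NA G) (Q : Sylow 47 G) {x : G} (hxQ : x ∈ Q) (hxZ : x ∉ Zc (Q : Subgroup G)) :
    Nat.card ((Q : Subgroup G) ⊓ centralizer ({x} : Set G) : Subgroup G) = 47 ^ 2 := by
  have hQ := cardQ N.toHyp Q
  set F : Subgroup G := Q ⊓ centralizer ({x} : Set G)
  have hZF : Zc (Q : Subgroup G) ≤ F := by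
    intro z hz
    refine mem_inf.2 ⟨Zc_le _ hz, ?_⟩
    rw [mem_centralizer_singleton_iff]
    exact ((mem_Zc.1 hz).2 x hxQ).symm
  have hxF : x ∈ F := mem_inf.2 ⟨hxQ, mem_centralizer_singleton_iff.2 rfl⟩
  have hF : Nat.card F ∣ 47 ^ 3 := hQ ▸ card_dvd_of_le inf_le_left
  obtain ⟨i, hi, hi'⟩ := pow_card_cases hF
  have h5 : Nat.card (Zc (Q : Subgroup G)) < Nat.card F := by
    apply lt_of_le_of_ne (Nat.le_of_dvd Nat.card_pos (card_dvd_of_le hZF))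
    intro h
    apply hxZ
    rw [eq_of_le_of_card_ge hZF h.ge]; exact hxF
  rw [cZ N, hi'] at h5
  interval_cases i
  · norm_num at h5
  · norm_num at h5
  · exact hi'
  · exfalso
    have h7 : F = Q := eq_of_le_of_card_ge inf_le_left (by rw [hQ, hi'])
    apply hxZ
    rw [mem_Zc]
    refine ⟨hxQ, fun y hy => ?_⟩
    have hyF : y ∈ F := by rw [h7]; exact hy
    exact mem_centralizer_singleton_iff.1 hyF.2

lemma cent_central (N : NA G) (hN : ∀ Q : Sylow 47 G, Nat.card (normalizer (Q : Set G)) = 47 ^ 3)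
    (Q : Sylow 47 G) {x : G} (hx : orderOf x = 47) (hxZ : x ∈ Zc (Q : Subgroup G)) :
    IsPGroup 47 (centralizer ({x} : Set G)) := by
  set X := centralizer ({x} : Set G)
  have hQX : (Q : Subgroup G) ≤ X := by
    intro y hy; rw [mem_centralizer_singleton_iff]; exact (mem_Zc.1 hxZ).2 y hy
  obtain ⟨c, hc, hcX⟩ := cent_card N.toHyp hx (X := X) le_rfl (k := 3)
    (cardQ N.toHyp Q ▸ card_dvd_of_le hQX) (not_47_4 N.toHyp X)
  have hZz : Zc (Q : Subgroup G) = zpowers x := by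
    refine eq_of_mem_47 (cZ N Q) (by rw [Nat.card_zpowers, hx]) hxZ (mem_zpowers x) ?_
    rintro rfl; rw [orderOf_one] at hx; norm_num at hx
  have hZX : Zc (Q : Subgroup G) ≤ X := (Zc_le _).trans hQX
  haveI : ((Zc (Q : Subgroup G)).subgroupOf X).Normal := by
    rw [normal_subgroupOf_iff_le_normalizer hZX, hZz]
    refine le_trans ?_ (centralizer_le_normalizer _)
    intro y hy
    rw [mem_centralizer_iff]
    rintro _ ⟨n, rfl⟩
    exact (Commute.zpow_right (show Commute y x from mem_centralizer_singleton_iff.1 hy) n).symm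
  have h1 : ((Q.subtype hQX : Sylow 47 X) : Subgroup X).Normal := by
    refine L1q ((Zc (Q : Subgroup G)).subgroupOf X) (j := 1) (k := 2) (c := c) ?_ (by rw [hcX]; ring) hc _ ?_
    · rw [Nat.card_congr (subgroupOfEquivOfLe hZX).toEquiv, cZ N]; norm_num
    · intro g hg q hq
      have hg' : (g : G) ∈ normalizer ((Q : Subgroup G) : Set G) :=
        (mem_normalizer_subgroupOf hQX g).1 hg
      have hgQ : (g : G) ∈ Q := inf_norm_eq N.toHyp Q (h := 1) (by rw [hN, mul_one]) (Or.inl rfl) hx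
        (le_refl X) g.2 hg' hQX
      have := comm_mem_Zc N Q (inv_mem hgQ) (inv_mem (show (q : G) ∈ Q from hq))
      rw [mem_subgroupOf]
      convert this using 1
      simp [mul_assoc]
  have h2 : X ≤ normalizer (Q : Set G) := le_normalizer_of_subtype hQX h1
  have h3 : (Q : Subgroup G) = normalizer (Q : Set G) :=
    eq_of_le_of_card_ge le_normalizer (by rw [hN, cardQ N.toHyp])
  rw [← h3] at h2
  exact Q.2.to_le h2

lemma cent_noncentral (N : NA G) (hN : ∀ Q : Sylow 47 G, Nat.card (normalizer (Q : Set G)) = 47 ^ 3)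
    (Q : Sylow 47 G) {x : G} (hx : orderOf x = 47) (hxQ : x ∈ Q) (hxZ : x ∉ Zc (Q : Subgroup G)) :
    IsPGroup 47 (centralizer ({x} : Set G)) := by
  have hNQ : ∀ Q : Sylow 47 G, normalizer (Q : Set G) = Q := fun Q =>
    (eq_of_le_of_card_ge le_normalizer ((hN Q).trans (cardQ N.toHyp Q).symm).le).symm
  set X := centralizer ({x} : Set G) with hXdef
  have hE := card_EC N Q hxQ hxZ
  set E : Subgroup G := (Q : Subgroup G) ⊓ X with hEdef
  have hEQ : E ≤ Q := inf_le_left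
  have hEX : E ≤ X := inf_le_right
  have hQN := le_norm_of_sq (cardQ N.toHyp Q) hE hEQ
  have huniq : ∀ R : Sylow 47 G, E ≤ R → R = Q := by
    by_contra hcon
    push Not at hcon
    obtain ⟨R, hER, hRQ⟩ := hcon
    obtain ⟨h48, -, -⟩ := over_eq N hE hER hEQ hRQ
    have h1 := card_norm_D N hE Q hEQ
    rw [h48, hNQ Q, inf_eq_right.2 hQN, cardQ N.toHyp] at h1
    haveI : (E.subgroupOf (normalizer (E : Set G))).Normal := by
      rw [normal_subgroupOf_iff_le_normalizer le_normalizer]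
    refine no_2256q (E.subgroupOf (normalizer (E : Set G))) ?_ (by rw [h1]; norm_num) ?_
    · rw [Nat.card_congr (subgroupOfEquivOfLe le_normalizer).toEquiv, hE]
    · intro S hS
      obtain ⟨R, hR⟩ := exists_sylow_eq N (S := S.map (Subgroup.subtype _)) (by
        rw [← hS]; exact Nat.card_congr (S.equivMapOfInjective _ (Subgroup.subtype_injective _)).symm.toEquiv)
      have hRN : (R : Subgroup G) ≤ normalizer (E : Set G) := by
        rw [hR]; exact map_subtype_le _
      have hSR : S = (R : Subgroup G).subgroupOf (normalizer (E : Set G)) := by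
        rw [hR]
        exact (comap_map_eq_self_of_injective (Subgroup.subtype_injective _) S).symm
      ext g
      rw [hSR, mem_normalizer_subgroupOf hRN]
      exact SetLike.ext_iff.1 (hNQ R) (g : G)
  have hNE : normalizer (E : Set G) ≤ Q := by
    intro g hg
    rw [← hNQ Q]
    exact Sylow.smul_eq_iff_mem_normalizer.1 (huniq _ (le_smul_of_norm hEQ hg))
  obtain ⟨c, hc, hcX⟩ := cent_card N.toHyp hx (X := X) le_rfl (k := 2)
    (hE ▸ card_dvd_of_le hEX) (by
      intro h3
      have hEp : IsPGroup 47 (E.subgroupOf X) :=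
        (IsPGroup.of_card hE).of_equiv (subgroupOfEquivOfLe hEX).symm
      obtain ⟨S, hS⟩ := hEp.exists_le_sylow
      have h5 := S.pow_dvd_card_of_pow_dvd_card h3
      have hSp : IsPGroup 47 ((S : Subgroup X).map X.subtype) := S.2.map _
      obtain ⟨R, hR⟩ := hSp.exists_le_sylow
      have h6 : Nat.card ((S : Subgroup X).map X.subtype) = Nat.card S :=
        Nat.card_congr ((S : Subgroup X).equivMapOfInjective _ X.subtype_injective).symm.toEquiv
      have h7 : (S : Subgroup X).map X.subtype = R := by
        apply eq_of_le_of_card_ge hR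
        rw [cardQ N.toHyp, h6]
        exact Nat.le_of_dvd Nat.card_pos h5
      have h8 : E ≤ R := by
        rw [← h7]
        intro e he
        exact ⟨⟨e, hEX he⟩, hS he, rfl⟩
      have h9 := huniq R h8
      apply hxZ
      rw [mem_Zc]
      refine ⟨hxQ, fun y hy => ?_⟩
      rw [← h9, ← h7] at hy
      obtain ⟨y', -, rfl⟩ := hy
      exact mem_centralizer_singleton_iff.1 y'.2)
  have h1 : X ≤ normalizer (E : Set G) := by
    refine L1sub hEX hcX hc hE ?_
    intro g hgX hgN y hy
    exact comm_of_card_sq hE hy (mem_inf.2 ⟨hNE hgN, hgX⟩)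
  exact Q.2.to_le (h1.trans hNE)

lemma step4 (N : NA G) (hN : ∀ Q : Sylow 47 G, Nat.card (normalizer (Q : Set G)) = 47 ^ 3) : False := by
  apply isolated_contra N.toHyp
  intro Q x hxQ hx
  by_cases h : x ∈ Zc (Q : Subgroup G)
  · exact cent_central N hN Q hx h
  · exact cent_noncentral N hN Q hx hxQ h

end na
end OD
open scoped MatrixGroups
namespace OD
open Subgroup
open scoped Pointwise
set_option linter.style.haveILetI false
set_option linter.unusedSectionVars false
set_option linter.unusedVariables false

variable {G : Type*} [Group G] [Finite G]

/-- subgroups of order 47^2 of `Q` lying in 48 Sylow subgroups -/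
def Ess (Q : Sylow 47 G) : Set (Subgroup G) :=
  {D | Nat.card D = 47 ^ 2 ∧ D ≤ Q ∧ Nat.card (SylOver D) = 48}

lemma card_notMem (A B : Subgroup G) (h : B ≤ A) :
    Nat.card {x : G // x ∈ A ∧ x ∉ B} = Nat.card A - Nat.card B := by
  have h1 : Nat.card {x : G // x ∈ A ∧ x ∉ B} = ((A : Set G) \ (B : Set G)).ncard :=
    Nat.card_coe_set_eq _
  rw [h1, Set.ncard_sdiff h (Set.toFinite _)]
  rfl

section na

lemma sq_inf (N : NA G) (Q : Sylow 47 G) {D D' : Subgroup G} (hD : Nat.card D = 47 ^ 2) (hD' : Nat.card D' = 47 ^ 2)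
    (h : D ≤ Q) (h' : D' ≤ Q) (hne : D ≠ D') : D ⊓ D' = Zc (Q : Subgroup G) := by
  have h1 : Zc (Q : Subgroup G) ≤ D ⊓ D' := le_inf (Zc_le_D N Q hD h) (Zc_le_D N Q hD' h')
  symm
  apply eq_of_le_of_card_ge h1
  have h2 : Nat.card (D ⊓ D' : Subgroup G) ∣ 47 ^ 2 := hD ▸ card_dvd_of_le inf_le_left
  obtain ⟨i, hi, hi'⟩ := pow_card_cases h2
  rw [cZ N, hi']
  interval_cases i
  · norm_num
  · norm_num
  · exfalso
    apply hne
    have h3 : D ⊓ D' = D := eq_of_le_of_card_ge inf_le_left (by rw [hD, hi'])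
    have h4 : D ⊓ D' = D' := eq_of_le_of_card_ge inf_le_right (by rw [hD', hi'])
    exact h3.symm.trans h4

lemma ess_le (N : NA G) (Q : Sylow 47 G) : Nat.card (Ess Q) ≤ 48 := by
  classical
  let f : (Σ D : Ess Q, {x : G // x ∈ (D : Subgroup G) ∧ x ∉ Zc (Q : Subgroup G)}) →
      {x : G // x ∈ (Q : Subgroup G) ∧ x ∉ Zc (Q : Subgroup G)} :=
    fun p => ⟨p.2.1, p.1.2.2.1 p.2.2.1, p.2.2.2⟩
  have hf : Function.Injective f := by
    rintro ⟨D, x, hx⟩ ⟨D', x', hx'⟩ h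
    have h1 : x = x' := congrArg Subtype.val h
    subst h1
    have h2 : D = D' := by
      by_contra hne
      have := sq_inf N Q D.2.1 D'.2.1 D.2.2.1 D'.2.2.1 (fun h => hne (Subtype.ext h))
      apply hx.2
      rw [← this]
      exact ⟨hx.1, hx'.1⟩
    subst h2
    rfl
  haveI : Fintype (Ess Q) := Fintype.ofFinite _
  have hc1 : Nat.card (Σ D : Ess Q, {x : G // x ∈ (D : Subgroup G) ∧ x ∉ Zc (Q : Subgroup G)}) =
      Nat.card (Ess Q) * 2162 := by
    rw [Nat.card_sigma, Finset.sum_congr rfl (g := fun _ => 2162)]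
    · simp
    · intro D _
      rw [card_notMem _ _ (Zc_le_D N Q D.2.1 D.2.2.1), cZ N, D.2.1]
      norm_num
  have := Nat.card_le_card_of_injective f hf
  rw [hc1, card_notMem _ _ (Zc_le _), cZ N, cardQ N.toHyp] at this
  omega

lemma ess_two (N : NA G) (hN : ∀ Q : Sylow 47 G, Nat.card (normalizer (Q : Set G)) = 47 ^ 3 * 2116)
    (Q : Sylow 47 G) : Nat.card (Ess Q) = 2 := by
  classical
  have hmod := syl_mod Q
  rw [card_syl_2116 N.toHyp Q (hN Q)] at hmod
  let f : (Σ D : Ess Q, {Q' : Sylow 47 G // Q' ∈ SylOver (D : Subgroup G) ∧ Q' ≠ Q}) →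
      {Q' : Sylow 47 G // Q' ≠ Q ∧ 47 * Nat.card (Q ⊓ Q' : Subgroup G) = Nat.card Q} :=
    fun p => ⟨p.2.1, p.2.2.2, by
      rw [over_inf N p.1.2.1 p.1.2.2.1 p.2.2.1 p.2.2.2.symm, p.1.2.1, cardQ N.toHyp]
      norm_num⟩
  have hf : Function.Bijective f := by
    constructor
    · rintro ⟨D, Q1, h1⟩ ⟨D', Q1', h1'⟩ h
      have e1 : Q1 = Q1' := congrArg Subtype.val h
      subst e1
      have e2 : D = D' := by
        apply Subtype.ext
        rw [← over_inf N D.2.1 D.2.2.1 h1.1 h1.2.symm, ← over_inf N D'.2.1 D'.2.2.1 h1'.1 h1.2.symm]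
      subst e2
      rfl
    · rintro ⟨Q1, hne, hc⟩
      have hc2 : Nat.card (Q ⊓ Q1 : Subgroup G) = 47 ^ 2 := by
        rw [cardQ N.toHyp] at hc; omega
      exact ⟨⟨⟨(Q ⊓ Q1 : Subgroup G), hc2, inf_le_left,
        (over_eq N hc2 inf_le_left inf_le_right hne.symm).1⟩, Q1, (inf_le_right : (Q ⊓ Q1 : Subgroup G) ≤ Q1), hne⟩, rfl⟩
  haveI : Fintype (Ess Q) := Fintype.ofFinite _
  have hc1 : Nat.card (Σ D : Ess Q, {Q' : Sylow 47 G // Q' ∈ SylOver (D : Subgroup G) ∧ Q' ≠ Q}) =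
      Nat.card (Ess Q) * 47 := by
    rw [Nat.card_sigma, Finset.sum_congr rfl (g := fun _ => 47)]
    · simp
    · intro D _
      have h1 : Nat.card {Q' : Sylow 47 G // Q' ∈ SylOver (D : Subgroup G) ∧ Q' ≠ Q} =
        (SylOver (D : Subgroup G) \ {Q}).ncard := Nat.card_coe_set_eq _
      rw [h1, Set.ncard_sdiff_singleton_of_mem (show Q ∈ SylOver (D : Subgroup G) from D.2.2.1),
        ← Nat.card_coe_set_eq, D.2.2.2]
  have h2 := Nat.card_congr (Equiv.ofBijective f hf)
  rw [← h2, hc1] at hmod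
  have h3 := ess_le N Q
  unfold Nat.ModEq at hmod
  omega

end na
end OD
open scoped MatrixGroups
namespace OD
open Subgroup
open scoped Pointwise
set_option linter.style.haveILetI false
set_option linter.unusedSectionVars false
set_option linter.unusedVariables false

variable {G : Type*} [Group G] [Finite G]

lemma Zc_smul {R : Sylow 47 G} {x : G} (g : G) (hx : x ∈ Zc (R : Subgroup G)) :
    g * x * g⁻¹ ∈ Zc ((g • R : Sylow 47 G) : Subgroup G) := by
  rw [mem_Zc] at hx ⊢
  constructor
  · exact (mem_smul_iff g _ R).2 (by
      rw [show g⁻¹ * (g * x * g⁻¹) * g = x by group]; exact hx.1)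
  · intro y hy
    have h1 := hx.2 _ ((mem_smul_iff g y R).1 hy)
    calc y * (g * x * g⁻¹) = g * ((g⁻¹ * y * g) * x) * g⁻¹ := by group
      _ = _ := by rw [h1]; group

lemma conj_ne_one {g x : G} (h : x ≠ 1) : g * x * g⁻¹ ≠ 1 := by
  intro h1
  apply h
  rw [mul_inv_eq_one] at h1
  exact mul_left_cancel (a := g) (by rw [h1, mul_one])

/-- elements of the abelian group `D` inverted by `z` -/
def invSub (D : Subgroup G) (hD : Nat.card D = 47 ^ 2) (z : G) : Subgroup G where
  carrier := {v | v ∈ D ∧ z * v * z⁻¹ = v⁻¹}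
  one_mem' := ⟨one_mem _, by simp⟩
  mul_mem' := by
    rintro a b ⟨ha, ha'⟩ ⟨hb, hb'⟩
    refine ⟨mul_mem ha hb, ?_⟩
    calc z * (a * b) * z⁻¹ = (z * a * z⁻¹) * (z * b * z⁻¹) := by group
      _ = (b * a)⁻¹ := by rw [ha', hb']; group
      _ = (a * b)⁻¹ := by rw [comm_of_card_sq hD ha hb]
  inv_mem' := by
    rintro a ⟨ha, ha'⟩
    refine ⟨inv_mem ha, ?_⟩
    calc z * a⁻¹ * z⁻¹ = (z * a * z⁻¹)⁻¹ := by group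
      _ = _ := by rw [ha']

lemma eq_of_two_47 {A B D S : Subgroup G} (hD : Nat.card D = 47 ^ 2) (hS : S ≤ D)
    (hA : Nat.card A = 47) (hB : Nat.card B = 47) (hne : A ≠ B) (hAS : A ≤ S) (hBS : B ≤ S) : S = D := by
  have hF : Nat.card S ∣ 47 ^ 2 := hD ▸ card_dvd_of_le hS
  obtain ⟨i, hi, hi'⟩ := pow_card_cases hF
  apply eq_of_le_of_card_ge hS
  rw [hD, hi']
  apply Nat.pow_le_pow_right (by norm_num)
  by_contra hcon
  have h1 : Nat.card S ≤ 47 := by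
    rw [hi']
    calc 47 ^ i ≤ 47 ^ 1 := Nat.pow_le_pow_right (by norm_num) (by omega)
      _ = 47 := by norm_num
  apply hne
  rw [eq_of_le_of_card_ge hAS (by rw [hA]; exact h1), eq_of_le_of_card_ge hBS (by rw [hB]; exact h1)]

section na

lemma fixR (N : NA G) {D : Subgroup G} (hD : Nat.card D = 47 ^ 2) {j : G} (hj : j ∈ normalizer (D : Set G))
    {R : Sylow 47 G} (hR : D ≤ R) {v : G} (hv : v ∈ Zc (R : Subgroup G)) (hv1 : v ≠ 1)
    (h : j * v * j⁻¹ ∈ Zc (R : Subgroup G)) : j • R = R :=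
  over_uniq N hD (le_smul_of_norm hR hj) hR (Zc_smul j hv) h (conj_ne_one hv1)

lemma exists_fixR (N : NA G) {D : Subgroup G} (hD : Nat.card D = 47 ^ 2) (h48 : Nat.card (SylOver D) = 48)
    {j : G} (hj : j ∈ normalizer (D : Set G)) (h2 : ∀ d ∈ D, (j * j) * d = d * (j * j)) :
    ∃ R : Sylow 47 G, D ≤ R ∧ j • R = R := by
  obtain ⟨v, hv, hv1⟩ := exists_order47 (D := D) (by rw [hD]; norm_num)
  have hv1 : v ≠ 1 := by rintro rfl; rw [orderOf_one] at hv1; norm_num at hv1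
  have hjv : j * v * j⁻¹ ∈ D := (mem_normalizer_iff.1 hj v).1 hv
  have hov := (over_ncard N hD).2 h48
  by_cases hw : v * (j * v * j⁻¹) = 1
  · obtain ⟨R, hR, hvR⟩ := hov v hv hv1
    refine ⟨R, hR, fixR N hD hj hR hvR hv1 ?_⟩
    rw [← inv_eq_of_mul_eq_one_right hw]
    exact inv_mem hvR
  · obtain ⟨R, hR, hvR⟩ := hov _ (mul_mem hv hjv) hw
    refine ⟨R, hR, fixR N hD hj hR hvR hw ?_⟩
    have : j * (v * (j * v * j⁻¹)) * j⁻¹ = v * (j * v * j⁻¹) := by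
      calc j * (v * (j * v * j⁻¹)) * j⁻¹ = (j * v * j⁻¹) * ((j * j) * v * (j * j)⁻¹) := by group
        _ = (j * v * j⁻¹) * v := by rw [h2 v hv]; group
        _ = _ := comm_of_card_sq hD hjv hv
    rw [this]; exact hvR

lemma pm_of_three (N : NA G) {D : Subgroup G} (hD : Nat.card D = 47 ^ 2) {z : G} (hz : z * z = 1)
    (h3 : 2 < {R : Sylow 47 G | D ≤ R ∧ z • R = R}.ncard) :
    (∀ d ∈ D, z * d * z⁻¹ = d) ∨ (∀ d ∈ D, z * d * z⁻¹ = d⁻¹) := by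
  have key : ∀ R : Sylow 47 G, D ≤ R → z • R = R →
      Zc (R : Subgroup G) ≤ D ⊓ centralizer ({z} : Set G) ∨ Zc (R : Subgroup G) ≤ invSub D hD z := by
    intro R hR hzR
    have hZD := Zc_le_D N R hD hR
    by_cases h : ∀ v ∈ Zc (R : Subgroup G), v * (z * v * z⁻¹) = 1
    · right
      intro v hv
      exact ⟨hZD hv, (inv_eq_of_mul_eq_one_right (h v hv)).symm⟩
    · left
      push Not at h
      obtain ⟨v, hv, hw⟩ := h
      have hzv : z * v * z⁻¹ ∈ Zc (R : Subgroup G) := by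
        have := Zc_smul z hv; rwa [hzR] at this
      have hwZ := mul_mem hv hzv
      have hzw : z * (v * (z * v * z⁻¹)) * z⁻¹ = v * (z * v * z⁻¹) := by
        calc z * (v * (z * v * z⁻¹)) * z⁻¹ = (z * v * z⁻¹) * ((z * z) * v * (z * z)⁻¹) := by group
          _ = (z * v * z⁻¹) * v := by rw [hz]; group
          _ = _ := (mem_Zc.1 hv).2 _ (mem_Zc.1 hzv).1
      have hwC : v * (z * v * z⁻¹) ∈ Zc (R : Subgroup G) ⊓ centralizer ({z} : Set G) := by
        refine mem_inf.2 ⟨hwZ, mem_centralizer_singleton_iff.2 ?_⟩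
        rw [mul_inv_eq_iff_eq_mul] at hzw
        exact hzw.symm
      have hcard : Nat.card (Zc (R : Subgroup G) ⊓ centralizer ({z} : Set G) : Subgroup G) ∣ 47 :=
        (card_dvd_of_le inf_le_left).trans (cZ N R).dvd
      have hcard2 : Nat.card (Zc (R : Subgroup G) ⊓ centralizer ({z} : Set G) : Subgroup G) = 47 := by
        refine ((Nat.dvd_prime (by norm_num)).1 hcard).resolve_left ?_
        intro h1
        rw [card_eq_one] at h1
        rw [h1] at hwC
        exact hw (mem_bot.1 hwC)
      have : (Zc (R : Subgroup G) ⊓ centralizer ({z} : Set G) : Subgroup G) = Zc (R : Subgroup G) :=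
        eq_of_le_of_card_ge inf_le_left (by rw [hcard2, cZ N])
      rw [← this]
      exact inf_le_inf_right _ hZD
  obtain ⟨a, b, c, ⟨ha, ha'⟩, ⟨hb, hb'⟩, ⟨hc, hc'⟩, hab, hac, hbc⟩ := (Set.two_lt_ncard_iff (Set.toFinite _)).1 h3
  have hneZ : ∀ R R' : Sylow 47 G, D ≤ R → D ≤ R' → R ≠ R' → Zc (R : Subgroup G) ≠ Zc (R' : Subgroup G) :=
    fun R R' h h' hne he => hne (L2 N hD h h' he)
  have plus : ∀ R R' : Sylow 47 G, D ≤ R → D ≤ R' → R ≠ R' →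
      Zc (R : Subgroup G) ≤ D ⊓ centralizer ({z} : Set G) →
      Zc (R' : Subgroup G) ≤ D ⊓ centralizer ({z} : Set G) → ∀ d ∈ D, z * d * z⁻¹ = d := by
    intro R R' h h' hne h1 h2 d hd
    have := eq_of_two_47 hD inf_le_left (cZ N R) (cZ N R') (hneZ R R' h h' hne) h1 h2
    rw [← this] at hd
    have := mem_centralizer_singleton_iff.1 hd.2
    rw [mul_inv_eq_iff_eq_mul, this]
  have minus : ∀ R R' : Sylow 47 G, D ≤ R → D ≤ R' → R ≠ R' →
      Zc (R : Subgroup G) ≤ invSub D hD z →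
      Zc (R' : Subgroup G) ≤ invSub D hD z → ∀ d ∈ D, z * d * z⁻¹ = d⁻¹ := by
    intro R R' h h' hne h1 h2 d hd
    have := eq_of_two_47 hD (show invSub D hD z ≤ D from fun x hx => hx.1) (cZ N R) (cZ N R') (hneZ R R' h h' hne) h1 h2
    rw [← this] at hd
    exact hd.2
  rcases key a ha ha' with h1 | h1 <;> rcases key b hb hb' with h2 | h2
  · exact Or.inl (plus a b ha hb hab h1 h2)
  · rcases key c hc hc' with h3 | h3
    · exact Or.inl (plus a c ha hc hac h1 h3)
    · exact Or.inr (minus b c hb hc hbc h2 h3)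
  · rcases key c hc hc' with h3 | h3
    · exact Or.inl (plus b c hb hc hbc h2 h3)
    · exact Or.inr (minus a c ha hc hac h1 h3)
  · exact Or.inr (minus a b ha hb hab h1 h2)

end na
end OD
open scoped MatrixGroups
namespace OD
open Subgroup
open scoped Pointwise
set_option linter.style.haveILetI false
set_option linter.unusedSectionVars false
set_option linter.unusedVariables false

variable {G : Type*} [Group G]

/-- conjugate subgroup `g D g⁻¹` -/
def cj (g : G) (D : Subgroup G) : Subgroup G := MulAut.conj g • D

lemma mem_cj {g x : G} {D : Subgroup G} : x ∈ cj g D ↔ g⁻¹ * x * g ∈ D := by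
  rw [cj, Subgroup.mem_pointwise_smul_iff_inv_smul_mem, ← map_inv]
  simp [MulAut.smul_def]

lemma mem_cj' {g x : G} {D : Subgroup G} : g * x * g⁻¹ ∈ cj g D ↔ x ∈ D := by
  rw [mem_cj, show g⁻¹ * (g * x * g⁻¹) * g = x by group]

lemma cj_one (D : Subgroup G) : cj 1 D = D := by ext x; rw [mem_cj]; simp

lemma cj_mul (g h : G) (D : Subgroup G) : cj (g * h) D = cj g (cj h D) := by
  rw [cj, map_mul, mul_smul]; rfl

lemma cj_inj {g : G} {D E : Subgroup G} (h : cj g D = cj g E) : D = E := by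
  have := congrArg (cj g⁻¹) h
  rwa [← cj_mul, ← cj_mul, inv_mul_cancel, cj_one, cj_one] at this

lemma cj_eq_iff {g : G} {D : Subgroup G} : cj g D = D ↔ g ∈ normalizer (D : Set G) := by
  constructor
  · intro h
    rw [mem_normalizer_iff]
    intro x
    rw [← mem_cj' (g := g), h]
  · intro h
    ext x
    rw [mem_cj, mem_normalizer_iff.1 h, show g * (g⁻¹ * x * g) * g⁻¹ = x by group]

lemma card_cj (g : G) (D : Subgroup G) : Nat.card (cj g D) = Nat.card D :=
  (Nat.card_congr (Subgroup.equivSMul (MulAut.conj g) D).toEquiv).symm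

lemma cj_sylow (g : G) (Q : Sylow 47 G) : ((g • Q : Sylow 47 G) : Subgroup G) = cj g (Q : Subgroup G) := rfl

lemma cj_mono {g : G} {D E : Subgroup G} : cj g D ≤ cj g E ↔ D ≤ E := by
  constructor
  · intro h x hx
    exact mem_cj'.1 (h (mem_cj' (g := g).2 hx))
  · intro h x hx
    exact mem_cj.2 (h (mem_cj.1 hx))

lemma cj_inf {g : G} {D E : Subgroup G} : cj g (D ⊓ E) = cj g D ⊓ cj g E := by
  ext x; rw [mem_inf, mem_cj, mem_cj, mem_cj, mem_inf]

lemma mem_norm_cj {g x : G} {D : Subgroup G} :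
    x ∈ normalizer (cj g D : Set G) ↔ g⁻¹ * x * g ∈ normalizer (D : Set G) := by
  rw [← cj_eq_iff, ← cj_eq_iff, ← cj_mul]
  constructor
  · intro h
    apply cj_inj (g := g)
    rw [← cj_mul, show g * (g⁻¹ * x * g) = x * g by group, h]
  · intro h
    rw [show x * g = g * (g⁻¹ * x * g) by group, cj_mul, h]

lemma card_SylOver_cj [Finite G] (g : G) (D : Subgroup G) :
    Nat.card (SylOver (cj g D)) = Nat.card (SylOver D) := by
  refine (Nat.card_congr (Equiv.ofBijective (fun R : SylOver D => (⟨g • (R : Sylow 47 G), ?_⟩ : SylOver (cj g D))) ⟨?_, ?_⟩)).symm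
  · exact cj_mono.2 R.2
  · intro R R' h
    exact Subtype.ext (MulAction.injective g (congrArg Subtype.val h))
  · intro R
    refine ⟨⟨g⁻¹ • (R : Sylow 47 G), ?_⟩, Subtype.ext (smul_inv_smul g (R : Sylow 47 G))⟩
    have h1 : cj g D ≤ (R : Sylow 47 G) := R.2
    have := (cj_mono (g := g⁻¹)).2 h1
    rwa [← cj_mul, inv_mul_cancel, cj_one] at this

variable [Finite G]

lemma Ess_cj {g : G} {Q : Sylow 47 G} {D : Subgroup G} (h : D ∈ Ess Q) : cj g D ∈ Ess (g • Q) :=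
  ⟨by rw [card_cj, h.1], cj_mono.2 h.2.1, by rw [card_SylOver_cj, h.2.2]⟩

lemma Ess_norm {g : G} {Q : Sylow 47 G} (hg : g ∈ normalizer (Q : Set G)) {D : Subgroup G} (h : D ∈ Ess Q) :
    cj g D ∈ Ess Q := by
  have := Ess_cj (g := g) h
  rwa [Sylow.smul_eq_iff_mem_normalizer.2 hg] at this

lemma cj_Zc (g : G) (Q : Sylow 47 G) :
    cj g (Zc (Q : Subgroup G)) = Zc ((g • Q : Sylow 47 G) : Subgroup G) := by
  ext x
  rw [mem_cj]
  constructor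
  · intro h
    have := Zc_smul g h
    rwa [show g * (g⁻¹ * x * g) * g⁻¹ = x by group] at this
  · intro h
    have := Zc_smul g⁻¹ h
    rwa [inv_smul_smul, inv_inv] at this

lemma conj_involutions {B : Type*} [Group B] [Finite B] {m : ℕ} (hB : Nat.card B = 2 * m)
    (hm : ¬ 2 ∣ m) {z z' : B} (hz : orderOf z = 2) (hz' : orderOf z' = 2) : ∃ b : B, b * z * b⁻¹ = z' := by
  have hf : (Nat.card B).factorization 2 = 1 :=
    factorization_eq (m := m) (by norm_num) (by rw [hB, pow_one]) hm
  let S : Sylow 2 B := Sylow.ofCard (zpowers z) (by rw [Nat.card_zpowers, hz, hf, pow_one])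
  let S' : Sylow 2 B := Sylow.ofCard (zpowers z') (by rw [Nat.card_zpowers, hz', hf, pow_one])
  obtain ⟨b, hb⟩ := MulAction.exists_smul_eq B S S'
  have h1 : b * z * b⁻¹ ∈ S' := by
    rw [← hb, mem_smul_iff, show b⁻¹ * (b * z * b⁻¹) * b = z by group]
    exact mem_zpowers z
  obtain ⟨n, hn⟩ := (show b * z * b⁻¹ ∈ zpowers z' from h1)
  have hne : b * z * b⁻¹ ≠ 1 := by
    apply conj_ne_one; rintro rfl; rw [orderOf_one] at hz; norm_num at hz
  refine ⟨b, ?_⟩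
  rw [← hn]
  rw [← hn] at hne
  have hsq : z' ^ (2 : ℤ) = 1 := by
    have := pow_orderOf_eq_one z'; rw [hz'] at this; exact_mod_cast this
  rcases Int.even_or_odd' n with ⟨k, rfl | rfl⟩
  · exact absurd (by simp [zpow_mul, hsq]) hne
  · simp [zpow_add, zpow_mul, hsq]

section na

lemma comm_contra (N : NA G) (Q : Sylow 47 G) {D E : Subgroup G} (hD : D ∈ Ess Q) (hE : E ∈ Ess Q) (hne : D ≠ E)
    (h : ∀ x ∈ D, ∀ y ∈ E, x * y = y * x) : False := by
  obtain ⟨x, hx, hxZ⟩ : ∃ x ∈ D, x ∉ Zc (Q : Subgroup G) := by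
    by_contra hcon
    push Not at hcon
    have h9 := Nat.le_of_dvd Nat.card_pos (card_dvd_of_le (show D ≤ Zc (Q : Subgroup G) from hcon))
    rw [hD.1, cZ N] at h9
    norm_num at h9
  have h1 := card_EC N Q (hD.2.1 hx) hxZ
  have h2 : D = (Q : Subgroup G) ⊓ centralizer ({x} : Set G) := by
    refine eq_of_le_of_card_ge (fun d hd => mem_inf.2 ⟨hD.2.1 hd, ?_⟩) (by rw [hD.1, h1])
    exact mem_centralizer_singleton_iff.2 (comm_of_card_sq hD.1 hd hx)
  have h3 : E = (Q : Subgroup G) ⊓ centralizer ({x} : Set G) := by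
    refine eq_of_le_of_card_ge (fun d hd => mem_inf.2 ⟨hE.2.1 hd, ?_⟩) (by rw [hE.1, h1])
    exact mem_centralizer_singleton_iff.2 (h x hx d hd).symm
  exact hne (h2.trans h3.symm)

lemma invert_both_contra (N : NA G) (Q : Sylow 47 G) {D E : Subgroup G} (hD : D ∈ Ess Q) (hE : E ∈ Ess Q) (hne : D ≠ E)
    {z : G} (h1 : ∀ d ∈ D, z * d * z⁻¹ = d⁻¹) (h2 : ∀ d ∈ E, z * d * z⁻¹ = d⁻¹) : False := by
  apply comm_contra N Q hD hE hne
  intro x hx y hy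
  have hc := comm_mem_Zc N Q (hD.2.1 hx) (hE.2.1 hy)
  set c := x * y * x⁻¹ * y⁻¹ with hcdef
  have hcD : c ∈ D := Zc_le_D N Q hD.1 hD.2.1 hc
  have e1 : z * c * z⁻¹ = x⁻¹ * y⁻¹ * x * y := by
    calc z * c * z⁻¹ = (z * x * z⁻¹) * (z * y * z⁻¹) * (z * x * z⁻¹)⁻¹ * (z * y * z⁻¹)⁻¹ := by
          rw [hcdef]; group
      _ = _ := by rw [h1 x hx, h2 y hy, inv_inv, inv_inv]
  have hcx := (mem_Zc.1 hc).2 (y * x) (mul_mem (hE.2.1 hy) (hD.2.1 hx))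
  have e2 : x * y = (y * x) * c := by rw [hcx, hcdef]; group
  have e3 : x⁻¹ * y⁻¹ * x * y = c := by
    calc x⁻¹ * y⁻¹ * x * y = (y * x)⁻¹ * (x * y) := by group
      _ = c := by rw [e2]; group
  have e4 : c * c = 1 := by
    have := h1 c hcD
    rw [e1, e3] at this
    nth_rw 2 [this]
    exact mul_inv_cancel c
  have e5 : c ^ (47 ^ 2) = 1 := by
    have := pow_card_eq_one' (x := (⟨c, hcD⟩ : D))
    rw [hD.1] at this
    exact congrArg Subtype.val this
  have e6 : c = 1 := by
    have : c ^ (47 ^ 2) = (c * c) ^ 1104 * c := by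
      rw [← pow_two, ← pow_mul, ← pow_succ]; norm_num
    rw [e5, e4, one_pow, one_mul] at this
    exact this.symm
  rw [e2, e6, mul_one]

end na
end OD
open scoped MatrixGroups
namespace OD
open Subgroup
open scoped Pointwise
set_option linter.style.haveILetI false
set_option linter.unusedSectionVars false
set_option linter.unusedVariables false

variable {G : Type*} [Group G] [Finite G]

section na

lemma no_swap (N : NA G) (hN : ∀ Q : Sylow 47 G, Nat.card (normalizer (Q : Set G)) = 47 ^ 3 * 2116)
    (Q : Sylow 47 G) {D E : Subgroup G} (hD : D ∈ Ess Q) (hE : E ∈ Ess Q) (hne : D ≠ E)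
    (hDE : ∀ F ∈ Ess Q, F = D ∨ F = E) : normalizer (Q : Set G) ≤ normalizer (D : Set G) := by
  by_contra hcon
  obtain ⟨g, hgQ, hgD⟩ := SetLike.not_le_iff_exists.1 hcon
  have hstay : ∀ b ∈ normalizer (Q : Set G), cj b D = D ∨ cj b D = E := fun b hb =>
    hDE _ (Ess_norm hb hD)
  have hgDE : cj g D = E := (hstay g hgQ).resolve_left fun h => hgD (cj_eq_iff.1 h)
  have hother : ∀ b ∈ normalizer (Q : Set G), (cj b D = D ↔ cj b E = E) := by
    intro b hb
    have hbE := hDE _ (Ess_norm hb hE)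
    constructor
    · intro h
      refine hbE.resolve_left fun h' => hne ?_
      exact cj_inj (g := b) (h.trans h'.symm)
    · intro h
      refine (hstay b hb).resolve_right fun h' => hne ?_
      exact cj_inj (g := b) (h'.trans h.symm)
  -- index two
  have hidx : ((normalizer (D : Set G)).subgroupOf (normalizer (Q : Set G))).index = 2 := by
    rw [index_eq_two_iff]
    refine ⟨⟨g, hgQ⟩, fun b => ?_⟩
    have e1 : b * ⟨g, hgQ⟩ ∈ (normalizer (D : Set G)).subgroupOf (normalizer (Q : Set G)) ↔ ¬ cj (b : G) D = D := by
      rw [mem_subgroupOf, ← cj_eq_iff]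
      show cj ((b : G) * g) D = D ↔ _
      rw [cj_mul, hgDE, hother b b.2]
      rcases hDE _ (Ess_norm b.2 hE) with h | h
      · rw [h]; exact ⟨fun _ h' => hne h', fun _ => rfl⟩
      · rw [h]; exact ⟨fun h' => absurd h'.symm hne, fun h' => absurd rfl h'⟩
    have e2 : b ∈ (normalizer (D : Set G)).subgroupOf (normalizer (Q : Set G)) ↔ cj (b : G) D = D := by
      rw [mem_subgroupOf, ← cj_eq_iff]
    rw [e1, e2]
    by_cases h : cj (b : G) D = D
    · exact Or.inr ⟨h, fun h' => h' h⟩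
    · exact Or.inl ⟨h, h⟩
  have hB : Nat.card (normalizer (D : Set G) ⊓ normalizer (Q : Set G) : Subgroup G) = 47 ^ 3 * 1058 := by
    have h1 := index_mul_card ((normalizer (D : Set G)).subgroupOf (normalizer (Q : Set G)))
    rw [hidx, hN, ← inf_subgroupOf_right, Nat.card_congr (subgroupOfEquivOfLe inf_le_right).toEquiv] at h1
    omega
  have hA := card_norm_D N hD.1 Q hD.2.1
  rw [hD.2.2, hB] at hA
  have hBR : ∀ R : Sylow 47 G, D ≤ R →
      Nat.card (normalizer (D : Set G) ⊓ normalizer (R : Set G) : Subgroup G) = 47 ^ 3 * 1058 := by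
    intro R hR
    have := card_norm_D N hD.1 R hR
    rw [hD.2.2, hA] at this
    omega
  -- 2-subgroups fixing a Sylow
  have hsmall : ∀ (T : Subgroup G) (R : Sylow 47 G), IsPGroup 2 T → D ≤ R → T ≤ normalizer (D : Set G) →
      T ≤ normalizer (R : Set G) → Nat.card T ≤ 2 := by
    intro T R hT hR h1 h2
    obtain ⟨k, hk⟩ := IsPGroup.iff_card.1 hT
    have h3 := card_dvd_of_le (le_inf h1 h2)
    rw [hBR R hR, hk] at h3
    rw [hk]
    by_contra hcon
    have hk2 : 2 ≤ k := by
      by_contra hk2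
      have : k ≤ 1 := by omega
      have := Nat.pow_le_pow_right (show 1 ≤ 2 by norm_num) this
      omega
    have := (pow_dvd_pow 2 hk2).trans h3
    revert this; norm_num
  set A := normalizer (D : Set G) with hAdef
  -- Sylow 2-subgroup
  have T₀ : Sylow 2 A := default
  obtain ⟨hT₀, -⟩ := card_sylow_eq (a := 5) (m := 47 ^ 3 * 3 * 23 ^ 2) T₀ (by rw [hA]; norm_num) (by norm_num)
  set T : Subgroup G := (T₀ : Subgroup A).map A.subtype with hTdef
  have hT : Nat.card T = 32 := by
    rw [← Nat.card_congr ((T₀ : Subgroup A).equivMapOfInjective _ A.subtype_injective).toEquiv, hT₀]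
    norm_num
  have hTA : T ≤ A := map_subtype_le _
  have hTp : IsPGroup 2 T := IsPGroup.of_card (n := 5) (by rw [hT]; norm_num)
  obtain ⟨z, hzT, hz2⟩ : ∃ z ∈ Zc T, orderOf z = 2 := by
    haveI : Nontrivial T := by rw [← Finite.one_lt_card_iff_nontrivial, hT]; norm_num
    have h1 := hTp.center_nontrivial
    have h2 : 2 ∣ Nat.card (Zc T) := by
      have h3 : IsPGroup 2 (Zc T) := hTp.to_le (Zc_le T)
      obtain ⟨k, hk⟩ := IsPGroup.iff_card.1 h3
      rw [← Finite.one_lt_card_iff_nontrivial, ← card_Zc, hk] at h1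
      rw [hk]
      apply dvd_pow_self
      rintro rfl
      norm_num at h1
    obtain ⟨z, hz⟩ := exists_prime_orderOf_dvd_card' 2 h2
    exact ⟨z, z.2, (Subgroup.orderOf_coe z).trans hz⟩
  have hzz : z * z = 1 := by
    rw [← pow_two, ← hz2]; exact pow_orderOf_eq_one z
  have hz1 : z ≠ 1 := by rintro rfl; rw [orderOf_one] at hz2; norm_num at hz2
  have hzA : z ∈ A := hTA (Zc_le _ hzT)
  obtain ⟨R, hR, hzR⟩ := exists_fixR N hD.1 hD.2.2 hzA (fun d _ => by rw [hzz]; simp)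
  have h3 : 2 < {R : Sylow 47 G | D ≤ R ∧ z • R = R}.ncard := by
    have h4 := card_orbit_mul (S := T) R
    have h5 : Nat.card (MulAction.stabilizer T R) ≤ 2 := by
      rw [Nat.card_congr ((MulAction.stabilizer T R).equivMapOfInjective _ T.subtype_injective).toEquiv]
      refine hsmall _ R (hTp.to_le (map_subtype_le _)) hR ((map_subtype_le _).trans hTA) ?_
      rintro _ ⟨t, ht, rfl⟩
      exact Sylow.smul_eq_iff_mem_normalizer.1 ht
    have h6 : MulAction.orbit T R ⊆ {R : Sylow 47 G | D ≤ R ∧ z • R = R} := by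
      rintro _ ⟨t, rfl⟩
      refine ⟨le_smul_of_norm hR (hTA t.2), ?_⟩
      show z • (t : G) • R = (t : G) • R
      rw [← mul_smul, ← (mem_Zc.1 hzT).2 t t.2, mul_smul, hzR]
    have h7 := Set.ncard_le_ncard h6 (Set.toFinite _)
    rw [← Nat.card_coe_set_eq] at h7
    rw [hT] at h4
    have : Nat.card (MulAction.orbit T R) * Nat.card (MulAction.stabilizer T R) ≤
      Nat.card (MulAction.orbit T R) * 2 := Nat.mul_le_mul_left _ h5
    omega
  have zfix : (∀ d ∈ D, z * d * z⁻¹ = d) ∨ (∀ d ∈ D, z * d * z⁻¹ = d⁻¹) → ∀ R : Sylow 47 G, D ≤ R →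
      z ∈ normalizer (R : Set G) := by
    intro h R hR
    obtain ⟨v, hv, hv1⟩ := exists_order47 (D := Zc (R : Subgroup G)) (by rw [cZ N])
    have hv1 : v ≠ 1 := by rintro rfl; rw [orderOf_one] at hv1; norm_num at hv1
    apply Sylow.smul_eq_iff_mem_normalizer.1
    have hvD := Zc_le_D N R hD.1 hR hv
    refine fixR N hD.1 hzA hR hv hv1 ?_
    rcases h with h | h
    · rw [h v hvD]; exact hv
    · rw [h v hvD]; exact inv_mem hv
  have hpm := pm_of_three N hD.1 hzz h3
  have zfix := zfix hpm
  rcases hpm with hp | hm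
  · -- z centralizes D
    obtain ⟨K, hK, hzK⟩ := Sylow.exists_subgroup_card_pow_succ (G := A) (p := 2) (n := 1)
      (by rw [hA]; norm_num) (H := zpowers (⟨z, hzA⟩ : A)) (by
        rw [Nat.card_zpowers, ← Subgroup.orderOf_coe, pow_one]; exact hz2)
    have hzK' : (⟨z, hzA⟩ : A) ∈ K := hzK (mem_zpowers _)
    have hZ2 : Nat.card (zpowers (⟨z, hzA⟩ : A)) = 2 := by
      rw [Nat.card_zpowers, ← Subgroup.orderOf_coe]; exact hz2
    obtain ⟨j, hjK, hjz⟩ : ∃ j ∈ K, j ∉ zpowers (⟨z, hzA⟩ : A) := by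
      by_contra hc
      push Not at hc
      have := Nat.le_of_dvd Nat.card_pos (card_dvd_of_le (show K ≤ zpowers (⟨z, hzA⟩ : A) from hc))
      rw [hK, hZ2] at this
      norm_num at this
    have hj2 : j * j ∈ zpowers (⟨z, hzA⟩ : A) := by
      have hi : ((zpowers (⟨z, hzA⟩ : A)).subgroupOf K).index = 2 := by
        have h1 := index_mul_card ((zpowers (⟨z, hzA⟩ : A)).subgroupOf K)
        rw [Nat.card_congr (subgroupOfEquivOfLe hzK).toEquiv, hZ2, hK] at h1
        omega
      have := sq_mem_of_index_two hi ⟨j, hjK⟩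
      rw [pow_two] at this
      exact this
    have hcz : ∀ w ∈ zpowers (⟨z, hzA⟩ : A), ∀ d ∈ D, (w : G) * d = d * w := by
      rintro _ ⟨n, rfl⟩ d hd
      have : Commute z d := by
        have := hp d hd
        rw [mul_inv_eq_iff_eq_mul] at this
        exact this
      simpa using (this.zpow_left n).eq
    obtain ⟨R, hR, hjR⟩ := exists_fixR N hD.1 hD.2.2 j.2 (fun d hd => hcz _ hj2 d hd)
    have hjR' := Sylow.smul_eq_iff_mem_normalizer.1 hjR
    have hKp : IsPGroup 2 (K.map A.subtype) := (IsPGroup.of_card hK).map _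
    have h1 := hsmall (K.map A.subtype ⊓ normalizer (R : Set G)) R (hKp.to_le inf_le_left) hR
      (inf_le_left.trans (map_subtype_le _)) inf_le_right
    have hsub : ({1, z, (j : G)} : Set G) ⊆ (K.map A.subtype ⊓ normalizer (R : Set G) : Subgroup G) := by
      rintro x (rfl | rfl | rfl)
      · exact one_mem _
      · exact mem_inf.2 ⟨⟨_, hzK', rfl⟩, zfix R hR⟩
      · exact mem_inf.2 ⟨⟨_, hjK, rfl⟩, hjR'⟩
    have h2 := Set.ncard_le_ncard hsub (Set.toFinite _)
    have h3 : ({1, z, (j : G)} : Set G).ncard = 3 := by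
      rw [Set.ncard_eq_three]
      refine ⟨1, z, j, hz1.symm, ?_, ?_, rfl⟩
      · intro h; apply hjz; rw [show j = 1 from Subtype.ext h.symm]; exact one_mem _
      · intro h; apply hjz; rw [show j = ⟨z, hzA⟩ from Subtype.ext h.symm]; exact mem_zpowers _
    rw [h3, ← Nat.card_coe_set_eq] at h2
    have h4 : Nat.card (K.map A.subtype ⊓ normalizer (R : Set G) : Subgroup G) < 3 := by omega
    exact absurd h2 (not_le.2 h4)
  · -- z inverts D
    have hzQ := zfix Q hD.2.1
    set z' := g * z * g⁻¹ with hz'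
    have hz'Q : z' ∈ normalizer (Q : Set G) := mul_mem (mul_mem hgQ hzQ) (inv_mem hgQ)
    have hz'E : ∀ d ∈ E, z' * d * z'⁻¹ = d⁻¹ := by
      intro d hd
      rw [← hgDE] at hd
      have := hm _ (mem_cj.1 hd)
      calc z' * d * z'⁻¹ = g * (z * (g⁻¹ * d * g) * z⁻¹) * g⁻¹ := by rw [hz']; group
        _ = d⁻¹ := by rw [this]; group
    have hz'A : z' ∈ A := by
      rw [hAdef, ← cj_eq_iff, hother z' hz'Q, cj_eq_iff, ← hgDE, mem_norm_cj, hz']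
      rw [show g⁻¹ * (g * z * g⁻¹) * g = z by group]
      exact hzA
    have hz'2 : orderOf z' = 2 := by
      rw [orderOf_eq_prime_iff]
      constructor
      · rw [pow_two, hz']
        calc g * z * g⁻¹ * (g * z * g⁻¹) = g * (z * z) * g⁻¹ := by group
          _ = 1 := by rw [hzz]; group
      · exact conj_ne_one hz1
    obtain ⟨b, hb⟩ := conj_involutions (B := (A ⊓ normalizer (Q : Set G) : Subgroup G)) (m := 47 ^ 3 * 529)
      (by rw [hB]; norm_num) (by norm_num) (z := ⟨z, mem_inf.2 ⟨hzA, hzQ⟩⟩) (z' := ⟨z', mem_inf.2 ⟨hz'A, hz'Q⟩⟩)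
      (by rw [← Subgroup.orderOf_coe]; exact hz2) (by rw [← Subgroup.orderOf_coe]; exact hz'2)
    have hb' : (b : G) * z * (b : G)⁻¹ = z' := congrArg Subtype.val hb
    have hbA : (b : G) ∈ A := (mem_inf.1 b.2).1
    refine invert_both_contra N Q hD hE hne (z := z') ?_ hz'E
    intro d hd
    have hd' : (b : G)⁻¹ * d * b ∈ D := by
      rw [← cj_eq_iff.2 hbA] at hd
      exact mem_cj.1 hd
    have := hm _ hd'
    calc z' * d * z'⁻¹ = b * (z * ((b : G)⁻¹ * d * b) * z⁻¹) * (b : G)⁻¹ := by rw [← hb']; group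
      _ = d⁻¹ := by rw [this]; group

end na
end OD
open scoped MatrixGroups
namespace OD
set_option linter.unusedVariables false
set_option linter.unusedSimpArgs false
set_option linter.style.haveILetI false

/-- the field with 47 elements -/
abbrev F47 := ZMod 47
/-- coordinate vectors -/
abbrev V3 := Fin 3 → F47

/-- the determinant of three vectors -/
def dt (u v w : V3) : F47 :=
  u 0 * (v 1 * w 2 - v 2 * w 1) - u 1 * (v 0 * w 2 - v 2 * w 0) + u 2 * (v 0 * w 1 - v 1 * w 0)

/-- a collineation on nonzero vectors -/
structure Coll (τ : V3 → V3) : Prop where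
  ne : ∀ v, v ≠ 0 → τ v ≠ 0
  iff : ∀ u v w, u ≠ 0 → v ≠ 0 → w ≠ 0 → (dt u v w = 0 ↔ dt (τ u) (τ v) (τ w) = 0)

lemma ne0 {v : V3} : v ≠ 0 ↔ v 0 ≠ 0 ∨ v 1 ≠ 0 ∨ v 2 ≠ 0 := by
  rw [Ne, funext_iff, Fin.forall_fin_succ, Fin.forall_fin_succ, Fin.forall_fin_one]
  simp only [Pi.zero_apply]
  change ¬ (v 0 = 0 ∧ v 1 = 0 ∧ v 2 = 0) ↔ _
  tauto

lemma v3ext {u v : V3} (h0 : u 0 = v 0) (h1 : u 1 = v 1) (h2 : u 2 = v 2) : u = v := by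
  ext i; fin_cases i <;> assumption

lemma rigid {τ : V3 → V3} (hc : Coll τ) {a b c d : F47}
    (ha : τ ![1,0,0] = ![a,0,0]) (hb : τ ![0,1,0] = ![0,b,0]) (hcc : τ ![0,0,1] = ![0,0,c])
    (hd : τ ![1,1,1] = ![d,d,d]) : ∀ v : V3, v ≠ 0 → ∃ k : F47, k ≠ 0 ∧ τ v = k • v := by
  have n1 : (![1,0,0] : V3) ≠ 0 := ne0.2 (by simp)
  have n2 : (![0,1,0] : V3) ≠ 0 := ne0.2 (by simp)
  have n3 : (![0,0,1] : V3) ≠ 0 := ne0.2 (by simp)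
  have n4 : (![1,1,1] : V3) ≠ 0 := ne0.2 (by simp)
  have a0 : a ≠ 0 := by have := hc.ne _ n1; rw [ha] at this; simpa [ne0] using this
  have b0 : b ≠ 0 := by have := hc.ne _ n2; rw [hb] at this; simpa [ne0] using this
  have c0 : c ≠ 0 := by have := hc.ne _ n3; rw [hcc] at this; simpa [ne0] using this
  have d0 : d ≠ 0 := by have := hc.ne _ n4; rw [hd] at this; simpa [ne0] using this
  -- coordinates which vanish
  have z0 : ∀ v : V3, v ≠ 0 → (v 0 = 0 ↔ τ v 0 = 0) := by
    intro v hv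
    have := hc.iff _ _ _ n2 n3 hv
    rw [hb, hcc] at this
    simpa [dt, b0, c0] using this
  have z1 : ∀ v : V3, v ≠ 0 → (v 1 = 0 ↔ τ v 1 = 0) := by
    intro v hv
    have := hc.iff _ _ _ n1 n3 hv
    rw [ha, hcc] at this
    simpa [dt, a0, c0] using this
  have z2 : ∀ v : V3, v ≠ 0 → (v 2 = 0 ↔ τ v 2 = 0) := by
    intro v hv
    have := hc.iff _ _ _ n1 n2 hv
    rw [ha, hb] at this
    simpa [dt, a0, b0] using this
  -- equal coordinates
  have e01 : ∀ v : V3, v ≠ 0 → (v 0 = v 1 ↔ τ v 0 = τ v 1) := by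
    intro v hv
    have := hc.iff _ _ _ n3 n4 hv
    rw [hcc, hd] at this
    simp only [dt, Matrix.cons_val] at this
    have h1 : ∀ x y : F47, x = y ↔ y - x = 0 := fun x y => by rw [sub_eq_zero, eq_comm]
    rw [h1, h1 (τ v 0)]
    have h2 : c * (d * (τ v 1 - τ v 0)) = 0 ↔ τ v 1 - τ v 0 = 0 := by simp [c0, d0]
    rw [← h2]
    convert this using 2 <;> ring
  have na : ∀ x y : F47, (![x,y,1] : V3) ≠ 0 := fun x y => ne0.2 (by simp)
  have z2' : ∀ x y : F47, τ ![x,y,1] 2 ≠ 0 := fun x y h => by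
    have := (z2 _ (na x y)).2 h
    simp at this
  -- f and g
  set f : F47 → F47 := fun x => τ ![x,0,1] 0 / τ ![x,0,1] 2 with hf
  set g : F47 → F47 := fun y => τ ![0,y,1] 1 / τ ![0,y,1] 2 with hg
  have hx : ∀ x y, τ ![x,y,1] 0 / τ ![x,y,1] 2 = f x := by
    intro x y
    have := (hc.iff _ _ _ n2 (na x 0) (na x y)).1 (by simp [dt])
    rw [hb] at this
    simp only [dt, Matrix.cons_val] at this
    have h3 : b * (τ ![x,0,1] 0 * τ ![x,y,1] 2 - τ ![x,0,1] 2 * τ ![x,y,1] 0) = 0 := by linear_combination -this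
    rw [mul_eq_zero, or_iff_right b0] at h3
    rw [hf]
    simp only
    rw [div_eq_div_iff (z2' _ _) (z2' _ _)]
    linear_combination -h3
  have hy : ∀ x y, τ ![x,y,1] 1 / τ ![x,y,1] 2 = g y := by
    intro x y
    have := (hc.iff _ _ _ n1 (na 0 y) (na x y)).1 (by simp [dt])
    rw [ha] at this
    simp only [dt, Matrix.cons_val] at this
    have h3 : a * (τ ![0,y,1] 1 * τ ![x,y,1] 2 - τ ![0,y,1] 2 * τ ![x,y,1] 1) = 0 := by linear_combination this
    rw [mul_eq_zero, or_iff_right a0] at h3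
    rw [hg]
    simp only
    rw [div_eq_div_iff (z2' _ _) (z2' _ _)]
    linear_combination -h3
  have hfg : ∀ x, f x = g x := by
    intro x
    rw [← hx x x, ← hy x x]
    rw [(e01 _ (na x x)).1 (by simp)]
  have hf1 : f 1 = 1 := by rw [← hx 1 1, hd]; simp [d0]
  -- the point (1,1,0)
  have n5 : (![1,1,0] : V3) ≠ 0 := ne0.2 (by simp)
  have i2 : τ ![1,1,0] 2 = 0 := (z2 _ n5).1 (by simp)
  have i1 : τ ![1,1,0] 0 = τ ![1,1,0] 1 := (e01 _ n5).1 (by simp)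
  have i0 : τ ![1,1,0] 1 ≠ 0 := fun h => by
    have := (z1 _ n5).2 h; simp at this
  have hadd : ∀ x y, f (x + y) = f x + f y := by
    intro x y
    have := (hc.iff _ _ _ n5 (na 0 y) (na x (x + y))).1 (by simp [dt])
    simp only [dt] at this
    rw [i2, i1] at this
    have h0 : τ ![0,y,1] 0 = 0 := (z0 _ (na 0 y)).1 (by simp)
    rw [h0] at this
    have h3 : τ ![0,y,1] 1 * τ ![x,x+y,1] 2 - τ ![0,y,1] 2 * τ ![x,x+y,1] 1 + τ ![0,y,1] 2 * τ ![x,x+y,1] 0 = 0 := by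
      apply mul_left_cancel₀ i0
      linear_combination this
    rw [hfg (x + y), ← hy x (x + y), ← hx x (x + y), hfg y, ← hy 0 y]
    have := z2' x (x + y)
    have := z2' 0 y
    field_simp
    linear_combination -h3
  have hid : ∀ x, f x = x := by
    intro x
    let φ : F47 →+ F47 := AddMonoidHom.mk' f hadd
    have h1 : ∀ n : ℕ, f n = n := by
      intro n
      have : φ (n • 1) = n • φ 1 := map_nsmul φ n 1
      simpa [φ, hf1] using this
    have := h1 x.val
    rwa [ZMod.natCast_zmod_val] at this
  have haff : ∀ x y, τ ![x,y,1] = τ ![x,y,1] 2 • ![x,y,1] := by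
    intro x y
    have h1 := hx x y
    have h2 := hy x y
    rw [hid] at h1
    rw [← hfg, hid] at h2
    rw [div_eq_iff (z2' x y)] at h1 h2
    apply v3ext
    · rw [h1]; simp [mul_comm]
    · rw [h2]; simp [mul_comm]
    · simp
  intro v hv
  have hτ := hc.ne v hv
  have key : ∃ k : F47, τ v = k • v := by
    by_cases h2 : v 2 = 0
    · have h3 := (z2 v hv).1 h2
      have := (hc.iff _ _ _ n3 (na (v 0) (v 1)) hv).1 (by simp [dt, mul_comm])
      rw [hcc, haff] at this
      have z2'' := z2' (v 0) (v 1)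
      have h4 : v 0 * τ v 1 - v 1 * τ v 0 = 0 := by
        apply mul_left_cancel₀ z2''
        apply mul_left_cancel₀ c0
        simp only [dt, Matrix.cons_val, Pi.smul_apply, smul_eq_mul] at this
        linear_combination this
      rcases ne0.1 hv with h | h | h
      · refine ⟨τ v 0 / v 0, v3ext ?_ ?_ ?_⟩
        · simp [h]
        · simp; field_simp; linear_combination h4
        · simp [h2, h3]
      · refine ⟨τ v 1 / v 1, v3ext ?_ ?_ ?_⟩
        · simp; field_simp; linear_combination -h4
        · simp [h]
        · simp [h2, h3]
      · exact absurd h2 h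
    · have k2 := mt (z2 v hv).2 h2
      -- v is proportional to an affine vector
      have h5 := haff (v 0 / v 2) (v 1 / v 2)
      have p1 := (hc.iff _ _ _ n1 (na (v 0 / v 2) (v 1 / v 2)) hv).1 (by simp [dt]; field_simp; simp)
      have p2 := (hc.iff _ _ _ n2 (na (v 0 / v 2) (v 1 / v 2)) hv).1 (by simp [dt]; field_simp; simp)
      have z2'' := z2' (v 0 / v 2) (v 1 / v 2)
      rw [h5] at p1 p2
      rw [ha] at p1
      rw [hb] at p2
      simp only [dt, Matrix.cons_val, Pi.smul_apply, smul_eq_mul] at p1 p2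
      have q1 : v 1 / v 2 * τ v 2 - τ v 1 = 0 := by
        apply mul_left_cancel₀ z2''
        apply mul_left_cancel₀ a0
        linear_combination p1
      have q2 : v 0 / v 2 * τ v 2 - τ v 0 = 0 := by
        apply mul_left_cancel₀ z2''
        apply mul_left_cancel₀ b0
        linear_combination -p2
      refine ⟨τ v 2 / v 2, v3ext ?_ ?_ ?_⟩
      · simp; linear_combination -q2
      · simp; linear_combination -q1
      · simp [h2]
  obtain ⟨k, hk⟩ := key
  refine ⟨k, ?_, hk⟩
  rintro rfl
  rw [zero_smul] at hk
  exact hτ hk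

end OD
open scoped MatrixGroups
namespace OD
set_option linter.unusedVariables false
set_option linter.unusedSimpArgs false
set_option linter.style.haveILetI false
open Matrix

lemma dt_mul (M : Matrix (Fin 3) (Fin 3) F47) (u v w : V3) :
    dt (M *ᵥ u) (M *ᵥ v) (M *ᵥ w) = M.det * dt u v w := by
  simp only [dt, Matrix.det_fin_three, Matrix.mulVec, dotProduct, Fin.sum_univ_three]
  ring

lemma coll_matrix {τ : V3 → V3} (hc : Coll τ) :
    ∃ M : SL(3, F47), ∀ v : V3, v ≠ 0 → ∃ k : F47, k ≠ 0 ∧ τ v = k • (M.1 *ᵥ v) := by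
  have n1 : (![1,0,0] : V3) ≠ 0 := ne0.2 (by simp)
  have n2 : (![0,1,0] : V3) ≠ 0 := ne0.2 (by simp)
  have n3 : (![0,0,1] : V3) ≠ 0 := ne0.2 (by simp)
  have n4 : (![1,1,1] : V3) ≠ 0 := ne0.2 (by simp)
  set p := τ ![1,0,0] with hp
  set q := τ ![0,1,0] with hq
  set r := τ ![0,0,1] with hr
  set x := τ ![1,1,1] with hx
  have hD : dt p q r ≠ 0 := fun h => by
    have := (hc.iff _ _ _ n1 n2 n3).2 h
    simp [dt] at this
  have hα : dt x q r ≠ 0 := fun h => by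
    have := (hc.iff _ _ _ n4 n2 n3).2 h
    simp [dt] at this
  have hβ : dt p x r ≠ 0 := fun h => by
    have := (hc.iff _ _ _ n1 n4 n3).2 h
    simp [dt] at this
  have hγ : dt p q x ≠ 0 := fun h => by
    have := (hc.iff _ _ _ n1 n2 n4).2 h
    simp [dt] at this
  set M0 : Matrix (Fin 3) (Fin 3) F47 :=
    !![dt x q r * p 0, dt p x r * q 0, dt p q x * r 0;
       dt x q r * p 1, dt p x r * q 1, dt p q x * r 1;
       dt x q r * p 2, dt p x r * q 2, dt p q x * r 2] with hM0
  have hdet : M0.det = dt x q r * dt p x r * dt p q x * dt p q r := by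
    generalize h1 : dt x q r = A at *
    generalize h2 : dt p x r = B at *
    generalize h3 : dt p q x = C at *
    rw [Matrix.det_fin_three, hM0]
    simp [dt]
    ring
  have hdet0 : M0.det ≠ 0 := by
    rw [hdet]; simp [hα, hβ, hγ, hD]
  have hu : IsUnit M0.det := hdet0.isUnit
  have hinv : ∀ v : V3, M0⁻¹ *ᵥ (M0 *ᵥ v) = v := fun v => by
    rw [Matrix.mulVec_mulVec, Matrix.nonsing_inv_mul _ hu, Matrix.one_mulVec]
  have hinv' : ∀ v : V3, M0 *ᵥ (M0⁻¹ *ᵥ v) = v := fun v => by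
    rw [Matrix.mulVec_mulVec, Matrix.mul_nonsing_inv _ hu, Matrix.one_mulVec]
  have hcσ : Coll (fun v => M0⁻¹ *ᵥ τ v) := by
    constructor
    · intro v hv h
      apply hc.ne v hv
      have h' : M0⁻¹ *ᵥ τ v = 0 := h
      rw [← hinv' (τ v), h', Matrix.mulVec_zero]
    · intro u v w h1 h2 h3
      rw [hc.iff u v w h1 h2 h3, dt_mul]
      have : (M0⁻¹).det ≠ 0 := by
        rw [Matrix.det_nonsing_inv]
        simpa using hdet0
      rw [mul_eq_zero, or_iff_right this]
  have hrig := rigid hcσ (a := (dt x q r)⁻¹) (b := (dt p x r)⁻¹) (c := (dt p q x)⁻¹) (d := (dt p q r)⁻¹)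
    (by
      show M0⁻¹ *ᵥ p = _
      rw [← hinv ![(dt x q r)⁻¹, 0, 0]]
      congr 1
      apply v3ext <;> simp [hM0, Matrix.mulVec, dotProduct, Fin.sum_univ_three] <;> field_simp)
    (by
      show M0⁻¹ *ᵥ q = _
      rw [← hinv ![0, (dt p x r)⁻¹, 0]]
      congr 1
      apply v3ext <;> simp [hM0, Matrix.mulVec, dotProduct, Fin.sum_univ_three] <;> field_simp)
    (by
      show M0⁻¹ *ᵥ r = _
      rw [← hinv ![0, 0, (dt p q x)⁻¹]]
      congr 1
      apply v3ext <;> simp [hM0, Matrix.mulVec, dotProduct, Fin.sum_univ_three] <;> field_simp)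
    (by
      show M0⁻¹ *ᵥ x = _
      rw [← hinv ![(dt p q r)⁻¹, (dt p q r)⁻¹, (dt p q r)⁻¹]]
      congr 1
      apply v3ext <;> simp [hM0, Matrix.mulVec, dotProduct, Fin.sum_univ_three] <;> field_simp <;>
        simp only [dt] <;> ring)
  have hdc : (M0.det ^ 15) ^ 3 * M0.det = 1 := by
    have := ZMod.pow_card_sub_one_eq_one (p := 47) hdet0
    rw [← this]; ring
  refine ⟨⟨M0.det ^ 15 • M0, ?_⟩, ?_⟩
  · rw [Matrix.det_smul]; simpa using hdc
  · intro v hv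
    obtain ⟨k, hk0, hk⟩ := hrig v hv
    have hc0 : M0.det ^ 15 ≠ 0 := pow_ne_zero _ hdet0
    refine ⟨k / M0.det ^ 15, div_ne_zero hk0 hc0, ?_⟩
    have hk' : M0⁻¹ *ᵥ τ v = k • v := hk
    rw [← hinv' (τ v), hk', Matrix.mulVec_smul, Matrix.smul_mulVec, smul_smul, div_mul_cancel₀ _ hc0]

lemma cube_one : ∀ c : F47, c ^ 3 = 1 → c = 1 := by
  intro c h
  have h1 : c ^ 45 = 1 := by
    calc c ^ 45 = (c ^ 3) ^ 15 := by ring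
      _ = 1 := by rw [h, one_pow]
  have h0 : c ≠ 0 := by rintro rfl; norm_num at h
  have := ZMod.pow_card_sub_one_eq_one (p := 47) h0
  calc c = c ^ 45 * c := by rw [h1, one_mul]
    _ = c ^ 46 := by ring
    _ = 1 := this

lemma scalar_unique (M : SL(3, F47)) (h : ∀ v : V3, v ≠ 0 → ∃ k : F47, M.1 *ᵥ v = k • v) : M = 1 := by
  have n1 : (![1,0,0] : V3) ≠ 0 := ne0.2 (by simp)
  have n2 : (![0,1,0] : V3) ≠ 0 := ne0.2 (by simp)
  have n3 : (![0,0,1] : V3) ≠ 0 := ne0.2 (by simp)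
  have n4 : (![1,1,1] : V3) ≠ 0 := ne0.2 (by simp)
  obtain ⟨a, ha⟩ := h _ n1
  obtain ⟨b, hb⟩ := h _ n2
  obtain ⟨c, hc⟩ := h _ n3
  obtain ⟨d, hd⟩ := h _ n4
  have e : ∀ {u v : V3}, u = v → u 0 = v 0 ∧ u 1 = v 1 ∧ u 2 = v 2 := by
    rintro u v rfl; exact ⟨rfl, rfl, rfl⟩
  have ha := e ha
  have hb := e hb
  have hc := e hc
  have hd := e hd
  simp [Matrix.mulVec, dotProduct, Fin.sum_univ_three] at ha hb hc hd
  obtain ⟨a0, a1, a2⟩ := ha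
  obtain ⟨b0, b1, b2⟩ := hb
  obtain ⟨c0, c1, c2⟩ := hc
  obtain ⟨d0, d1, d2⟩ := hd
  have hdet := M.2
  rw [Matrix.det_fin_three] at hdet
  rw [b0, c0, add_zero, add_zero] at d0
  rw [a1, c1, zero_add, add_zero] at d1
  rw [a2, b2, zero_add, zero_add] at d2
  have : d = 1 := cube_one d (by
    rw [← hdet, d0, d1, d2, a1, a2, b0, b2]; ring)
  subst this
  apply Subtype.ext
  ext i j
  clear a0 b1 c2
  fin_cases i <;> fin_cases j <;> simp [a1, a2, b0, b2, c0, c1, d0, d1, d2]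

lemma card_SL : Nat.card SL(3, F47) = 2 ^ 6 * 3 * 23 ^ 2 * 37 * 47 ^ 3 * 61 := by
  have h1 := Matrix.card_GL_field (𝔽 := F47) 3
  have hs : Function.Surjective (Matrix.GeneralLinearGroup.det (n := Fin 3) (R := F47)) := by
    intro u
    refine ⟨Matrix.GeneralLinearGroup.mk' (Matrix.diagonal ![(u : F47), 1, 1]) ?_, ?_⟩
    · rw [Matrix.det_diagonal]
      refine invertibleOfNonzero ?_
      simp [Fin.prod_univ_three]
    · ext
      simp [Matrix.det_diagonal, Fin.prod_univ_three]
  have h2 := Subgroup.index_mul_card (Matrix.GeneralLinearGroup.det (n := Fin 3) (R := F47)).ker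
  rw [Subgroup.index_ker, MonoidHom.range_eq_top.2 hs] at h2
  have h3 : Nat.card (⊤ : Subgroup F47ˣ) = 46 := by
    rw [Subgroup.card_top, Nat.card_eq_fintype_card, ZMod.card_units]
  have h4 : Nat.card (Matrix.GeneralLinearGroup.det (n := Fin 3) (R := F47)).ker = Nat.card SL(3, F47) := by
    refine Nat.card_congr ⟨fun x => ⟨x.1.1, ?_⟩, fun M => ⟨M, ?_⟩, ?_, ?_⟩
    · have := congrArg Units.val (MonoidHom.mem_ker.1 x.2)
      simpa using this
    · rw [MonoidHom.mem_ker]; ext; simp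
    · intro x; ext; rfl
    · intro x; ext; rfl
  rw [h3, h4, h1] at h2
  rw [Fin.prod_univ_three, ZMod.card] at h2
  norm_num at h2
  rw [Nat.card_eq_fintype_card]
  omega

lemma center_SL : Subgroup.center SL(3, F47) = ⊥ := by
  rw [eq_bot_iff]
  intro A hA
  obtain ⟨r, hr, hr'⟩ := Matrix.SpecialLinearGroup.mem_center_iff.1 hA
  rw [Fintype.card_fin] at hr
  rw [Subgroup.mem_bot]
  apply Subtype.ext
  rw [← hr', cube_one r hr]
  simp

lemma PSL_equiv : Nonempty (SL(3, F47) ≃* PSL(3, ZMod 47)) :=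
  ⟨(QuotientGroup.quotientBot (G := SL(3, F47))).symm.trans
    (QuotientGroup.quotientMulEquivOfEq center_SL.symm)⟩

end OD
open scoped MatrixGroups
namespace OD
set_option linter.unusedVariables false
set_option linter.unusedSimpArgs false
set_option linter.style.haveILetI false
open Matrix

/-- explicit dot product -/
def dp (w v : V3) : F47 := w 0 * v 0 + w 1 * v 1 + w 2 * v 2

lemma dt_zero_iff (u v x : V3) : dt u v x = 0 ↔ ∃ w : V3, w ≠ 0 ∧ dp w u = 0 ∧ dp w v = 0 ∧ dp w x = 0 := by
  have h1 : dt u v x = (Matrix.of ![u, v, x]).det := by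
    rw [Matrix.det_fin_three]; simp [dt]; ring
  rw [h1, ← Matrix.exists_mulVec_eq_zero_iff]
  constructor
  · rintro ⟨w, hw, h⟩
    refine ⟨w, hw, ?_, ?_, ?_⟩
    · have := congrFun h 0
      simp [Matrix.mulVec, dotProduct, Fin.sum_univ_three] at this
      rw [dp, ← this]; ring
    · have := congrFun h 1
      simp [Matrix.mulVec, dotProduct, Fin.sum_univ_three] at this
      rw [dp, ← this]; ring
    · have := congrFun h 2
      simp [Matrix.mulVec, dotProduct, Fin.sum_univ_three] at this
      rw [dp, ← this]; ring
  · rintro ⟨w, hw, h1, h2, h3⟩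
    refine ⟨w, hw, v3ext ?_ ?_ ?_⟩
    · simp [Matrix.mulVec, dotProduct, Fin.sum_univ_three]
      rw [← h1, dp]; ring
    · simp [Matrix.mulVec, dotProduct, Fin.sum_univ_three]
      rw [← h2, dp]; ring
    · simp [Matrix.mulVec, dotProduct, Fin.sum_univ_three]
      rw [← h3, dp]; ring

theorem geoB {G P L : Type*} [Group G] [Finite G] [MulAction G P] (I : P → L → Prop)
    (hcard : Nat.card G = 2 ^ 6 * 3 * 23 ^ 2 * 37 * 47 ^ 3 * 61)
    (hL : ∀ (g : G) (l : L), ∃ l', ∀ p, I p l → I (g • p) l')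
    (faith : ∀ g : G, (∀ p : P, g • p = p) → g = 1)
    (Ψ : V3 → P)
    (hΨ : ∀ u v : V3, u ≠ 0 → v ≠ 0 → (Ψ u = Ψ v ↔ ∃ k : F47, k ≠ 0 ∧ u = k • v))
    (hsurj : ∀ p, ∃ v : V3, v ≠ 0 ∧ Ψ v = p)
    (hlin : ∀ w : V3, w ≠ 0 → ∃ l, ∀ v : V3, v ≠ 0 → (dp w v = 0 ↔ I (Ψ v) l))
    (hlin' : ∀ l, ∃ w : V3, w ≠ 0 ∧ ∀ v : V3, v ≠ 0 → (dp w v = 0 ↔ I (Ψ v) l)) :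
    Nonempty (G ≃* SL(3, F47)) := by
  have hcol : ∀ u v x : V3, u ≠ 0 → v ≠ 0 → x ≠ 0 →
      (dt u v x = 0 ↔ ∃ l, I (Ψ u) l ∧ I (Ψ v) l ∧ I (Ψ x) l) := by
    intro u v x hu hv hx
    rw [dt_zero_iff]
    constructor
    · rintro ⟨w, hw, h1, h2, h3⟩
      obtain ⟨l, hl⟩ := hlin w hw
      exact ⟨l, (hl _ hu).1 h1, (hl _ hv).1 h2, (hl _ hx).1 h3⟩
    · rintro ⟨l, h1, h2, h3⟩
      obtain ⟨w, hw, hl⟩ := hlin' l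
      exact ⟨w, hw, (hl _ hu).2 h1, (hl _ hv).2 h2, (hl _ hx).2 h3⟩
  have hcolg : ∀ (g : G) (p q r : P), (∃ l, I p l ∧ I q l ∧ I r l) →
      ∃ l, I (g • p) l ∧ I (g • q) l ∧ I (g • r) l := by
    rintro g p q r ⟨l, h1, h2, h3⟩
    obtain ⟨l', hl'⟩ := hL g l
    exact ⟨l', hl' _ h1, hl' _ h2, hl' _ h3⟩
  have hM : ∀ g : G, ∃ M : SL(3, F47), ∀ v : V3, v ≠ 0 → Ψ (M.1 *ᵥ v) = g • Ψ v := by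
    intro g
    choose τ hτ0 hτ using fun v : V3 => hsurj (g • Ψ v)
    have hc : Coll τ := by
      refine ⟨fun v _ => hτ0 v, fun u v w hu hv hw => ?_⟩
      rw [hcol u v w hu hv hw, hcol _ _ _ (hτ0 u) (hτ0 v) (hτ0 w), hτ, hτ, hτ]
      refine ⟨hcolg g _ _ _, fun h => ?_⟩
      simpa using hcolg g⁻¹ _ _ _ h
    obtain ⟨M, hM⟩ := coll_matrix hc
    refine ⟨M, fun v hv => ?_⟩
    obtain ⟨k, hk, h⟩ := hM v hv
    rw [← hτ, eq_comm]
    refine (hΨ _ _ (hτ0 v) ?_).2 ⟨k, hk, h⟩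
    intro h0
    rw [h0, smul_zero] at h
    exact hτ0 v h
  have hne : ∀ (M : SL(3, F47)) (v : V3), v ≠ 0 → M.1 *ᵥ v ≠ 0 := by
    intro M v hv h
    apply hv
    have : (M⁻¹ * M).1 *ᵥ v = 0 := by
      rw [Matrix.SpecialLinearGroup.coe_mul, ← Matrix.mulVec_mulVec, h, Matrix.mulVec_zero]
    simpa using this
  have huni : ∀ M M' : SL(3, F47), (∀ v : V3, v ≠ 0 → Ψ (M.1 *ᵥ v) = Ψ (M'.1 *ᵥ v)) → M = M' := by
    intro M M' h
    have : M'⁻¹ * M = 1 := by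
      apply scalar_unique
      intro v hv
      obtain ⟨k, -, hk⟩ := (hΨ _ _ (hne M v hv) (hne M' v hv)).1 (h v hv)
      refine ⟨k, ?_⟩
      rw [Matrix.SpecialLinearGroup.coe_mul, ← Matrix.mulVec_mulVec, hk, Matrix.mulVec_smul,
        Matrix.mulVec_mulVec, ← Matrix.SpecialLinearGroup.coe_mul]
      simp
    rwa [inv_mul_eq_one, eq_comm] at this
  choose φ hφ using hM
  have hmul : ∀ g h, φ (g * h) = φ g * φ h := by
    intro g h
    apply huni
    intro v hv
    rw [hφ _ v hv, Matrix.SpecialLinearGroup.coe_mul, ← Matrix.mulVec_mulVec, hφ g _ (hne _ v hv), hφ h v hv,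
      mul_smul]
  have hinj : Function.Injective (MonoidHom.mk' φ hmul) := by
    rw [injective_iff_map_eq_one]
    intro g hg
    apply faith
    intro p
    obtain ⟨v, hv, rfl⟩ := hsurj p
    have hg' : φ g = 1 := hg
    have := hφ g v hv
    rw [hg'] at this
    simpa using this.symm
  have hbij : Function.Bijective (MonoidHom.mk' φ hmul) := by
    rw [Nat.bijective_iff_injective_and_card]
    exact ⟨hinj, hcard.trans card_SL.symm⟩
  exact ⟨MulEquiv.ofBijective _ hbij⟩

end OD
open scoped MatrixGroups
namespace OD
set_option linter.unusedVariables false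
set_option linter.unusedSimpArgs false
set_option linter.style.haveILetI false
open Matrix

theorem geoA {G P L : Type*} [Group G] [Finite G] [MulAction G P] (I : P → L → Prop)
    (hcard : Nat.card G = 2 ^ 6 * 3 * 23 ^ 2 * 37 * 47 ^ 3 * 61)
    (hL : ∀ (g : G) (l : L), ∃ l', ∀ p, I (g • p) l' ↔ I p l)
    (faith : ∀ g : G, (∀ p : P, g • p = p) → g = 1)
    (huniq : ∀ p q l l', p ≠ q → I p l → I q l → I p l' → I q l' → l = l')
    (htwo : ∀ l, ∃ p q, p ≠ q ∧ I p l ∧ I q l)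
    (o : P) (t : F47 → F47 → G) (tadd : ∀ a b a' b', t (a + a') (b + b') = t a b * t a' b')
    (inf : F47 → F47 → P) (m : F47 → F47 → L) (l0 : L)
    (H1 : ∀ a b c d, ¬ (c = 0 ∧ d = 0) → (I (t a b • o) (m c d) ↔ a * d = b * c))
    (H2 : ∀ a b c d, ¬ (a = 0 ∧ b = 0) → ¬ (c = 0 ∧ d = 0) → (I (inf a b) (m c d) ↔ a * d = b * c))
    (H3 : ∀ a b c d, ¬ (a = 0 ∧ b = 0) → ¬ (c = 0 ∧ d = 0) → (inf a b = inf c d ↔ a * d = b * c))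
    (H4 : ∀ a b c d, ¬ (c = 0 ∧ d = 0) → t a b • inf c d = inf c d)
    (H5 : ∀ c d, ¬ (c = 0 ∧ d = 0) → I (inf c d) l0)
    (H5' : ∀ a b, ¬ I (t a b • o) l0)
    (H6 : ∀ p, (∃ a b, t a b • o = p) ∨ ∃ c d, ¬ (c = 0 ∧ d = 0) ∧ inf c d = p) :
    Nonempty (G ≃* SL(3, F47)) := by
  classical
  set Ψ : V3 → P := fun v => if v 2 = 0 then inf (v 0) (v 1) else t (v 0 / v 2) (v 1 / v 2) • o with hΨdef
  have Ψ0 : ∀ v : V3, v 2 = 0 → Ψ v = inf (v 0) (v 1) := fun v h => by simp [hΨdef, h]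
  have Ψ1 : ∀ v : V3, v 2 ≠ 0 → Ψ v = t (v 0 / v 2) (v 1 / v 2) • o := fun v h => by simp [hΨdef, h]
  have hn : ∀ v : V3, v ≠ 0 → v 2 = 0 → ¬ (v 0 = 0 ∧ v 1 = 0) := by
    intro v hv h h'
    rcases ne0.1 hv with h1 | h1 | h1
    · exact h1 h'.1
    · exact h1 h'.2
    · exact h1 h
  have t0 : t 0 0 = 1 := by
    have := tadd 0 0 0 0
    rw [add_zero] at this
    exact left_eq_mul.1 this
  have tinj : ∀ a b a' b', t a b • o = t a' b' • o → a = a' ∧ b = b' := by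
    intro a b a' b' h
    have h1 : t (a' - a) (b' - b) • o = t 0 0 • o := by
      have e : t a' b' = t a b * t (a' - a) (b' - b) := by
        rw [← tadd]; congr 1 <;> ring
      rw [e, mul_smul] at h
      rw [t0, one_smul]
      exact (smul_left_cancel _ h).symm
    have h2 : ∀ c d : F47, ¬ (c = 0 ∧ d = 0) → (a' - a) * d = (b' - b) * c := by
      intro c d hcd
      rw [← H1 _ _ c d hcd, h1, H1 _ _ c d hcd]; simp
    have h3 := h2 0 1 (by simp)
    have h4 := h2 1 0 (by simp)
    constructor
    · linear_combination -h3
    · linear_combination h4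
  have hlin : ∀ w : V3, w ≠ 0 → ∃ l, ∀ v : V3, v ≠ 0 → (dp w v = 0 ↔ I (Ψ v) l) := by
    intro w hw
    by_cases hw01 : w 0 = 0 ∧ w 1 = 0
    · have hw2 : w 2 ≠ 0 := by
        rcases ne0.1 hw with h1 | h1 | h1
        · exact absurd hw01.1 h1
        · exact absurd hw01.2 h1
        · exact h1
      refine ⟨l0, fun v hv => ?_⟩
      rw [dp, hw01.1, hw01.2]
      by_cases h : v 2 = 0
      · rw [Ψ0 v h, h]
        simp [H5 _ _ (hn v hv h)]
      · rw [Ψ1 v h]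
        simp [H5', hw2, h]
    · have hcd : ¬ (w 1 = 0 ∧ - w 0 = 0) := by rw [neg_eq_zero, and_comm]; exact hw01
      obtain ⟨a, b, hab⟩ : ∃ a b : F47, w 0 * a + w 1 * b + w 2 = 0 := by
        by_cases h : w 0 = 0
        · have : w 1 ≠ 0 := fun h' => hw01 ⟨h, h'⟩
          exact ⟨0, -w 2 / w 1, by field_simp; ring⟩
        · exact ⟨-w 2 / w 0, 0, by field_simp; ring⟩
      obtain ⟨l, hl⟩ := hL (t a b) (m (w 1) (-w 0))
      refine ⟨l, fun v hv => ?_⟩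
      by_cases h : v 2 = 0
      · rw [Ψ0 v h, ← H4 a b _ _ (hn v hv h), hl, H2 _ _ _ _ (hn v hv h) hcd, dp, h]
        constructor
        · intro e; linear_combination -e
        · intro e; linear_combination -e
      · have e : t (v 0 / v 2) (v 1 / v 2) = t a b * t (v 0 / v 2 - a) (v 1 / v 2 - b) := by
          rw [← tadd]; congr 1 <;> ring
        rw [Ψ1 v h, e, mul_smul, hl, H1 _ _ _ _ hcd, dp]
        have e2 : w 0 * v 0 + w 1 * v 1 + w 2 * v 2 =
          v 2 * ((v 1 / v 2 - b) * w 1 - (v 0 / v 2 - a) * (- w 0)) := by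
          field_simp
          linear_combination v 2 * hab
        rw [e2, mul_eq_zero, or_iff_right h, sub_eq_zero, eq_comm]
  have hΨ : ∀ u v : V3, u ≠ 0 → v ≠ 0 → (Ψ u = Ψ v ↔ ∃ k : F47, k ≠ 0 ∧ u = k • v) := by
    intro u v hu hv
    constructor
    · intro h
      have hk : (∃ k : F47, u = k • v) → ∃ k : F47, k ≠ 0 ∧ u = k • v := by
        rintro ⟨k, hk⟩
        refine ⟨k, ?_, hk⟩
        rintro rfl
        rw [zero_smul] at hk
        exact hu hk
      apply hk
      by_cases h1 : u 2 = 0 <;> by_cases h2 : v 2 = 0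
      · rw [Ψ0 u h1, Ψ0 v h2, H3 _ _ _ _ (hn u hu h1) (hn v hv h2)] at h
        rcases ne0.1 hv with h' | h' | h'
        · refine ⟨u 0 / v 0, v3ext ?_ ?_ ?_⟩
          · simp [h']
          · simp; field_simp; linear_combination -h
          · simp [h1, h2]
        · refine ⟨u 1 / v 1, v3ext ?_ ?_ ?_⟩
          · simp; field_simp; linear_combination h
          · simp [h']
          · simp [h1, h2]
        · exact absurd h2 h'
      · rw [Ψ0 u h1, Ψ1 v h2] at h
        exact absurd (h ▸ H5 _ _ (hn u hu h1)) (H5' _ _)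
      · rw [Ψ0 v h2, Ψ1 u h1] at h
        exact absurd (h ▸ H5 _ _ (hn v hv h2)) (H5' _ _)
      · rw [Ψ1 u h1, Ψ1 v h2] at h
        obtain ⟨e1, e2⟩ := tinj _ _ _ _ h
        rw [div_eq_div_iff h1 h2] at e1 e2
        refine ⟨u 2 / v 2, v3ext ?_ ?_ ?_⟩
        · simp; field_simp; linear_combination e1
        · simp; field_simp; linear_combination e2
        · simp [h2]
    · rintro ⟨k, hk, rfl⟩
      by_cases h2 : v 2 = 0
      · have h1 : (k • v) 2 = 0 := by simp [h2]
        rw [Ψ0 _ h1, Ψ0 v h2, H3 _ _ _ _ (hn _ hu h1) (hn v hv h2)]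
        simp; ring
      · have h1 : (k • v) 2 ≠ 0 := by simp [h2, hk]
        rw [Ψ1 _ h1, Ψ1 v h2]
        simp only [Pi.smul_apply, smul_eq_mul]
        rw [mul_div_mul_left _ _ hk, mul_div_mul_left _ _ hk]
  have hsurj : ∀ p, ∃ v : V3, v ≠ 0 ∧ Ψ v = p := by
    intro p
    rcases H6 p with ⟨a, b, rfl⟩ | ⟨c, d, hcd, rfl⟩
    · refine ⟨![a, b, 1], ne0.2 (by simp), ?_⟩
      have h1 : (![a, b, 1] : V3) 2 = 1 := rfl
      have h2 : (![a, b, 1] : V3) 2 ≠ 0 := fun h => one_ne_zero (α := F47) (h1.symm.trans h)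
      have h3 := Ψ1 _ h2
      rw [h1, div_one, div_one] at h3
      exact h3
    · refine ⟨![c, d, 0], ?_, ?_⟩
      · intro h
        exact hcd ⟨congrFun h 0, congrFun h 1⟩
      · rw [Ψ0 _ (by simp)]; simp
  refine geoB I hcard (fun g l => ?_) faith Ψ hΨ hsurj hlin ?_
  · obtain ⟨l', h⟩ := hL g l
    exact ⟨l', fun p hp => (h p).2 hp⟩
  · intro l
    obtain ⟨p, q, hpq, hp, hq⟩ := htwo l
    obtain ⟨u, hu, rfl⟩ := hsurj p
    obtain ⟨v, hv, rfl⟩ := hsurj q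
    obtain ⟨w, hw, h1, h2, -⟩ := (dt_zero_iff u v u).1 (by simp [dt]; ring)
    obtain ⟨l', hl'⟩ := hlin w hw
    have := huniq _ _ l l' hpq hp hq ((hl' u hu).1 h1) ((hl' v hv).1 h2)
    subst this
    exact ⟨w, hw, hl'⟩

end OD
open scoped MatrixGroups
namespace OD
open Subgroup
open scoped Pointwise
set_option linter.style.haveILetI false
set_option linter.unusedSectionVars false
set_option linter.unusedVariables false

variable {G : Type*} [Group G] [Finite G]

/-- A flag structure: each Sylow subgroup carries a point and a line. -/
structure Flag (pt ln : Sylow 47 G → Subgroup G) : Prop where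
  pt_smul : ∀ (g : G) R, pt (g • R) = cj g (pt R)
  ln_smul : ∀ (g : G) R, ln (g • R) = cj g (ln R)
  pt_ess : ∀ R, pt R ∈ Ess R
  ln_ess : ∀ R, ln R ∈ Ess R
  ne : ∀ R, pt R ≠ ln R

lemma Flag.swap {pt ln : Sylow 47 G → Subgroup G} (f : Flag pt ln) : Flag ln pt :=
  ⟨f.ln_smul, f.pt_smul, f.ln_ess, f.pt_ess, fun R => (f.ne R).symm⟩

lemma mem_of_norm {R R' : Sylow 47 G} {u : G} (hu : u ∈ (R : Subgroup G))
    (h : u ∈ normalizer (R' : Set G)) : u ∈ (R' : Subgroup G) := by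
  have hp : IsPGroup 47 (zpowers u) := R.2.to_le (zpowers_le.2 hu)
  have h1 := hp.inf_normalizer_sylow R'
  have h2 : u ∈ zpowers u ⊓ normalizer (R' : Set G) := mem_inf.2 ⟨mem_zpowers u, h⟩
  have h3 : u ∈ zpowers u ⊓ (R' : Subgroup G) := h1 ▸ h2
  exact (mem_inf.1 h3).2

section na

lemma exists_flag (N : NA G) (hN : ∀ Q : Sylow 47 G, Nat.card (normalizer (Q : Set G)) = 47 ^ 3 * 2116) :
    ∃ pt ln : Sylow 47 G → Subgroup G, Flag pt ln := by
  obtain ⟨Q⟩ : Nonempty (Sylow 47 G) := inferInstance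
  have h2 := ess_two N hN Q
  rw [Nat.card_coe_set_eq, Set.ncard_eq_two] at h2
  obtain ⟨D, E, hne, hDE⟩ := h2
  have hD : D ∈ Ess Q := by rw [hDE]; simp
  have hE : E ∈ Ess Q := by rw [hDE]; simp
  have hall : ∀ F ∈ Ess Q, F = D ∨ F = E := by rw [hDE]; simp
  have nD := no_swap N hN Q hD hE hne hall
  have nE := no_swap N hN Q hE hD hne.symm (fun F hF => (hall F hF).symm)
  choose c hc using fun R : Sylow 47 G => MulAction.exists_smul_eq G Q R
  have key : ∀ (F : Subgroup G), normalizer (Q : Set G) ≤ normalizer (F : Set G) → ∀ (g : G) R,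
      cj (c (g • R)) F = cj g (cj (c R) F) := by
    intro F hF g R
    have h1 : ((g * c R)⁻¹ * c (g • R)) • Q = Q := by
      rw [mul_smul, hc, inv_smul_eq_iff, mul_smul, hc]
    have h3 := cj_eq_iff.2 (hF (Sylow.smul_eq_iff_mem_normalizer.1 h1))
    have h4 := congrArg (cj (g * c R)) h3
    rwa [← cj_mul, mul_inv_cancel_left, cj_mul] at h4
  refine ⟨fun R => cj (c R) D, fun R => cj (c R) E, key D nD, key E nE, fun R => ?_, fun R => ?_,
    fun R h => hne (cj_inj h)⟩
  · have := Ess_cj (g := c R) hD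
    rwa [hc] at this
  · have := Ess_cj (g := c R) hE
    rwa [hc] at this


lemma pt_eq (N : NA G) {pt ln : Sylow 47 G → Subgroup G} (f : Flag pt ln) {R R' : Sylow 47 G} (h : pt R ≤ R') : pt R' = pt R := by
  obtain ⟨g, hg, rfl⟩ := over_trans N (f.pt_ess R).1 (f.pt_ess R).2.1 h
  rw [f.pt_smul, cj_eq_iff.2 hg]

lemma pt_eq_iff (N : NA G) {pt ln : Sylow 47 G → Subgroup G} (f : Flag pt ln) (R R' : Sylow 47 G) : pt R' = pt R ↔ pt R ≤ R' :=
  ⟨fun h => h ▸ (f.pt_ess R').2.1, pt_eq N f⟩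

lemma pt_inf (N : NA G) {pt ln : Sylow 47 G → Subgroup G} (f : Flag pt ln) {R R' : Sylow 47 G} (h : pt R = pt R') (hne : R ≠ R') : (R ⊓ R' : Subgroup G) = pt R :=
  over_inf N (f.pt_ess R).1 (f.pt_ess R).2.1 (h ▸ (f.pt_ess R').2.1) hne

lemma flag_ext (N : NA G) {pt ln : Sylow 47 G → Subgroup G} (f : Flag pt ln) {R R' : Sylow 47 G} (h : pt R = pt R') (h' : ln R = ln R') : R = R' := by
  by_contra hne
  exact f.ne R ((pt_inf N f h hne).symm.trans (pt_inf N f.swap h' hne))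

lemma cj_of_mem (N : NA G) {pt ln : Sylow 47 G → Subgroup G} (f : Flag pt ln) {R : Sylow 47 G} {u : G} (hu : u ∈ (R : Subgroup G)) : cj u (pt R) = pt R :=
  cj_eq_iff.2 (le_norm_of_sq (cardQ N.toHyp R) (f.pt_ess R).1 (f.pt_ess R).2.1 hu)

lemma pt_ln_inf (N : NA G) {pt ln : Sylow 47 G → Subgroup G} (f : Flag pt ln) (R : Sylow 47 G) : pt R ⊓ ln R = Zc (R : Subgroup G) :=
  sq_inf N R (f.pt_ess R).1 (f.ln_ess R).1 (f.pt_ess R).2.1 (f.ln_ess R).2.1 (f.ne R)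

lemma claimC (N : NA G) {pt ln : Sylow 47 G → Subgroup G} (f : Flag pt ln) {R R' : Sylow 47 G} (h : ln R = ln R') (hne : R ≠ R') {u : G} (hu : u ∈ pt R)
    (hu' : cj u (pt R') = pt R') : u ∈ Zc (R : Subgroup G) := by
  have huR : u ∈ (R : Subgroup G) := (f.pt_ess R).2.1 hu
  have h1 : u • R' = R' := by
    apply flag_ext N f
    · rw [f.pt_smul, hu']
    · rw [f.ln_smul, ← h, cj_of_mem N f.swap huR]
  have h2 : u ∈ (R' : Subgroup G) := mem_of_norm huR (Sylow.smul_eq_iff_mem_normalizer.1 h1)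
  rw [← pt_ln_inf N f, ← pt_inf N f.swap h hne]
  exact mem_inf.2 ⟨hu, mem_inf.2 ⟨huR, h2⟩⟩

lemma exists_Zc (N : NA G) {pt ln : Sylow 47 G → Subgroup G} (f : Flag pt ln) (R : Sylow 47 G) : ∃ z ∈ Zc (R : Subgroup G), z ≠ 1 := by
  obtain ⟨v, hv, hv1⟩ := exists_order47 (D := Zc (R : Subgroup G)) (by rw [cZ N])
  exact ⟨v, hv, by rintro rfl; rw [orderOf_one] at hv1; norm_num at hv1⟩

lemma uniq (N : NA G) {pt ln : Sylow 47 G → Subgroup G} (f : Flag pt ln) {R R' S S' : Sylow 47 G} (hR : ln R = ln R') (hS : ln S = ln S') (h : pt R = pt S)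
    (h' : pt R' = pt S') (hne : R ≠ R') : R = S := by
  obtain ⟨z, hz, hz1⟩ := exists_Zc N f R
  have hz' := hz
  rw [← pt_ln_inf N f, mem_inf, hR] at hz'
  refine over_uniq N (f.pt_ess R).1 (f.pt_ess R).2.1 (h ▸ (f.pt_ess S).2.1) hz ?_ hz1
  refine claimC N f hS ?_ (h ▸ hz'.1) ?_
  · rintro rfl
    exact hne (flag_ext N f (h.trans h'.symm) hR)
  · rw [← h']
    exact cj_of_mem N f ((f.ln_ess R').2.1 hz'.2)

lemma fib_card (N : NA G) {pt ln : Sylow 47 G → Subgroup G} (f : Flag pt ln) (R : Sylow 47 G) : Nat.card {S : Sylow 47 G // pt S = pt R} = 48 := by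
  rw [← (f.pt_ess R).2.2]
  exact Nat.card_congr (Equiv.subtypeEquivRight fun S => pt_eq_iff N f R S)

lemma pts_card (N : NA G) {pt ln : Sylow 47 G → Subgroup G} (f : Flag pt ln) (hN : ∀ Q : Sylow 47 G, Nat.card (normalizer (Q : Set G)) = 47 ^ 3 * 2116) :
    Nat.card {D : Subgroup G // ∃ R, pt R = D} = 2257 := by
  classical
  obtain ⟨Q⟩ : Nonempty (Sylow 47 G) := inferInstance
  have h1 := card_syl_2116 N.toHyp Q (hN Q)
  haveI := Fintype.ofFinite {D : Subgroup G // ∃ R, pt R = D}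
  let φ : Sylow 47 G → {D : Subgroup G // ∃ R, pt R = D} := fun R => ⟨pt R, R, rfl⟩
  rw [← Nat.card_congr (Equiv.sigmaFiberEquiv φ), Nat.card_sigma] at h1
  have h2 : ∀ D : {D : Subgroup G // ∃ R, pt R = D}, Nat.card {R // φ R = D} = 48 := by
    rintro ⟨_, R, rfl⟩
    rw [← fib_card N f R]
    exact Nat.card_congr (Equiv.subtypeEquivRight fun S => by simp [φ])
  rw [Finset.sum_congr rfl fun D _ => h2 D, Finset.sum_const, Finset.card_univ, ← Nat.card_eq_fintype_card,
    smul_eq_mul] at h1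
  omega

lemma card_ne_sub (N : NA G) {pt ln : Sylow 47 G → Subgroup G} (f : Flag pt ln) {α : Type*} [Finite α] (a : α) : Nat.card {x : α // x ≠ a} = Nat.card α - 1 := by
  classical
  haveI := Fintype.ofFinite α
  rw [Nat.card_eq_fintype_card, Nat.card_eq_fintype_card, Fintype.card_subtype_compl, Fintype.card_subtype_eq]

lemma join (N : NA G) {pt ln : Sylow 47 G → Subgroup G} (f : Flag pt ln) (hN : ∀ Q : Sylow 47 G, Nat.card (normalizer (Q : Set G)) = 47 ^ 3 * 2116)
    {R R' : Sylow 47 G} (hne : pt R ≠ pt R') :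
    ∃ S S', pt S = pt R ∧ pt S' = pt R' ∧ ln S = ln S' := by
  classical
  let X := Σ S : {S : Sylow 47 G // pt S = pt R}, {S' : {S' : Sylow 47 G // ln S' = ln S.1} // S' ≠ ⟨S.1, rfl⟩}
  let Y := {p : {D : Subgroup G // ∃ R, pt R = D} // p ≠ ⟨pt R, R, rfl⟩}
  haveI := Fintype.ofFinite {S : Sylow 47 G // pt S = pt R}
  have hX : Nat.card X = 48 * 47 := by
    rw [Nat.card_sigma]
    have : ∀ S : {S : Sylow 47 G // pt S = pt R},
        Nat.card {S' : {S' : Sylow 47 G // ln S' = ln S.1} // S' ≠ ⟨S.1, rfl⟩} = 47 := by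
      intro S
      rw [card_ne_sub N f, fib_card N f.swap]
    rw [Finset.sum_congr rfl fun D _ => this D, Finset.sum_const, Finset.card_univ, ← Nat.card_eq_fintype_card,
      smul_eq_mul, fib_card N f]
  have hY : Nat.card Y = 48 * 47 := by
    rw [card_ne_sub N f, pts_card N f hN]
  let φ : X → Y := fun x => ⟨⟨pt x.2.1.1, _, rfl⟩, fun h => by
    have h1 : pt x.2.1.1 = pt R := congrArg Subtype.val h
    apply x.2.2
    apply Subtype.ext
    exact flag_ext N f (h1.trans x.1.2.symm) x.2.1.2⟩
  have hinj : Function.Injective φ := by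
    rintro ⟨⟨S, hS⟩, ⟨⟨S', hS'⟩, hSne⟩⟩ ⟨⟨T, hT⟩, ⟨⟨T', hT'⟩, hTne⟩⟩ h
    have h1 : pt S' = pt T' := congrArg (fun y => y.1.1) h
    have hne1 : S ≠ S' := fun h => hSne (Subtype.ext h.symm)
    obtain rfl : S = T := uniq N f (R' := S') (S' := T') hS'.symm hT'.symm (hS.trans hT.symm) h1 hne1
    obtain rfl : S' = T' := flag_ext N f h1 (hS'.trans hT'.symm)
    rfl
  have hbij : Function.Bijective φ := by
    rw [Nat.bijective_iff_injective_and_card]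
    exact ⟨hinj, hX.trans hY.symm⟩
  obtain ⟨⟨S, S'⟩, h⟩ := hbij.2 ⟨⟨pt R', R', rfl⟩, fun h => hne (congrArg Subtype.val h).symm⟩
  exact ⟨S.1, S'.1.1, S.2, congrArg (fun y => y.1.1) h, S'.1.2.symm⟩

end na
end OD
open scoped MatrixGroups
namespace OD
open Subgroup
open scoped Pointwise
set_option linter.style.haveILetI false
set_option linter.unusedSectionVars false
set_option linter.unusedVariables false

variable {G : Type*} [Group G] [Finite G]

lemma coords {E : Subgroup G} (hE : Nat.card E = 47 ^ 2) (h47 : ∀ u ∈ E, u ^ 47 = 1) :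
    ∃ t : F47 → F47 → G, (∀ a b a' b', t (a + a') (b + b') = t a b * t a' b') ∧
      (∀ a b, t a b ∈ E) ∧ (∀ u ∈ E, ∃ a b, t a b = u) ∧ (∀ a b, t a b = 1 → a = 0 ∧ b = 0) := by
  letI : CommGroup E := { (inferInstance : Group E) with
    mul_comm := fun x y => Subtype.ext (comm_of_card_sq hE x.2 y.2) }
  letI : Module (ZMod 47) (Additive E) := AddCommGroup.zmodModule (n := 47) (fun x => by
    apply Additive.toMul.injective
    apply Subtype.ext
    rw [toMul_nsmul]
    exact h47 _ (Additive.toMul x).2)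
  haveI : Fintype (Additive E) := Fintype.ofFinite _
  haveI : Module.Finite (ZMod 47) (Additive E) := Module.Finite.of_finite
  have hr : Module.finrank (ZMod 47) (Additive E) = 2 := by
    have h1 := Module.card_eq_pow_finrank (K := ZMod 47) (V := Additive E)
    have h2 : Fintype.card (Additive E) = 47 ^ 2 := by
      rw [← Nat.card_eq_fintype_card]; exact hE
    rw [h2, ZMod.card] at h1
    exact (Nat.pow_right_injective (le_refl _ |>.trans (by norm_num : 2 ≤ 47)) h1).symm
  let e : (Fin 2 → ZMod 47) ≃ₗ[ZMod 47] Additive E :=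
    (LinearEquiv.ofFinrankEq _ _ (by rw [hr]; simp))
  refine ⟨fun a b => ((Additive.toMul (e ![a, b]) : E) : G), ?_, fun a b => SetLike.coe_mem _, ?_, ?_⟩
  · intro a b a' b'
    have : (![a + a', b + b'] : Fin 2 → ZMod 47) = ![a, b] + ![a', b'] := by simp
    beta_reduce
    rw [this, map_add, toMul_add]
    rfl
  · intro u hu
    obtain ⟨v, hv⟩ := e.surjective (Additive.ofMul (⟨u, hu⟩ : E))
    refine ⟨v 0, v 1, ?_⟩
    have : (![v 0, v 1] : Fin 2 → ZMod 47) = v := by ext i; fin_cases i <;> rfl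
    beta_reduce
    rw [this, hv]; rfl
  · intro a b h
    have h1 : e ![a, b] = 0 := by
      apply Additive.toMul.injective
      apply Subtype.ext
      exact h
    rw [LinearEquiv.map_eq_zero_iff] at h1
    exact ⟨congrFun h1 0, congrFun h1 1⟩

section na

lemma exists_other (N : NA G) {pt ln : Sylow 47 G → Subgroup G} (f : Flag pt ln) (R : Sylow 47 G) : ∃ R', ln R' = ln R ∧ R ≠ R' := by
  by_contra hcon
  push Not at hcon
  have h1 := fib_card N f.swap R
  have : Subsingleton {S : Sylow 47 G // ln S = ln R} :=
    ⟨fun a b => Subtype.ext ((hcon a a.2).symm.trans (hcon b b.2))⟩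
  have := Finite.card_le_one_iff_subsingleton.2 this
  omega

lemma semireg (N : NA G) {pt ln : Sylow 47 G → Subgroup G} (f : Flag pt ln) (hN : ∀ Q : Sylow 47 G, Nat.card (normalizer (Q : Set G)) = 47 ^ 3 * 2116)
    {R0 O : Sylow 47 G} (hO : ¬ ∃ S, pt S = pt O ∧ ln S = ln R0) {u : G} (hu : u ∈ ln R0)
    (huO : cj u (pt O) = pt O) : u = 1 := by
  have key : ∀ R, ln R = ln R0 → u ∈ Zc (R : Subgroup G) := by
    intro R hR
    have huR' : u ∈ ln R := hR ▸ hu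
    have huR : u ∈ (R : Subgroup G) := (f.ln_ess R).2.1 huR'
    have hne : pt R ≠ pt O := fun h => hO ⟨R, h, hR⟩
    obtain ⟨S, S', h1, h2, h3⟩ := join N f hN hne
    have hSS : S ≠ S' := by rintro rfl; exact hne (h1.symm.trans h2)
    have hS : S = u • S := by
      refine uniq N f (R' := S') (S' := u • S') h3 ?_ ?_ ?_ hSS
      · rw [f.ln_smul, f.ln_smul, h3]
      · rw [f.pt_smul, h1, cj_of_mem N f huR]
      · rw [f.pt_smul, h2, huO]
    have huS : u ∈ (S : Subgroup G) := mem_of_norm huR (Sylow.smul_eq_iff_mem_normalizer.1 hS.symm)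
    have hRS : R ≠ S := by
      rintro rfl
      exact hO ⟨S', h2, h3.symm.trans hR⟩
    rw [← pt_ln_inf N f, ← pt_inf N f h1.symm hRS]
    exact mem_inf.2 ⟨mem_inf.2 ⟨huR, huS⟩, huR'⟩
  by_contra hu1
  obtain ⟨R', hR', hne⟩ := exists_other N f R0
  exact hne (over_uniq N (f.ln_ess R0).1 (f.ln_ess R0).2.1 (hR' ▸ (f.ln_ess R').2.1) (key R0 rfl) (key R' hR') hu1)

lemma faith (N : NA G) {pt ln : Sylow 47 G → Subgroup G} (f : Flag pt ln) (hN : ∀ Q : Sylow 47 G, Nat.card (normalizer (Q : Set G)) = 47 ^ 3 * 2116)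
    {g : G} (hg : ∀ R, cj g (pt R) = pt R) : g = 1 := by
  have hfix : ∀ R : Sylow 47 G, g • R = R := by
    intro R
    obtain ⟨R', hR', hne⟩ := exists_other N f R
    exact (uniq N f (R' := R') (S' := g • R') hR'.symm (by rw [f.ln_smul, f.ln_smul, hR'])
      (by rw [f.pt_smul, hg]) (by rw [f.pt_smul, hg]) hne).symm
  set K : Subgroup G := (MulAction.toPermHom G (Sylow 47 G)).ker with hK
  have memK : ∀ x, x ∈ K ↔ ∀ R : Sylow 47 G, x • R = R := by
    intro x
    rw [hK, MonoidHom.mem_ker, Equiv.ext_iff]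
    rfl
  obtain ⟨R⟩ : Nonempty (Sylow 47 G) := inferInstance
  have h47 : ¬ 47 ∣ Nat.card K := by
    intro h
    obtain ⟨x, hxK, hx⟩ := exists_order47 h
    have hx1 : x ≠ 1 := by rintro rfl; rw [orderOf_one] at hx; norm_num at hx
    obtain ⟨Q, hQ⟩ := order47_of_mem N.toHyp default hx
    have hall : ∀ S : Sylow 47 G, x ∈ (S : Subgroup G) := fun S =>
      mem_of_norm (R := Q) hQ (Sylow.smul_eq_iff_mem_normalizer.1 ((memK x).1 hxK S))
    have hZ : ∀ S : Sylow 47 G, x ∈ Zc (S : Subgroup G) := by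
      intro S
      obtain ⟨S', hS', hne⟩ := exists_other N f S
      obtain ⟨S'', hS'', hne'⟩ := exists_other N f.swap S
      rw [← pt_ln_inf N f, ← pt_inf N f.swap hS'.symm hne, ← pt_inf N f hS''.symm hne']
      exact mem_inf.2 ⟨mem_inf.2 ⟨hall _, hall _⟩, mem_inf.2 ⟨hall _, hall _⟩⟩
    obtain ⟨R', hR', hne⟩ := exists_other N f R
    exact hne (over_uniq N (f.ln_ess R).1 (f.ln_ess R).2.1 (hR' ▸ (f.ln_ess R').2.1) (hZ R) (hZ R') hx1)
  have hKd : Nat.card K ∣ 2116 := by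
    have h1 : K ≤ normalizer (R : Set G) := fun x hx => Sylow.smul_eq_iff_mem_normalizer.1 ((memK x).1 hx R)
    have h2 := card_dvd_of_le h1
    rw [hN] at h2
    refine Nat.Coprime.dvd_of_dvd_mul_left (Nat.Coprime.pow_right 3 ?_) h2
    exact ((Nat.Prime.coprime_iff_not_dvd (by norm_num)).2 h47).symm
  obtain ⟨c, hc⟩ := exists_prime_orderOf_dvd_card' (G := G) 37 (by rw [cardG N.toHyp]; norm_num)
  have hR37 : IsPGroup 37 (zpowers c) := IsPGroup.of_card (n := 1) (by rw [Nat.card_zpowers, hc, pow_one])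
  have hmod := fix_mod (zpowers c) K hR37 (by rw [normalizer_eq_top]; exact le_top)
  have h1 : Nat.card (K ⊓ centralizer (zpowers c : Set G) : Subgroup G) = 1 := by
    have h2 := (card_dvd_of_le (inf_le_left : K ⊓ centralizer (zpowers c : Set G) ≤ K)).trans hKd
    have h3 : Nat.card (K ⊓ centralizer (zpowers c : Set G) : Subgroup G) ∣ 37 * 61 := by
      refine (card_dvd_of_le ?_).trans (N.cent37 c hc)
      refine inf_le_right.trans (centralizer_le ?_)
      simp
    have := Nat.dvd_gcd h2 h3
    rw [show Nat.gcd 2116 (37 * 61) = 1 by norm_num] at this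
    exact Nat.dvd_one.1 this
  rw [h1] at hmod
  have hone : Nat.card K = 1 := by
    have : ∀ n ∈ Nat.divisors 2116, n ≡ 1 [MOD 37] → n = 1 := by
      decide +kernel
    exact this _ (Nat.mem_divisors.2 ⟨hKd, by norm_num⟩) hmod
  have := (Subgroup.eq_bot_of_card_eq K hone) ▸ (memK g).2 hfix
  exact this

end na
end OD
open scoped MatrixGroups
namespace OD
open Subgroup
open scoped Pointwise
set_option linter.style.haveILetI false
set_option linter.unusedSectionVars false
set_option linter.unusedVariables false

variable {G : Type*} [Group G] [Finite G]

section na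

lemma affine_card (N : NA G) {pt ln : Sylow 47 G → Subgroup G} (f : Flag pt ln) (hN : ∀ Q : Sylow 47 G, Nat.card (normalizer (Q : Set G)) = 47 ^ 3 * 2116)
    (R0 : Sylow 47 G) : Nat.card {p : {D : Subgroup G // ∃ R, pt R = D} //
      ¬ ∃ S, pt S = p.1 ∧ ln S = ln R0} = 47 * 47 := by
  classical
  haveI := Fintype.ofFinite {D : Subgroup G // ∃ R, pt R = D}
  have h1 : Nat.card {p : {D : Subgroup G // ∃ R, pt R = D} // ∃ S, pt S = p.1 ∧ ln S = ln R0} = 48 := by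
    rw [← fib_card N f.swap R0]
    refine (Nat.card_congr (Equiv.ofBijective
      (fun S : {S : Sylow 47 G // ln S = ln R0} => ⟨⟨pt S.1, S.1, rfl⟩, S.1, rfl, S.2⟩) ⟨?_, ?_⟩)).symm
    · intro S S' h
      have h1 : pt S.1 = pt S'.1 := congrArg (fun y => y.1.1) h
      exact Subtype.ext (flag_ext N f h1 (S.2.trans S'.2.symm))
    · rintro ⟨⟨_, R, rfl⟩, S, h1, h2⟩
      exact ⟨⟨S, h2⟩, Subtype.ext (Subtype.ext h1)⟩
  have h2 := pts_card N f hN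
  rw [Nat.card_eq_fintype_card] at h1 h2 ⊢
  rw [Fintype.card_subtype_compl, h1, h2]

theorem plane (N : NA G) {pt ln : Sylow 47 G → Subgroup G} (f : Flag pt ln) (hN : ∀ Q : Sylow 47 G, Nat.card (normalizer (Q : Set G)) = 47 ^ 3 * 2116)
    (hcard : Nat.card G = 2 ^ 6 * 3 * 23 ^ 2 * 37 * 47 ^ 3 * 61) : Nonempty (G ≃* SL(3, F47)) := by
  classical
  obtain ⟨R0⟩ : Nonempty (Sylow 47 G) := inferInstance
  have hE := (f.ln_ess R0).1
  have hcov : ∀ u ∈ ln R0, u ≠ 1 → ∃ R : Sylow 47 G, ln R = ln R0 ∧ u ∈ Zc (R : Subgroup G) := by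
    intro u hu hu1
    obtain ⟨R, hR, hz⟩ := (over_ncard N hE).2 (f.ln_ess R0).2.2 u hu hu1
    exact ⟨R, pt_eq N f.swap hR, hz⟩
  have h47 : ∀ u ∈ ln R0, u ^ 47 = 1 := by
    intro u hu
    by_cases hu1 : u = 1
    · rw [hu1, one_pow]
    obtain ⟨R, hR, hz⟩ := hcov u hu hu1
    have := pow_card_eq_one' (x := (⟨u, hz⟩ : Zc (R : Subgroup G)))
    rw [cZ N R] at this
    exact congrArg Subtype.val this
  obtain ⟨t, tadd, tmem, tsurj, tinj⟩ := coords hE h47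
  have t0 : t 0 0 = 1 := by
    have := tadd 0 0 0 0
    rw [add_zero] at this
    exact left_eq_mul.1 this
  have tpow : ∀ (n : ℕ) a b, t (n * a) (n * b) = t a b ^ n := by
    intro n a b
    induction n with
    | zero => simp [t0]
    | succ n ih =>
      rw [pow_succ, ← ih, ← tadd]
      push_cast
      congr 1 <;> ring
  have scal : ∀ a b c d, ¬ (c = 0 ∧ d = 0) → a * d = b * c → ∃ n : ℕ, t a b = t c d ^ n := by
    intro a b c d hcd h
    have : ∃ k : F47, a = k * c ∧ b = k * d := by
      by_cases hc : c = 0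
      · have hd : d ≠ 0 := fun hd => hcd ⟨hc, hd⟩
        refine ⟨b / d, ?_, ?_⟩
        · field_simp; exact h
        · field_simp
      · refine ⟨a / c, ?_, ?_⟩
        · field_simp
        · field_simp; exact h.symm
    obtain ⟨k, rfl, rfl⟩ := this
    refine ⟨k.val, ?_⟩
    rw [← tpow, ZMod.natCast_zmod_val]
  -- an affine point
  obtain ⟨O, hO⟩ : ∃ O : Sylow 47 G, ¬ ∃ S, pt S = pt O ∧ ln S = ln R0 := by
    have h1 := affine_card N f hN R0
    have : Nonempty {p : {D : Subgroup G // ∃ R, pt R = D} // ¬ ∃ S, pt S = p.1 ∧ ln S = ln R0} := by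
      by_contra hc
      rw [not_nonempty_iff] at hc
      rw [Nat.card_of_isEmpty] at h1
      norm_num at h1
    obtain ⟨⟨_, O, rfl⟩, hO⟩ := this
    exact ⟨O, hO⟩
  have hr : ∀ c d, ∃ R : Sylow 47 G, ln R = ln R0 ∧ (¬ (c = 0 ∧ d = 0) → t c d ∈ Zc (R : Subgroup G)) := by
    intro c d
    by_cases h : c = 0 ∧ d = 0
    · exact ⟨R0, rfl, fun h' => absurd h h'⟩
    · obtain ⟨R, hR, hz⟩ := hcov (t c d) (tmem c d) (fun h' => h (tinj c d h'))
      exact ⟨R, hR, fun _ => hz⟩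
  choose r hrl hrz using hr
  have hrO : ∀ c d, pt (r c d) ≠ pt O := fun c d h => hO ⟨r c d, h, hrl c d⟩
  choose s s' hs hs' hss using fun c d => join N f hN (hrO c d)
  have hsl : ∀ c d, ln (s c d) ≠ ln R0 := fun c d h => hO ⟨s' c d, hs' c d, (hss c d).symm.trans h⟩
  have over_uniq' : ∀ {R R' : Sylow 47 G} {z : G}, ln R = ln R0 → ln R' = ln R0 → z ∈ Zc (R : Subgroup G) →
      z ∈ Zc (R' : Subgroup G) → z ≠ 1 → R = R' := by
    intro R R' z h h' hz hz' h1
    exact over_uniq N hE (h ▸ (f.ln_ess R).2.1) (h' ▸ (f.ln_ess R').2.1) hz hz' h1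
  have req : ∀ a b c d, ¬ (a = 0 ∧ b = 0) → ¬ (c = 0 ∧ d = 0) → (r a b = r c d ↔ a * d = b * c) := by
    intro a b c d hab hcd
    have n1 : t a b ≠ 1 := fun h => hab (tinj _ _ h)
    have n2 : t c d ≠ 1 := fun h => hcd (tinj _ _ h)
    constructor
    · intro h
      have z1 := hrz a b hab
      have z2 := hrz c d hcd
      rw [h] at z1
      have ho : orderOf (t c d) = 47 := orderOf_eq_prime (h47 _ (tmem c d)) n2
      have he : zpowers (t c d) = Zc (r c d : Subgroup G) :=
        eq_of_mem_47 (by rw [Nat.card_zpowers, ho]) (cZ N _) (mem_zpowers _) z2 n2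
      rw [← he, ← mem_powers_iff_mem_zpowers] at z1
      obtain ⟨n, hn⟩ := z1
      have hn : t c d ^ n = t a b := hn
      have h2 : t (a - n * c) (b - n * d) = 1 := by
        have h3 : t a b = t (a - n * c) (b - n * d) * t (n * c) (n * d) := by
          rw [← tadd]; congr 1 <;> ring
        rw [tpow, hn] at h3
        exact right_eq_mul.1 h3
      obtain ⟨e1, e2⟩ := tinj _ _ h2
      linear_combination d * e1 - c * e2
    · intro h
      obtain ⟨n, hn⟩ := scal a b c d hcd h
      refine over_uniq' (hrl a b) (hrl c d) (hrz a b hab) ?_ n1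
      rw [hn]
      exact pow_mem (hrz c d hcd) n
  have common : ∀ a b c d X, pt X = pt (r a b) → ln X = ln (s c d) → r a b = r c d := by
    intro a b c d X h1 h2
    by_contra hne
    have := uniq N f (R' := r c d) (S' := s c d) ((hrl a b).trans (hrl c d).symm) h2 h1.symm (hs c d).symm hne
    rw [← this, hrl] at h2
    exact hsl c d h2.symm
  have lemA : ∀ a b c d, ¬ (c = 0 ∧ d = 0) → a * d = b * c →
      ∃ S, pt S = cj (t a b) (pt O) ∧ ln S = ln (s c d) := by
    intro a b c d hcd h
    obtain ⟨n, hn⟩ := scal a b c d hcd h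
    have hz : t a b ∈ Zc (r c d : Subgroup G) := by rw [hn]; exact pow_mem (hrz c d hcd) n
    rw [← pt_ln_inf N f, mem_inf] at hz
    have hzs : t a b ∈ (s c d : Subgroup G) := (f.pt_ess _).2.1 ((hs c d).symm ▸ hz.1)
    refine ⟨t a b • s' c d, ?_, ?_⟩
    · rw [f.pt_smul, hs']
    · rw [f.ln_smul, ← hss, cj_of_mem N f.swap hzs]
  letI act : MulAction G {D : Subgroup G // ∃ R, pt R = D} :=
    { smul := fun g p => ⟨cj g p.1, by
        obtain ⟨_, R, rfl⟩ := p
        exact ⟨g • R, f.pt_smul g R⟩⟩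
      one_smul := fun p => Subtype.ext (cj_one _)
      mul_smul := fun g h p => Subtype.ext (cj_mul g h _) }
  have act_val : ∀ (g : G) (p : {D : Subgroup G // ∃ R, pt R = D}), (g • p).1 = cj g p.1 := fun _ _ => rfl
  let I : {D : Subgroup G // ∃ R, pt R = D} → {E : Subgroup G // ∃ R, ln R = E} → Prop :=
    fun p l => ∃ S, pt S = p.1 ∧ ln S = l.1
  have hI : ∀ p l, I p l ↔ ∃ S, pt S = p.1 ∧ ln S = l.1 := fun _ _ => Iff.rfl
  have H5' : ∀ a b, ¬ ∃ S, pt S = cj (t a b) (pt O) ∧ ln S = ln R0 := by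
    rintro a b ⟨S, h1, h2⟩
    apply hO
    refine ⟨(t a b)⁻¹ • S, ?_, ?_⟩
    · rw [f.pt_smul, h1, ← cj_mul, inv_mul_cancel, cj_one]
    · rw [f.ln_smul, h2]
      exact cj_of_mem N f.swap ((f.ln_ess R0).2.1 (inv_mem (tmem a b)))
  have tO : ∀ a b a' b', cj (t a b) (pt O) = cj (t a' b') (pt O) → a = a' ∧ b = b' := by
    intro a b a' b' h
    have h3 : t a' b' = t a b * t (a' - a) (b' - b) := by
      rw [← tadd]; congr 1 <;> ring
    rw [h3, cj_mul] at h
    have h4 := semireg N f hN hO (tmem _ _) (cj_inj h).symm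
    obtain ⟨e1, e2⟩ := tinj _ _ h4
    exact ⟨(sub_eq_zero.1 e1).symm, (sub_eq_zero.1 e2).symm⟩
  refine geoA I hcard ?hL ?faith ?huniq ?htwo ⟨pt O, O, rfl⟩ t tadd (fun c d => ⟨pt (r c d), _, rfl⟩)
    (fun c d => ⟨ln (s c d), _, rfl⟩) ⟨ln R0, R0, rfl⟩ ?H1 ?H2 ?H3 ?H4 ?H5 ?H5' ?H6
  case hL =>
    rintro g ⟨_, R, rfl⟩
    refine ⟨⟨ln (g • R), _, rfl⟩, fun p => ?_⟩
    rw [hI, hI, act_val]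
    constructor
    · rintro ⟨S, h1, h2⟩
      refine ⟨g⁻¹ • S, ?_, ?_⟩
      · rw [f.pt_smul, h1, ← cj_mul, inv_mul_cancel, cj_one]
      · rw [f.ln_smul, h2]
        show cj g⁻¹ (ln (g • R)) = _
        rw [f.ln_smul, ← cj_mul, inv_mul_cancel, cj_one]
    · rintro ⟨S, h1, h2⟩
      refine ⟨g • S, ?_, ?_⟩
      · rw [f.pt_smul, h1]
      · rw [f.ln_smul, h2]
        exact (f.ln_smul g R).symm
  case faith =>
    intro g hg
    exact faith N f hN fun R => congrArg Subtype.val (hg ⟨pt R, R, rfl⟩)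
  case huniq =>
    rintro p q l l' hpq ⟨S1, a1, b1⟩ ⟨S2, a2, b2⟩ ⟨S3, a3, b3⟩ ⟨S4, a4, b4⟩
    apply Subtype.ext
    have hne : S1 ≠ S2 := by
      rintro rfl
      exact hpq (Subtype.ext (a1.symm.trans a2))
    have := uniq N f (R' := S2) (S' := S4) (b1.trans b2.symm) (b3.trans b4.symm) (a1.trans a3.symm)
      (a2.trans a4.symm) hne
    rw [← b1, ← b3, this]
  case htwo =>
    rintro ⟨_, R, rfl⟩
    obtain ⟨R', hR', hne⟩ := exists_other N f R
    refine ⟨⟨pt R, R, rfl⟩, ⟨pt R', R', rfl⟩, fun h => ?_, ⟨R, rfl, rfl⟩, ⟨R', rfl, hR'⟩⟩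
    exact hne (flag_ext N f (congrArg Subtype.val h) hR'.symm)
  case H1 =>
    intro a b c d hcd
    rw [hI, act_val]
    refine ⟨?_, lemA a b c d hcd⟩
    rintro ⟨Y', h1, h2⟩
    by_cases hab : a = 0 ∧ b = 0
    · rw [hab.1, hab.2]; ring
    obtain ⟨X', h3, h4⟩ := lemA a b a b hab (mul_comm a b)
    have hXX : s' a b ≠ X' := by
      rintro rfl
      have : cj (t 0 0) (pt O) = cj (t a b) (pt O) := by
        rw [t0, cj_one]; exact (hs' a b).symm.trans h3
      obtain ⟨e1, e2⟩ := tO _ _ _ _ this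
      exact hab ⟨e1.symm, e2.symm⟩
    have := uniq N f (R' := X') (S' := Y') ((hss a b).symm.trans h4.symm) ((hss c d).symm.trans h2.symm)
      ((hs' a b).trans (hs' c d).symm) (h3.trans h1.symm) hXX
    rw [← req a b c d hab hcd]
    refine common a b c d (s a b) (hs a b) ?_
    rw [hss, hss, this]
  case H2 =>
    intro a b c d hab hcd
    rw [hI, ← req a b c d hab hcd]
    constructor
    · rintro ⟨X, h1, h2⟩
      exact common a b c d X h1 h2
    · intro h
      exact ⟨s c d, by rw [hs, h], rfl⟩
  case H3 =>
    intro a b c d hab hcd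
    rw [← req a b c d hab hcd]
    constructor
    · intro h
      exact flag_ext N f (congrArg Subtype.val h) ((hrl a b).trans (hrl c d).symm)
    · intro h
      apply Subtype.ext
      show pt (r a b) = pt (r c d)
      rw [h]
  case H4 =>
    intro a b c d hcd
    apply Subtype.ext
    exact cj_of_mem N f ((f.ln_ess _).2.1 ((hrl c d).symm ▸ tmem a b))
  case H5 =>
    intro c d hcd
    exact ⟨r c d, rfl, hrl c d⟩
  case H5' => exact H5'
  case H6 =>
    intro p
    by_cases hp : ∃ S, pt S = p.1 ∧ ln S = ln R0
    · right
      obtain ⟨S, h1, h2⟩ := hp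
      obtain ⟨z, hz, hz1⟩ := exists_Zc N f S
      have hz' := hz
      rw [← pt_ln_inf N f, mem_inf, h2] at hz'
      obtain ⟨a, b, rfl⟩ := tsurj z hz'.2
      have hab : ¬ (a = 0 ∧ b = 0) := by
        rintro ⟨rfl, rfl⟩
        exact hz1 t0
      refine ⟨a, b, hab, Subtype.ext ?_⟩
      rw [← h1, over_uniq' (hrl a b) h2 (hrz a b hab) hz hz1]
    · left
      let φ : F47 × F47 → {p : {D : Subgroup G // ∃ R, pt R = D} // ¬ ∃ S, pt S = p.1 ∧ ln S = ln R0} :=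
        fun v => ⟨t v.1 v.2 • ⟨pt O, O, rfl⟩, H5' v.1 v.2⟩
      have hinj : Function.Injective φ := by
        intro v w h
        have h1 : cj (t v.1 v.2) (pt O) = cj (t w.1 w.2) (pt O) := congrArg (fun y => y.1.1) h
        obtain ⟨e1, e2⟩ := tO _ _ _ _ h1
        exact Prod.ext e1 e2
      have hbij : Function.Bijective φ := by
        rw [Nat.bijective_iff_injective_and_card]
        refine ⟨hinj, ?_⟩
        rw [affine_card N f hN R0, Nat.card_prod, Nat.card_eq_fintype_card, ZMod.card]
      obtain ⟨v, hv⟩ := hbij.2 ⟨p, hp⟩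
      exact ⟨v.1, v.2, congrArg Subtype.val hv⟩

end na

theorem main (H : Hyp G) : Nonempty (G ≃* PSL(3, ZMod 47)) := by
  obtain ⟨N, hN | hN⟩ := na_of_hyp H
  · obtain ⟨pt, ln, f⟩ := exists_flag N hN
    obtain ⟨e⟩ := plane N f hN (by rw [H.card, ordG])
    obtain ⟨e'⟩ := PSL_equiv
    exact ⟨e.trans e'⟩
  · exact (step4 N hN).elim

end OD
theorem L3_47_OD_characterizable (G : Type*) [Group G] [Finite G]
    (hcard : Nat.card G = 2 ^ 6 * 3 * 23 ^ 2 * 37 * 47 ^ 3 * 61)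
    (hdeg2 : primeGraphDeg G 2 = 3)
    (hdeg3 : primeGraphDeg G 3 = 2)
    (hdeg23 : primeGraphDeg G 23 = 3)
    (hdeg37 : primeGraphDeg G 37 = 1)
    (hdeg47 : primeGraphDeg G 47 = 2)
    (hdeg61 : primeGraphDeg G 61 = 1) :
    Nonempty (G ≃* PSL(3, ZMod 47)) := by
  exact OD.main (OD.hyp_of_pattern hcard hdeg2 hdeg23 hdeg37 hdeg47 hdeg61)
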